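/- Let F be a real-analytic function on a connected open set U ⊆ ℝ^d containing [0,1]^d, let D be a semi-analytic subset of [0,1]^d, and let L be an admissible differential operator of type (α,β) with (α,β) ≠ (1,(0,…,0)). Then there exists a finite constant C such that for every c > 0 with |LF(x)| ≥ c for all x ∈ D and every real number λ ≠ 0, |∫_D e^{iλF(x)} dx| ≤ C · |λ|^{−α/(|β|+1−α)} · c^{−1/(|β|+1−α)}. -/

import Mathlib

open MeasureTheory
open scoped ENNReal

/-- The partial derivative `∂/∂x_i` of a scalar function on `ℝ^d`. -/
noncomputable def pderiv' {d : ℕ} (i : Fin d) (f : (Fin d → ℝ) → ℝ) : (Fin d → ℝ) → ℝ :=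
  fun x => fderiv ℝ f x (Pi.single i 1)

/-- The classes `𝓛^{α,β}` of admissible differential operators of type `(α,β)`:
`𝓛^{1,0}` contains exactly the identity, and `L ∈ 𝓛^{α,β}` when there are distinct indices
`i_1,…,i_n` and operators `L_k ∈ 𝓛^{α_k,β_k}` with `α = Σ α_k`,
`β = Σ β_k + e_{i_1} + ⋯ + e_{i_n}` and `L F = det [∂_{x_{i_r}} (L_k F)]` for all smooth `F`. -/
inductive IsAdmissible (d : ℕ) :
    ℕ → (Fin d → ℕ) → (((Fin d → ℝ) → ℝ) → (Fin d → ℝ) → ℝ) → Prop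
  | id : IsAdmissible d 1 0 (fun F => F)
  | det (n : ℕ) (hn : 1 ≤ n) (hnd : n ≤ d) (i : Fin n → Fin d)
      (hi : Function.Injective i) (αs : Fin n → ℕ) (βs : Fin n → Fin d → ℕ)
      (Ls : Fin n → ((Fin d → ℝ) → ℝ) → (Fin d → ℝ) → ℝ)
      (hLs : ∀ k, IsAdmissible d (αs k) (βs k) (Ls k))
      (L : ((Fin d → ℝ) → ℝ) → (Fin d → ℝ) → ℝ)
      (hL : ∀ F : (Fin d → ℝ) → ℝ, ∀ x, ContDiffAt ℝ (⊤ : ℕ∞) F x →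
        L F x = (Matrix.of fun r k : Fin n => pderiv' (i r) (Ls k F) x).det) :
      IsAdmissible d (∑ k, αs k) ((∑ k, βs k) + ∑ k, Pi.single (i k) 1) L

/-- `D` is semi-analytic relative to the open set `U`: a finite union of sets defined by
finitely many real-analytic equations and strict inequalities. -/
def IsSemianalytic {d : ℕ} (U : Set (Fin d → ℝ)) (D : Set (Fin d → ℝ)) : Prop :=
  ∃ (n : ℕ) (k l : Fin n → ℕ)
    (f : (i : Fin n) → Fin (k i) → (Fin d → ℝ) → ℝ)
    (g : (i : Fin n) → Fin (l i) → (Fin d → ℝ) → ℝ),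
      (∀ i j, AnalyticOnNhd ℝ (f i j) U) ∧ (∀ i j, AnalyticOnNhd ℝ (g i j) U) ∧
      D = ⋃ i, {x ∈ U | (∀ j, f i j x = 0) ∧ ∀ j, 0 < g i j x}

section DirDeriv

open Filter Topology

variable {E : Type*} [NormedAddCommGroup E] [NormedSpace ℝ E]

/-- The derivative of a scalar function in the direction `v`. -/
noncomputable def dirDeriv (v : E) (f : E → ℝ) : E → ℝ := fun x => fderiv ℝ f x v

/-- Iterated directional derivatives along a list of directions. -/
noncomputable def listDeriv (l : List E) (f : E → ℝ) : E → ℝ := l.foldr dirDeriv f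

@[simp] lemma listDeriv_nil (f : E → ℝ) : listDeriv [] f = f := rfl

@[simp] lemma listDeriv_cons (v : E) (l : List E) (f : E → ℝ) :
    listDeriv (v :: l) f = dirDeriv v (listDeriv l f) := rfl

lemma listDeriv_append (l l' : List E) (f : E → ℝ) :
    listDeriv (l ++ l') f = listDeriv l (listDeriv l' f) := by
  simp [listDeriv, List.foldr_append]

lemma analyticAt_dirDeriv {f : E → ℝ} {p : E} (hf : AnalyticAt ℝ f p) (v : E) :
    AnalyticAt ℝ (dirDeriv v f) p :=
  ((ContinuousLinearMap.apply ℝ ℝ v).analyticAt _).comp hf.fderiv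

lemma analyticAt_listDeriv {f : E → ℝ} {p : E} (hf : AnalyticAt ℝ f p) (l : List E) :
    AnalyticAt ℝ (listDeriv l f) p := by
  induction l with
  | nil => exact hf
  | cons v l ih => exact analyticAt_dirDeriv ih v

lemma dirDeriv_congr {f g : E → ℝ} {p : E} (h : f =ᶠ[𝓝 p] g) (v : E) :
    dirDeriv v f =ᶠ[𝓝 p] dirDeriv v g := by
  filter_upwards [h.fderiv (𝕜 := ℝ)] with x hx
  simp [dirDeriv, hx]

lemma listDeriv_congr {f g : E → ℝ} {p : E} (h : f =ᶠ[𝓝 p] g) (l : List E) :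
    listDeriv l f =ᶠ[𝓝 p] listDeriv l g := by
  induction l with
  | nil => exact h
  | cons v l ih => exact dirDeriv_congr ih v

lemma dirDeriv_comm {f : E → ℝ} {p : E} (hf : AnalyticAt ℝ f p) (u v : E) :
    dirDeriv u (dirDeriv v f) =ᶠ[𝓝 p] dirDeriv v (dirDeriv u f) := by
  filter_upwards [hf.eventually_analyticAt] with x hx
  have hsym : IsSymmSndFDerivAt ℝ f x :=
    (hx.contDiffAt (n := 2)).isSymmSndFDerivAt (by simp)
  have hd : DifferentiableAt ℝ (fderiv ℝ f) x := hx.fderiv.differentiableAt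
  have key : ∀ a b : E, dirDeriv a (dirDeriv b f) x = fderiv ℝ (fderiv ℝ f) x a b := by
    intro a b
    change fderiv ℝ (fun y => (fderiv ℝ f y) b) x a = _
    rw [fderiv_clm_apply hd (differentiableAt_const b)]
    simp
  rw [key, key]
  exact hsym u v

lemma dirDeriv_add {f g : E → ℝ} {p : E} (hf : AnalyticAt ℝ f p) (hg : AnalyticAt ℝ g p) (v : E) :
    dirDeriv v (fun x => f x + g x) =ᶠ[𝓝 p] fun x => dirDeriv v f x + dirDeriv v g x := by
  filter_upwards [hf.eventually_analyticAt, hg.eventually_analyticAt] with x h1 h2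
  simp [dirDeriv, fderiv_fun_add h1.differentiableAt h2.differentiableAt]

lemma dirDeriv_mul {f g : E → ℝ} {p : E} (hf : AnalyticAt ℝ f p) (hg : AnalyticAt ℝ g p) (v : E) :
    dirDeriv v (fun x => f x * g x) =ᶠ[𝓝 p]
      fun x => dirDeriv v f x * g x + f x * dirDeriv v g x := by
  filter_upwards [hf.eventually_analyticAt, hg.eventually_analyticAt] with x h1 h2
  simp [dirDeriv, fderiv_fun_mul h1.differentiableAt h2.differentiableAt]
  ring

@[simp] lemma dirDeriv_const (v : E) (c : ℝ) : dirDeriv v (fun _ => c) = fun _ => 0 := by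
  ext x; simp [dirDeriv]

@[simp] lemma listDeriv_zero (l : List E) : listDeriv l (fun _ => (0 : ℝ)) = fun _ => 0 := by
  induction l with
  | nil => rfl
  | cons v l ih => simp [ih]

lemma dirDeriv_const_mul {f : E → ℝ} {p : E} (hf : AnalyticAt ℝ f p) (c : ℝ) (v : E) :
    dirDeriv v (fun x => c * f x) =ᶠ[𝓝 p] fun x => c * dirDeriv v f x := by
  filter_upwards [dirDeriv_mul (analyticAt_const (v := c)) hf v] with x hx
  simpa using hx

lemma listDeriv_add {f g : E → ℝ} {p : E} (hf : AnalyticAt ℝ f p) (hg : AnalyticAt ℝ g p)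
    (l : List E) :
    listDeriv l (fun x => f x + g x) =ᶠ[𝓝 p] fun x => listDeriv l f x + listDeriv l g x := by
  induction l with
  | nil => rfl
  | cons v l ih =>
    exact (dirDeriv_congr ih v).trans
      (dirDeriv_add (analyticAt_listDeriv hf l) (analyticAt_listDeriv hg l) v)

lemma listDeriv_const_mul {f : E → ℝ} {p : E} (hf : AnalyticAt ℝ f p) (c : ℝ) (l : List E) :
    listDeriv l (fun x => c * f x) =ᶠ[𝓝 p] fun x => c * listDeriv l f x := by
  induction l with
  | nil => rfl
  | cons v l ih =>
    exact (dirDeriv_congr ih v).trans (dirDeriv_const_mul (analyticAt_listDeriv hf l) c v)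

lemma dirDeriv_add_smul (f : E → ℝ) (u v : E) (t : ℝ) :
    dirDeriv (u + t • v) f = fun x => dirDeriv u f x + t * dirDeriv v f x := by
  ext x; simp [dirDeriv]

/-- Iterated directional derivatives do not depend on the order of the directions. -/
lemma listDeriv_perm {f : E → ℝ} {p : E} (hf : AnalyticAt ℝ f p) {l l' : List E}
    (h : l.Perm l') : listDeriv l f =ᶠ[𝓝 p] listDeriv l' f := by
  induction h with
  | nil => rfl
  | cons v _ ih => exact dirDeriv_congr ih v
  | swap u v l => exact dirDeriv_comm (analyticAt_listDeriv hf l) v u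
  | trans _ _ h1 h2 => exact h1.trans h2

lemma hasDerivAt_line {f : E → ℝ} {x v : E} {t : ℝ} (hf : AnalyticAt ℝ f (x + t • v)) :
    HasDerivAt (fun s : ℝ => f (x + s • v)) (dirDeriv v f (x + t • v)) t := by
  have h1 : HasDerivAt (fun s : ℝ => x + s • v) v t := by
    simpa using ((hasDerivAt_id t).smul_const v).const_add x
  exact hf.differentiableAt.hasFDerivAt.comp_hasDerivAt t h1

lemma hasDerivAt_listDeriv_replicate {f : E → ℝ} {p : E} (hf : AnalyticAt ℝ f p) (w u : E) (n : ℕ) :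
    HasDerivAt (fun t : ℝ => listDeriv (List.replicate n (w + t • u)) f p)
      (n * listDeriv (List.replicate (n - 1) w) (dirDeriv u f) p) 0 := by
  induction n generalizing f with
  | zero => simpa using hasDerivAt_const (0 : ℝ) (f p)
  | succ n ih =>
    have hw := analyticAt_dirDeriv hf w
    have hu := analyticAt_dirDeriv hf u
    have e1 : (fun t : ℝ => listDeriv (List.replicate (n + 1) (w + t • u)) f p) =
        fun t : ℝ => listDeriv (List.replicate n (w + t • u)) (dirDeriv w f) p +
          t * listDeriv (List.replicate n (w + t • u)) (dirDeriv u f) p := by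
      ext t
      rw [List.replicate_succ', listDeriv_append, listDeriv_cons, listDeriv_nil, dirDeriv_add_smul,
        (listDeriv_add hw (g := fun x => t * dirDeriv u f x) (analyticAt_const.mul hu)
          _).eq_of_nhds,
        (listDeriv_const_mul hu t _).eq_of_nhds]
    rw [e1]
    have h := (ih hw).add ((hasDerivAt_id (0 : ℝ)).mul (ih hu))
    refine h.congr_deriv ?_
    simp only [id, zero_smul, add_zero, one_mul, zero_mul, Nat.add_sub_cancel]
    rcases Nat.eq_zero_or_pos n with rfl | hn
    · simp
    · have e2 : listDeriv (List.replicate (n - 1) w) (dirDeriv u (dirDeriv w f)) p =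
          listDeriv (List.replicate n w) (dirDeriv u f) p := by
        rw [(listDeriv_congr (dirDeriv_comm hf u w) _).eq_of_nhds]
        obtain ⟨m, rfl⟩ : ∃ m, n = m + 1 := ⟨n - 1, by omega⟩
        rw [Nat.add_sub_cancel, List.replicate_succ', listDeriv_append]
        rfl
      rw [e2]; push_cast; ring

/-- Polarization: vanishing of all pure derivatives of a given order in the directions of a
subspace forces the vanishing of all mixed ones. -/
lemma listDeriv_eq_zero_of_pure (K : Submodule ℝ E) {f : E → ℝ} {p : E} (hf : AnalyticAt ℝ f p)
    (b : ℕ) (h : ∀ w ∈ K, listDeriv (List.replicate b w) f p = 0) (l : List E)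
    (hl : l.length = b) (hlK : ∀ u ∈ l, u ∈ K) : listDeriv l f p = 0 := by
  induction b generalizing f l with
  | zero =>
    obtain rfl := List.length_eq_zero_iff.1 hl
    simpa using h 0 K.zero_mem
  | succ b ih =>
    obtain ⟨u, l, rfl⟩ := List.exists_cons_of_length_eq_add_one hl
    have hu : u ∈ K := hlK u (by simp)
    have hp : listDeriv (u :: l) f p = listDeriv l (dirDeriv u f) p := by
      have := (listDeriv_perm hf (List.perm_append_comm (l₁ := [u]) (l₂ := l))).eq_of_nhds
      simpa [listDeriv_append] using this
    rw [hp]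
    refine ih (analyticAt_dirDeriv hf u) (fun w hw => ?_) l (by simpa using hl)
      (fun z hz => hlK z (by simp [hz]))
    have h1 := hasDerivAt_listDeriv_replicate hf w u (b + 1)
    have h2 : (fun t : ℝ => listDeriv (List.replicate (b + 1) (w + t • u)) f p) = fun _ => 0 := by
      ext t; exact h _ (K.add_mem hw (K.smul_mem t hu))
    rw [h2] at h1
    have h3 := h1.unique (hasDerivAt_const (0 : ℝ) (0 : ℝ))
    have h4 : ((b + 1 : ℕ) : ℝ) ≠ 0 := by positivity
    simpa [h4] using (mul_eq_zero.1 h3).resolve_left h4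

lemma listDeriv_replicate_eq_iteratedFDeriv {f : E → ℝ} {x : E} (hf : AnalyticAt ℝ f x) (v : E)
    (n : ℕ) : listDeriv (List.replicate n v) f x = iteratedFDeriv ℝ n f x (fun _ => v) := by
  induction n generalizing x with
  | zero => simp
  | succ n ih =>
    have h1 : listDeriv (List.replicate n v) f =ᶠ[𝓝 x]
        fun y => iteratedFDeriv ℝ n f y (fun _ => v) := by
      filter_upwards [hf.eventually_analyticAt] with y hy using ih hy
    rw [List.replicate_succ, listDeriv_cons, (dirDeriv_congr h1 v).eq_of_nhds,
      iteratedFDeriv_succ_apply_left]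
    have hd : DifferentiableAt ℝ (iteratedFDeriv ℝ n f) x :=
      (AnalyticOnNhd.iteratedFDeriv (s := {y | AnalyticAt ℝ f y}) (fun _ hy => hy) n x
        hf).differentiableAt
    simp only [dirDeriv]
    have : fderiv ℝ (fun y => iteratedFDeriv ℝ n f y (fun _ => v)) x =
        (ContinuousMultilinearMap.apply ℝ (fun _ : Fin n => E) ℝ (fun _ => v)).comp
          (fderiv ℝ (iteratedFDeriv ℝ n f) x) := by
      exact ((ContinuousMultilinearMap.apply ℝ (fun _ : Fin n => E) ℝ
        (fun _ => v)).hasFDerivAt.comp x hd.hasFDerivAt).fderiv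
    rw [this]
    rfl

/-- An analytic function all of whose pure derivatives vanish at a point is locally zero. -/
lemma eventually_eq_zero_of_listDeriv {f : E → ℝ} {p : E} (hf : AnalyticAt ℝ f p)
    (h : ∀ (w : E) (n : ℕ), listDeriv (List.replicate n w) f p = 0) : ∀ᶠ x in 𝓝 p, f x = 0 := by
  obtain ⟨q, r, hq⟩ := hf
  have hf : AnalyticAt ℝ f p := ⟨q, r, hq⟩
  filter_upwards [Metric.eball_mem_nhds p hq.r_pos] with x hx
  have hs := hq.hasSum_sub hx
  have hz : ∀ n, q n (fun _ => x - p) = 0 := by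
    intro n
    have h1 := hq.factorial_smul (x - p) n
    rw [← listDeriv_replicate_eq_iteratedFDeriv hf, h] at h1
    simpa [Nat.factorial_ne_zero] using h1
  simp only [hz] at hs
  exact hs.unique hasSum_zero

/-- Cauchy estimates for the pure directional derivatives of an analytic function. -/
lemma exists_listDeriv_bound {f : E → ℝ} {p : E} (hf : AnalyticAt ℝ f p) (v : E) :
    ∃ r > 0, ∃ C > 0, ∃ R > 0, ∀ x ∈ Metric.ball p r, ∀ n : ℕ,
      |listDeriv (List.replicate n v) f x| ≤ C * n.factorial * (R⁻¹) ^ n := by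
  obtain ⟨q, ρ, hq⟩ := hf
  obtain ⟨s, hs0, hsρ⟩ := ENNReal.lt_iff_exists_nnreal_btwn.1 hq.r_pos
  set r : NNReal := s / 2 with hr
  have hr0 : 0 < r := by
    have : 0 < s := by exact_mod_cast hs0
    positivity
  have hrr : ((r : ℝ≥0∞) + r) < q.radius := by
    refine lt_of_lt_of_le ?_ hq.r_le
    rw [← ENNReal.coe_add, hr, add_halves]
    exact hsρ
  have hsum := q.changeOriginSeries_summable_aux₁ hrr
  set T := ∑' s : Σ k l : ℕ, { s : Finset (Fin (k + l)) // s.card = l },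
    ‖q (s.1 + s.2.1)‖₊ * r ^ s.2.1 * r ^ s.1 with hT
  have hbound : ∀ z : E, ‖z‖₊ ≤ r → ∀ n, ‖q.changeOrigin z n‖₊ * r ^ n ≤ T := by
    intro z hz n
    have hrrad : (r : ℝ≥0∞) < q.radius := lt_of_le_of_lt (by simp) hrr
    have h1 := q.nnnorm_changeOrigin_le (x := z) n
      (lt_of_le_of_lt (by exact_mod_cast hz) hrrad)
    have h2 : ∑' s : Σ l : ℕ, { s : Finset (Fin (n + l)) // s.card = l },
        ‖q (n + s.1)‖₊ * ‖z‖₊ ^ s.1 ≤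
        ∑' s : Σ l : ℕ, { s : Finset (Fin (n + l)) // s.card = l },
        ‖q (n + s.1)‖₊ * r ^ s.1 := by
      have hsm := q.changeOriginSeries_summable_aux₂ hrrad n
      have hle : ∀ s : Σ l : ℕ, { s : Finset (Fin (n + l)) // s.card = l },
          ‖q (n + s.1)‖₊ * ‖z‖₊ ^ s.1 ≤ ‖q (n + s.1)‖₊ * r ^ s.1 := fun s => by gcongr
      exact (NNReal.summable_of_le hle hsm).tsum_le_tsum hle hsm
    calc ‖q.changeOrigin z n‖₊ * r ^ n
        ≤ (∑' s : Σ l : ℕ, { s : Finset (Fin (n + l)) // s.card = l },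
            ‖q (n + s.1)‖₊ * r ^ s.1) * r ^ n := by gcongr; exact h1.trans h2
      _ = ∑' s : Σ l : ℕ, { s : Finset (Fin (n + l)) // s.card = l },
            ‖q (n + s.1)‖₊ * r ^ s.1 * r ^ n := by rw [NNReal.tsum_mul_right]
      _ ≤ T := by
        have h3 := (NNReal.summable_sigma.1 hsum).2
        have h4 := (NNReal.summable_sigma.1 hsum).1
        rw [hT, hsum.tsum_sigma' h4]
        exact h3.le_tsum n (fun _ _ => zero_le)
  refine ⟨r, by exact_mod_cast hr0, T + 1, by positivity, r / (‖v‖ + 1), by positivity, ?_⟩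
  intro x hx n
  have hz : ‖x - p‖₊ ≤ r := by
    have : ‖x - p‖ < r := by simpa [dist_eq_norm] using hx
    exact_mod_cast this.le
  have hzρ : (‖x - p‖₊ : ℝ≥0∞) < ρ := by
    refine lt_of_le_of_lt (b := (s : ℝ≥0∞)) ?_ hsρ
    have : r ≤ s := by rw [hr]; exact half_le_self (by positivity)
    exact_mod_cast hz.trans this
  have h1 := hq.changeOrigin hzρ
  rw [add_sub_cancel] at h1
  have hfx : AnalyticAt ℝ f x := h1.analyticAt
  rw [listDeriv_replicate_eq_iteratedFDeriv hfx, ← h1.factorial_smul v n]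
  have h2 : ‖q.changeOrigin (x - p) n‖ * (r : ℝ) ^ n ≤ T := by exact_mod_cast hbound _ hz n
  have h3 : |q.changeOrigin (x - p) n fun _ => v| ≤ ‖q.changeOrigin (x - p) n‖ * ‖v‖ ^ n := by
    simpa using (q.changeOrigin (x - p) n).le_opNorm (fun _ => v)
  have hrn : (0 : ℝ) < (r : ℝ) ^ n := by positivity
  have h4 : ‖q.changeOrigin (x - p) n‖ ≤ T * ((r : ℝ) ^ n)⁻¹ := by
    rw [← div_eq_mul_inv, le_div_iff₀ hrn]; exact h2
  rw [nsmul_eq_mul, abs_mul, Nat.abs_cast, inv_div, div_pow]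
  calc (n.factorial : ℝ) * |q.changeOrigin (x - p) n fun _ => v|
      ≤ n.factorial * ((T + 1) * ((r : ℝ) ^ n)⁻¹ * (‖v‖ + 1) ^ n) := by
        gcongr
        refine h3.trans ?_
        gcongr
        · refine h4.trans ?_
          gcongr
          linarith
        · linarith
    _ = _ := by field_simp

end DirDeriv

section OneDim

open Filter Topology Set

lemma monotoneOn_or_antitoneOn_of_ne_zero {J : Set ℝ} (hJ : J.OrdConnected) {f f' : ℝ → ℝ}
    (hf : ∀ t ∈ J, HasDerivAt f (f' t) t) (hc : ContinuousOn f' J) (h0 : ∀ t ∈ J, f' t ≠ 0) :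
    MonotoneOn f J ∨ AntitoneOn f J := by
  have hconv : Convex ℝ J := hJ.convex
  have hcont : ContinuousOn f J := fun t ht => (hf t ht).continuousAt.continuousWithinAt
  have hd : DifferentiableOn ℝ f (interior J) := fun t ht =>
    (hf t (interior_subset ht)).differentiableAt.differentiableWithinAt
  have hsign : (∀ t ∈ J, 0 < f' t) ∨ (∀ t ∈ J, f' t < 0) := by
    by_contra! hcon
    obtain ⟨⟨s, hs, hs'⟩, t, ht, ht'⟩ := hcon
    have := hJ.isPreconnected.intermediate_value hs ht hc
    obtain ⟨z, hz, hz'⟩ := this ⟨hs', ht'⟩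
    exact h0 z hz hz'
  rcases hsign with h | h
  · left
    refine monotoneOn_of_deriv_nonneg hconv hcont hd fun t ht => ?_
    rw [(hf t (interior_subset ht)).deriv]
    exact (h t (interior_subset ht)).le
  · right
    refine antitoneOn_of_deriv_nonpos hconv hcont hd fun t ht => ?_
    rw [(hf t (interior_subset ht)).deriv]
    exact (h t (interior_subset ht)).le

lemma ordConnected_sep_of_monotoneOn {J : Set ℝ} (hJ : J.OrdConnected) {f : ℝ → ℝ}
    (hf : MonotoneOn f J ∨ AntitoneOn f J) {S : Set ℝ} (hS : S.OrdConnected) :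
    {t ∈ J | f t ∈ S}.OrdConnected := by
  constructor
  rintro x ⟨hx, hx'⟩ y ⟨hy, hy'⟩ z ⟨hz1, hz2⟩
  have hzJ : z ∈ J := hJ.out hx hy ⟨hz1, hz2⟩
  refine ⟨hzJ, ?_⟩
  rcases hf with hf | hf
  · exact hS.out hx' hy' ⟨hf hx hzJ hz1, hf hzJ hy hz2⟩
  · exact hS.out hy' hx' ⟨hf hzJ hy hz2, hf hx hzJ hz1⟩

lemma mul_abs_sub_le_of_deriv_ge {J : Set ℝ} (hJ : J.OrdConnected) {f f' : ℝ → ℝ} {c : ℝ}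
    (hf : ∀ t ∈ J, HasDerivAt f (f' t) t) (h0 : ∀ t ∈ J, c ≤ |f' t|) :
    ∀ s ∈ J, ∀ t ∈ J, c * |s - t| ≤ |f s - f t| := by
  have main : ∀ s ∈ J, ∀ t ∈ J, s < t → c * |s - t| ≤ |f s - f t| := by
    intro s hs t ht hst
    have hsub : Icc s t ⊆ J := hJ.out hs ht
    obtain ⟨z, hz, hz'⟩ := exists_hasDerivAt_eq_slope f f' hst
      (fun x hx => (hf x (hsub hx)).continuousAt.continuousWithinAt)
      (fun x hx => hf x (hsub (Ioo_subset_Icc_self hx)))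
    have h1 := h0 z (hsub (Ioo_subset_Icc_self hz))
    rw [hz', abs_div, le_div_iff₀ (by rw [abs_pos]; linarith)] at h1
    rwa [abs_sub_comm s t, abs_sub_comm (f s)]
  intro s hs t ht
  rcases lt_trichotomy s t with h | h | h
  · exact main s hs t ht h
  · simp [h]
  · rw [abs_sub_comm s t, abs_sub_comm (f s)]
    exact main t ht s hs h

/-- An abstract van der Corput lemma, for a set function that is subadditive on intervals, is
bounded by the length, and is at most `A / η` on intervals where the first derivative is monotone
(unless `free` holds) and at least `η`. -/
lemma vanDerCorput_abstract {J₀ : Set ℝ} (Q : Set ℝ → ℝ) (h : ℕ → ℝ → ℝ) (free : Prop) {A : ℝ}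
    (hA : 0 < A)
    (hh : ∀ i, ∀ t ∈ J₀, HasDerivAt (h i) (h (i + 1) t) t)
    (hsub : ∀ J₁ J₂ : Set ℝ, J₁ ⊆ J₀ → J₂ ⊆ J₀ → J₁.OrdConnected → J₂.OrdConnected →
      Disjoint J₁ J₂ → Q (J₁ ∪ J₂) ≤ Q J₁ + Q J₂)
    (hlen : ∀ J : Set ℝ, J ⊆ J₀ → J.OrdConnected → ∀ ℓ : ℝ, 0 ≤ ℓ →
      (∀ s ∈ J, ∀ t ∈ J, |s - t| ≤ ℓ) → Q J ≤ ℓ)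
    (hmono : ∀ J : Set ℝ, J ⊆ J₀ → J.OrdConnected → ∀ η : ℝ, 0 < η → (∀ t ∈ J, η ≤ |h 1 t|) →
      (free ∨ MonotoneOn (h 1) J ∨ AntitoneOn (h 1) J) → Q J ≤ A / η)
    (b : ℕ) : ∀ (J : Set ℝ), J ⊆ J₀ → J.OrdConnected → ∀ c : ℝ, 0 < c →
      (∀ t ∈ J, c ≤ |h (b + 1) t|) →
      (1 ≤ b ∨ free ∨ MonotoneOn (h 1) J ∨ AntitoneOn (h 1) J) →
      Q J ≤ 4 ^ (b + 1) * (A / c) ^ ((1 : ℝ) / ((b + 1 : ℕ) : ℝ)) := by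
  induction b with
  | zero =>
    intro J hJ hJo c hc hb hm
    have := hmono J hJ hJo c hc hb (by simpa using hm)
    have hp : 0 < A / c := by positivity
    simp only [zero_add, Nat.cast_one, div_one, Real.rpow_one, pow_one]
    linarith
  | succ b ih =>
    intro J hJ hJo c hc hb _
    set h₁ := h (b + 1) with hh₁
    have hne : ∀ t ∈ J, h (b + 1 + 1) t ≠ 0 := fun t ht h0 => by
      have := hb t ht
      rw [h0, abs_zero] at this
      linarith
    have hcont : ContinuousOn (h (b + 1 + 1)) J := fun t ht =>
      (hh _ t (hJ ht)).continuousAt.continuousWithinAt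
    have hmon := monotoneOn_or_antitoneOn_of_ne_zero hJo (fun t ht => hh (b + 1) t (hJ ht))
      hcont hne
    set m : ℝ := ((b + 1 : ℕ) : ℝ) with hm
    have hm1 : 0 < m := by positivity
    have hm2 : ((b + 1 + 1 : ℕ) : ℝ) = m + 1 := by push_cast [hm]; ring
    set X := (A / c) ^ ((1 : ℝ) / (m + 1)) with hX
    have hX0 : 0 < X := by positivity
    set η := c * X with hη
    have hη0 : 0 < η := by positivity
    have hXm : X ^ (m + 1) = A / c := by
      rw [hX, ← Real.rpow_mul (by positivity)]
      rw [one_div_mul_cancel (by positivity), Real.rpow_one]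
    have hAη : (A / η) ^ ((1 : ℝ) / m) = X := by
      have : A / η = X ^ m := by
        rw [Real.rpow_add hX0, Real.rpow_one] at hXm
        rw [hη]
        field_simp
        field_simp at hXm
        linarith
      rw [this, ← Real.rpow_mul hX0.le, mul_one_div_cancel hm1.ne', Real.rpow_one]
    have hoc : ∀ S : Set ℝ, S.OrdConnected → {t ∈ J | h₁ t ∈ S}.OrdConnected := fun S hS =>
      ordConnected_sep_of_monotoneOn hJo hmon hS
    have piece : ∀ S : Set ℝ, S.OrdConnected → (∀ y ∈ S, η ≤ |y|) →
        Q {t ∈ J | h₁ t ∈ S} ≤ 4 ^ (b + 1) * X := by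
      intro S hS hSη
      rw [← hAη]
      refine ih _ (fun t ht => hJ ht.1) (hoc S hS) η hη0 (fun t ht => hSη _ ht.2) ?_
      rcases Nat.eq_zero_or_pos b with rfl | hb0
      · right; right
        exact hmon.imp (fun h => h.mono fun t ht => ht.1) (fun h => h.mono fun t ht => ht.1)
      · exact Or.inl hb0
    have hmid : Q {t ∈ J | h₁ t ∈ Icc (-η) η} ≤ 2 * X := by
      refine hlen _ (fun t ht => hJ ht.1) (hoc _ ordConnected_Icc) _ (by positivity) ?_
      rintro s ⟨hs, hs'⟩ t ⟨ht, ht'⟩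
      have h1 := mul_abs_sub_le_of_deriv_ge hJo (fun t ht => hh (b + 1) t (hJ ht)) hb s hs t ht
      have h2 : |h (b + 1) s - h (b + 1) t| ≤ 2 * η := by
        rw [abs_le]; constructor <;> linarith [hs'.1, hs'.2, ht'.1, ht'.2]
      have h3 : c * |s - t| ≤ c * (2 * X) := by rw [hη] at h2; linarith
      exact le_of_mul_le_mul_left h3 hc
    have hup : Q {t ∈ J | h₁ t ∈ Ioi η} ≤ 4 ^ (b + 1) * X :=
      piece _ ordConnected_Ioi fun y hy => (le_of_lt hy).trans (le_abs_self y)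
    have hdown : Q {t ∈ J | h₁ t ∈ Iio (-η)} ≤ 4 ^ (b + 1) * X :=
      piece _ ordConnected_Iio fun y hy => by
        have : y < -η := hy
        have := neg_abs_le y
        linarith
    have e1 : {t ∈ J | h₁ t ∈ Ici (-η)} = {t ∈ J | h₁ t ∈ Icc (-η) η} ∪ {t ∈ J | h₁ t ∈ Ioi η} := by
      ext t
      simp only [mem_ofPred_eq, mem_union, mem_Icc, mem_Ioi, mem_Ici]
      constructor
      · rintro ⟨h1, h2⟩
        rcases le_or_gt (h₁ t) η with h | h
        · exact Or.inl ⟨h1, h2, h⟩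
        · exact Or.inr ⟨h1, h⟩
      · rintro (⟨h1, h2, _⟩ | ⟨h1, h2⟩)
        · exact ⟨h1, h2⟩
        · exact ⟨h1, by linarith⟩
    have e2 : J = {t ∈ J | h₁ t ∈ Iio (-η)} ∪ {t ∈ J | h₁ t ∈ Ici (-η)} := by
      ext t
      simp only [mem_ofPred_eq, mem_union, mem_Iio, mem_Ici]
      constructor
      · intro h1
        rcases lt_or_ge (h₁ t) (-η) with h | h
        · exact Or.inl ⟨h1, h⟩
        · exact Or.inr ⟨h1, h⟩
      · rintro (h | h) <;> exact h.1
    have s1 := hsub _ _ (fun t ht => hJ ht.1) (fun t ht => hJ ht.1) (hoc _ ordConnected_Iio)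
      (hoc (Ici (-η)) ordConnected_Ici) (by
        rw [Set.disjoint_left]
        rintro t ⟨_, h1⟩ ⟨_, h2⟩
        exact not_lt.2 (mem_Ici.1 h2) (mem_Iio.1 h1))
    have s2 := hsub _ _ (fun t ht => hJ ht.1) (fun t ht => hJ ht.1)
      (hoc (Icc (-η) η) ordConnected_Icc) (hoc (Ioi η) ordConnected_Ioi) (by
        rw [Set.disjoint_left]
        rintro t ⟨_, h1⟩ ⟨_, h2⟩
        exact absurd h2 (not_lt.2 h1.2))
    rw [← e2] at s1
    rw [← e1] at s2
    rw [hm2]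
    have h4 : (1 : ℝ) ≤ 4 ^ (b + 1) := one_le_pow₀ (by norm_num)
    have h5 : (4 : ℝ) ^ (b + 1 + 1) * X = 4 * (4 ^ (b + 1) * X) := by ring
    nlinarith

/-- One-dimensional sublevel set estimate. -/
lemma volume_sublevel_le {J : Set ℝ} (hJ : J.OrdConnected) (hbd : Bornology.IsBounded J)
    (h : ℕ → ℝ → ℝ) (hh : ∀ i, ∀ t ∈ J, HasDerivAt (h i) (h (i + 1) t) t) (b : ℕ) {c ε : ℝ}
    (hc : 0 < c) (hε : 0 < ε) (hb : ∀ t ∈ J, c ≤ |h (b + 1) t|) :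
    volume.real {t ∈ J | |h 0 t| ≤ ε} ≤
      4 ^ (b + 1) * (2 * ε / c) ^ ((1 : ℝ) / ((b + 1 : ℕ) : ℝ)) := by
  have vol_le : ∀ S : Set ℝ, ∀ ℓ : ℝ, 0 ≤ ℓ → (∀ s ∈ S, ∀ t ∈ S, |s - t| ≤ ℓ) →
      volume.real S ≤ ℓ := by
    intro S ℓ hℓ hS
    refine ENNReal.toReal_le_of_le_ofReal hℓ ((Real.volume_le_diam S).trans ?_)
    refine Metric.ediam_le fun s hs t ht => ?_
    rw [edist_dist]
    exact ENNReal.ofReal_le_ofReal (hS s hs t ht)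
  have hfin : ∀ S : Set ℝ, S ⊆ J → volume S ≠ ⊤ := fun S hS =>
    ((hbd.subset hS).measure_lt_top).ne
  have := vanDerCorput_abstract (J₀ := J) (fun K => volume.real {t ∈ K | |h 0 t| ≤ ε}) h True
    (A := 2 * ε) (by positivity) hh ?_ ?_ ?_ b J le_rfl hJ c hc hb (by simp)
  · exact this
  · intro J₁ J₂ h1 h2 _ _ _
    have : {t ∈ J₁ ∪ J₂ | |h 0 t| ≤ ε} = {t ∈ J₁ | |h 0 t| ≤ ε} ∪ {t ∈ J₂ | |h 0 t| ≤ ε} := by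
      ext t; simp only [mem_ofPred_eq, mem_union]; tauto
    simp only [this]
    exact measureReal_union_le _ _
  · intro K hK _ ℓ hℓ hd
    exact vol_le _ ℓ hℓ fun s hs t ht => hd s hs.1 t ht.1
  · intro K hK hKo η hη hη1 _
    refine vol_le _ _ (by positivity) fun s hs t ht => ?_
    have h1 := mul_abs_sub_le_of_deriv_ge hKo (fun t ht => hh 0 t (hK ht)) hη1 s hs.1 t ht.1
    have h2 : |h 0 s - h 0 t| ≤ 2 * ε := by
      have h3 := abs_le.1 hs.2
      have h4 := abs_le.1 ht.2
      rw [abs_le]; constructor <;> linarith [h3.1, h3.2, h4.1, h4.2]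
    rw [le_div_iff₀ hη]
    linarith


lemma norm_integral_exp_le_of_deriv_ge {a b : ℝ} (hab : a < b) (h : ℕ → ℝ → ℝ)
    (hh : ∀ i, ∀ t ∈ Icc a b, HasDerivAt (h i) (h (i + 1) t) t) {lam η : ℝ} (hlam : lam ≠ 0)
    (hη : 0 < η) (h1 : ∀ t ∈ Icc a b, η ≤ |h 1 t|)
    (hm : MonotoneOn (h 1) (Icc a b) ∨ AntitoneOn (h 1) (Icc a b)) :
    ‖∫ t in a..b, Complex.exp (Complex.I * lam * h 0 t)‖ ≤ 4 / |lam| / η := by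
  have hlam' : (0 : ℝ) < |lam| := abs_pos.2 hlam
  have hcont : ∀ i, ContinuousOn (h i) (Icc a b) := fun i t ht =>
    (hh i t ht).continuousAt.continuousWithinAt
  have hne : ∀ t ∈ Icc a b, h 1 t ≠ 0 := fun t ht h0 => by
    have := h1 t ht
    rw [h0, abs_zero] at this
    linarith
  have huIcc : uIcc a b = Icc a b := uIcc_of_le hab.le
  -- the reciprocal of the first derivative
  set u : ℝ → ℝ := fun t => (h 1 t)⁻¹ with hu
  set u' : ℝ → ℝ := fun t => -(h 2 t) / (h 1 t) ^ 2 with hu'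
  have hud : ∀ t ∈ Icc a b, HasDerivAt u (u' t) t := fun t ht => (hh 1 t ht).inv (hne t ht)
  have hu'c : ContinuousOn u' (Icc a b) :=
    (hcont 2).neg.div ((hcont 1).pow 2) fun t ht => pow_ne_zero 2 (hne t ht)
  set e : ℝ → ℂ := fun t => Complex.exp (Complex.I * lam * h 0 t) with he
  have hed : ∀ t ∈ Icc a b, HasDerivAt e (e t * (Complex.I * lam * h 1 t)) t := fun t ht =>
    (((hh 0 t ht).ofReal_comp).const_mul (Complex.I * lam)).cexp
  have hen : ∀ t, ‖e t‖ = 1 := fun t => by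
    have : Complex.I * lam * h 0 t = ((lam * h 0 t : ℝ) : ℂ) * Complex.I := by push_cast; ring
    rw [he]; simp only; rw [this, Complex.norm_exp_ofReal_mul_I]
  have hec : ContinuousOn e (Icc a b) := fun t ht => (hed t ht).continuousAt.continuousWithinAt
  have hofc : ∀ i, ContinuousOn (fun t => ((h i t : ℝ) : ℂ)) (Icc a b) := fun i =>
    Complex.continuous_ofReal.comp_continuousOn (hcont i)
  have hparts := intervalIntegral.integral_mul_deriv_eq_deriv_mul (a := a) (b := b)
    (u := fun t => ((u t : ℝ) : ℂ)) (v := e) (u' := fun t => ((u' t : ℝ) : ℂ))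
    (v' := fun t => e t * (Complex.I * lam * h 1 t))
    (fun t ht => (hud t (huIcc ▸ ht)).ofReal_comp) (fun t ht => hed t (huIcc ▸ ht))
    (ContinuousOn.intervalIntegrable (by
      rw [huIcc]; exact Complex.continuous_ofReal.comp_continuousOn hu'c))
    (ContinuousOn.intervalIntegrable (by
      rw [huIcc]; exact hec.mul (continuousOn_const.mul (hofc 1))))
  have hL : ∫ t in a..b, ((u t : ℝ) : ℂ) * (e t * (Complex.I * lam * h 1 t)) =
      Complex.I * lam * ∫ t in a..b, e t := by
    rw [← intervalIntegral.integral_const_mul]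
    refine intervalIntegral.integral_congr fun t ht => ?_
    have : ((h 1 t : ℝ) : ℂ) ≠ 0 := by exact_mod_cast hne t (huIcc ▸ ht)
    simp only [hu]
    push_cast
    field_simp
  have hubd : ∀ t ∈ Icc a b, |u t| ≤ 1 / η := fun t ht => by
    rw [hu]; simp only; rw [abs_inv, ← one_div]
    exact one_div_le_one_div_of_le hη (h1 t ht)
  have ha : a ∈ Icc a b := left_mem_Icc.2 hab.le
  have hb : b ∈ Icc a b := right_mem_Icc.2 hab.le
  have hint : IntervalIntegrable u' volume a b :=
    ContinuousOn.intervalIntegrable (by rw [huIcc]; exact hu'c)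
  have hFTC : ∫ t in a..b, u' t = u b - u a :=
    intervalIntegral.integral_eq_sub_of_hasDerivAt (fun t ht => hud t (huIcc ▸ ht)) hint
  have hsgn : (∀ t ∈ Icc a b, 0 ≤ h 2 t) ∨ (∀ t ∈ Icc a b, h 2 t ≤ 0) := by
    have hdw : ∀ t ∈ Icc a b, derivWithin (h 1) (Icc a b) t = h 2 t := fun t ht =>
      (hh 1 t ht).hasDerivWithinAt.derivWithin (uniqueDiffOn_Icc hab t ht)
    rcases hm with hm | hm
    · left; intro t ht; rw [← hdw t ht]; exact hm.derivWithin_nonneg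
    · right; intro t ht; rw [← hdw t ht]; exact hm.derivWithin_nonpos
  have hvar : ‖∫ t in a..b, ((u' t : ℝ) : ℂ) * e t‖ ≤ 2 / η := by
    have hle : ∀ g : ℝ → ℝ, IntervalIntegrable g volume a b → (∀ t ∈ Icc a b, |u' t| = g t) →
        ‖∫ t in a..b, ((u' t : ℝ) : ℂ) * e t‖ ≤ ∫ t in a..b, g t := by
      intro g hg hgu
      refine intervalIntegral.norm_integral_le_of_norm_le hab.le (ae_of_all _ fun t ht => ?_) hg
      rw [norm_mul, hen, mul_one, Complex.norm_real, Real.norm_eq_abs, hgu t (Ioc_subset_Icc_self ht)]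
    have h2a := abs_le.1 (hubd a ha)
    have h2b := abs_le.1 (hubd b hb)
    have h3 : 2 / η = 1 / η + 1 / η := by ring
    rcases hsgn with hs | hs
    · refine (hle (fun t => -u' t) hint.neg fun t ht => ?_).trans ?_
      · refine abs_of_nonpos ?_
        exact div_nonpos_of_nonpos_of_nonneg (neg_nonpos.2 (hs t ht)) (sq_nonneg _)
      · rw [intervalIntegral.integral_neg, hFTC]; linarith [h2a.1, h2a.2, h2b.1, h2b.2]
    · refine (hle u' hint fun t ht => ?_).trans ?_
      · refine abs_of_nonneg ?_
        exact div_nonneg (neg_nonneg.2 (hs t ht)) (sq_nonneg _)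
      · rw [hFTC]; linarith [h2a.1, h2a.2, h2b.1, h2b.2]
  rw [hL] at hparts
  have hnorm : |lam| * ‖∫ t in a..b, e t‖ ≤ 4 / η := by
    have : |lam| * ‖∫ t in a..b, e t‖ = ‖Complex.I * lam * ∫ t in a..b, e t‖ := by
      simp [Complex.norm_real]
    rw [this, hparts]
    have hu1 : ‖((u b : ℝ) : ℂ) * e b‖ ≤ 1 / η := by
      rw [norm_mul, hen, mul_one, Complex.norm_real]; exact hubd b hb
    have hu2 : ‖((u a : ℝ) : ℂ) * e a‖ ≤ 1 / η := by
      rw [norm_mul, hen, mul_one, Complex.norm_real]; exact hubd a ha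
    calc _ ≤ ‖((u b : ℝ) : ℂ) * e b - ((u a : ℝ) : ℂ) * e a‖ +
          ‖∫ t in a..b, ((u' t : ℝ) : ℂ) * e t‖ := norm_sub_le _ _
      _ ≤ (1 / η + 1 / η) + 2 / η := by
        gcongr
        exact (norm_sub_le _ _).trans (add_le_add hu1 hu2)
      _ = 4 / η := by ring
  rw [div_div, mul_comm |lam|, ← div_div, le_div_iff₀ hlam', mul_comm]
  exact hnorm

lemma integrableOn_of_bound {X : Type*} [MeasurableSpace X] {μ : Measure X} {S : Set X}
    (hS : μ S ≠ ⊤) {f : X → ℂ} (hf : AEStronglyMeasurable f (μ.restrict S)) {M : ℝ}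
    (hM : ∀ x, ‖f x‖ ≤ M) : IntegrableOn f S μ := by
  have : IsFiniteMeasure (μ.restrict S) := ⟨by simpa using hS.lt_top⟩
  exact Integrable.of_bound hf M (ae_of_all _ hM)

lemma norm_setIntegral_exp_le_mono {J : Set ℝ} (hJ : J.OrdConnected) (hbd : Bornology.IsBounded J)
    (h : ℕ → ℝ → ℝ)
    (hh : ∀ i, ∀ t ∈ J, HasDerivAt (h i) (h (i + 1) t) t) {lam η : ℝ} (hlam : lam ≠ 0)
    (hη : 0 < η) (h1 : ∀ t ∈ J, η ≤ |h 1 t|)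
    (hm : MonotoneOn (h 1) J ∨ AntitoneOn (h 1) J) :
    ‖∫ t in J, Complex.exp (Complex.I * lam * h 0 t)‖ ≤ 4 / |lam| / η := by
  have hlam' : (0 : ℝ) < |lam| := abs_pos.2 hlam
  have hpos : 0 < 4 / |lam| / η := by positivity
  rcases J.eq_empty_or_nonempty with rfl | hne
  · simpa using hpos.le
  set e : ℝ → ℂ := fun t => Complex.exp (Complex.I * lam * h 0 t) with he
  have hen : ∀ t, ‖e t‖ = 1 := fun t => by
    have : Complex.I * lam * h 0 t = ((lam * h 0 t : ℝ) : ℂ) * Complex.I := by push_cast; ring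
    rw [he]; simp only; rw [this, Complex.norm_exp_ofReal_mul_I]
  have hJm : MeasurableSet J := hJ.measurableSet
  have hJfin : volume J ≠ ⊤ := hbd.measure_lt_top.ne
  have hec : ContinuousOn e J := fun t ht =>
    ((((hh 0 t ht).ofReal_comp).const_mul (Complex.I * lam)).cexp).continuousAt.continuousWithinAt
  have hei : IntegrableOn e J := by
    exact integrableOn_of_bound hJfin (hec.aestronglyMeasurable hJm) fun t => (hen t).le
  refine le_of_forall_pos_le_add fun ε hε => ?_
  obtain ⟨b, hbJ, hb⟩ := Real.add_neg_lt_sSup hne (ε := -(ε / 2)) (by linarith)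
  obtain ⟨a, haJ, ha⟩ := Real.lt_sInf_add_pos hne (ε := ε / 2) (by positivity)
  have hJsub : J ⊆ Icc (sInf J) (sSup J) := fun t ht =>
    ⟨csInf_le hbd.bddBelow ht, le_csSup hbd.bddAbove ht⟩
  rcases le_or_gt b a with hba | hab
  · have hvol : volume.real J ≤ ε := by
      calc volume.real J ≤ volume.real (Icc (sInf J) (sSup J)) :=
            measureReal_mono hJsub (by simp)
        _ ≤ ε := by
          rw [Real.volume_real_Icc]
          exact max_le (by linarith) hε.le
    have := norm_setIntegral_le_of_norm_le_const (f := e) (C := 1) hJfin.lt_top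
      (fun t _ => (hen t).le)
    linarith
  · have hsub : Icc a b ⊆ J := hJ.out haJ hbJ
    have hI := norm_integral_exp_le_of_deriv_ge hab h (fun i t ht => hh i t (hsub ht)) hlam hη
      (fun t ht => h1 t (hsub ht)) (hm.imp (fun h => h.mono hsub) (fun h => h.mono hsub))
    rw [intervalIntegral.integral_of_le hab.le, ← integral_Icc_eq_integral_Ioc] at hI
    have hsplit : ∫ t in J, e t = (∫ t in Icc a b, e t) + ∫ t in J \ Icc a b, e t := by
      rw [add_comm, ← integral_inter_add_sdiff measurableSet_Icc hei, inter_eq_right.2 hsub, add_comm]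
    rw [hsplit]
    refine (norm_add_le _ _).trans (add_le_add hI ?_)
    have hsub2 : J \ Icc a b ⊆ Ico (sInf J) a ∪ Ioc b (sSup J) := by
      rintro t ⟨ht, ht'⟩
      have := hJsub ht
      rcases lt_or_ge t a with h | h
      · exact Or.inl ⟨this.1, h⟩
      · rcases lt_or_ge b t with h' | h'
        · exact Or.inr ⟨h', this.2⟩
        · exact absurd ⟨h, h'⟩ ht'
    have hvol : volume.real (J \ Icc a b) ≤ ε := by
      calc volume.real (J \ Icc a b) ≤ volume.real (Ico (sInf J) a ∪ Ioc b (sSup J)) :=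
            measureReal_mono hsub2 (by simp [measure_union_lt_top_iff, lt_top_iff_ne_top.symm])
        _ ≤ volume.real (Ico (sInf J) a) + volume.real (Ioc b (sSup J)) :=
            measureReal_union_le _ _
        _ ≤ ε / 2 + ε / 2 := by
          rw [Real.volume_real_Ico, Real.volume_real_Ioc]
          exact add_le_add (max_le (by linarith) (by linarith)) (max_le (by linarith) (by linarith))
        _ = ε := by ring
    have := norm_setIntegral_le_of_norm_le_const (f := e) (C := 1)
      ((measure_mono sdiff_subset).trans_lt hJfin.lt_top : volume (J \ Icc a b) < ⊤)
      (fun t _ => (hen t).le)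
    linarith

/-- The van der Corput lemma. -/
lemma vanDerCorput {J : Set ℝ} (hJ : J.OrdConnected) (hbd : Bornology.IsBounded J)
    (h : ℕ → ℝ → ℝ) (hh : ∀ i, ∀ t ∈ J, HasDerivAt (h i) (h (i + 1) t) t) (b : ℕ) {c lam : ℝ}
    (hc : 0 < c) (hlam : lam ≠ 0) (hb : ∀ t ∈ J, c ≤ |h (b + 1) t|)
    (hm : 1 ≤ b ∨ MonotoneOn (h 1) J ∨ AntitoneOn (h 1) J) :
    ‖∫ t in J, Complex.exp (Complex.I * lam * h 0 t)‖ ≤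
      4 ^ (b + 1) * (4 / |lam| / c) ^ ((1 : ℝ) / ((b + 1 : ℕ) : ℝ)) := by
  have hlam' : (0 : ℝ) < |lam| := abs_pos.2 hlam
  set e : ℝ → ℂ := fun t => Complex.exp (Complex.I * lam * h 0 t) with he
  have hen : ∀ t, ‖e t‖ = 1 := fun t => by
    have : Complex.I * lam * h 0 t = ((lam * h 0 t : ℝ) : ℂ) * Complex.I := by push_cast; ring
    rw [he]; simp only; rw [this, Complex.norm_exp_ofReal_mul_I]
  have hJfin : volume J ≠ ⊤ := hbd.measure_lt_top.ne
  have hec : ContinuousOn e J := fun t ht =>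
    ((((hh 0 t ht).ofReal_comp).const_mul (Complex.I * lam)).cexp).continuousAt.continuousWithinAt
  have hei : IntegrableOn e J := by
    exact integrableOn_of_bound hJfin (hec.aestronglyMeasurable hJ.measurableSet)
      fun t => (hen t).le
  refine vanDerCorput_abstract (J₀ := J) (fun K => ‖∫ t in K, e t‖) h False
    (A := 4 / |lam|) (by positivity) hh ?_ ?_ ?_ b J le_rfl hJ c hc hb (by tauto)
  · intro J₁ J₂ h1 h2 h1o h2o hd
    rw [setIntegral_union hd h2o.measurableSet (hei.mono_set h1) (hei.mono_set h2)]
    exact norm_add_le _ _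
  · intro K hK _ ℓ hℓ hd
    have hKfin : volume K < ⊤ := (measure_mono hK).trans_lt hJfin.lt_top
    refine (norm_setIntegral_le_of_norm_le_const (f := e) (C := 1) hKfin
      (fun t _ => (hen t).le)).trans ?_
    rw [one_mul]
    refine ENNReal.toReal_le_of_le_ofReal hℓ ((Real.volume_le_diam K).trans ?_)
    refine Metric.ediam_le fun s hs t ht => ?_
    rw [edist_dist]
    exact ENNReal.ofReal_le_ofReal (hd s hs t ht)
  · intro K hK hKo η hη hη1 hm
    exact norm_setIntegral_exp_le_mono hKo (hbd.subset hK) h (fun i t ht => hh i t (hK ht)) hlam hη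
      hη1 (by tauto)


lemma exists_zeros_of_deriv {I : Set ℝ} (hI : I.OrdConnected) {f f' : ℝ → ℝ}
    (hf : ∀ t ∈ I, HasDerivAt f (f' t) t) (Z : Finset ℝ) (n : ℕ) (hZ : Z.card = n + 1)
    (hZI : ∀ z ∈ Z, z ∈ I) (h0 : ∀ z ∈ Z, f z = 0) :
    ∃ Z' : Finset ℝ, Z'.card = n ∧ (∀ z ∈ Z', z ∈ I) ∧ ∀ z ∈ Z', f' z = 0 := by
  set z := Z.orderEmbOfFin hZ with hz
  have hmem : ∀ i, z i ∈ Z := fun i => Finset.orderEmbOfFin_mem Z hZ i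
  have hrolle : ∀ i : Fin n, ∃ w ∈ Ioo (z i.castSucc) (z i.succ), f' w = 0 := by
    intro i
    have hlt : z i.castSucc < z i.succ := z.strictMono Fin.castSucc_lt_succ
    have hsub : Icc (z i.castSucc) (z i.succ) ⊆ I := hI.out (hZI _ (hmem _)) (hZI _ (hmem _))
    exact exists_hasDerivAt_eq_zero hlt
      (fun x hx => (hf x (hsub hx)).continuousAt.continuousWithinAt)
      (by rw [h0 _ (hmem _), h0 _ (hmem _)])
      (fun x hx => hf x (hsub (Ioo_subset_Icc_self hx)))
  choose w hw hw0 using hrolle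
  have hinj : Function.Injective w := by
    have : StrictMono w := by
      intro i j hij
      have h1 : z i.succ ≤ z j.castSucc := z.monotone (by
        rw [Fin.le_def]; simp only [Fin.val_succ, Fin.val_castSucc]; exact hij)
      exact (hw i).2.trans_le (h1.trans (hw j).1.le)
    exact this.injective
  refine ⟨Finset.univ.map ⟨w, hinj⟩, by simp, ?_, ?_⟩
  · intro y hy
    obtain ⟨i, _, rfl⟩ := Finset.mem_map.1 hy
    exact hI.out (hZI _ (hmem i.castSucc)) (hZI _ (hmem i.succ)) (Ioo_subset_Icc_self (hw i))
  · intro y hy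
    obtain ⟨i, _, rfl⟩ := Finset.mem_map.1 hy
    exact hw0 i

lemma exists_zero_iterated {I : Set ℝ} (hI : I.OrdConnected) (n : ℕ) (h : ℕ → ℝ → ℝ)
    (hh : ∀ i, ∀ t ∈ I, HasDerivAt (h i) (h (i + 1) t) t) (Z : Finset ℝ)
    (hZ : Z.card = n + 1) (hZI : ∀ z ∈ Z, z ∈ I) (h0 : ∀ z ∈ Z, h 0 z = 0) :
    ∃ s ∈ I, h n s = 0 := by
  induction n generalizing h Z with
  | zero =>
    obtain ⟨z, hz⟩ := Finset.card_pos.1 (by omega : 0 < Z.card)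
    exact ⟨z, hZI z hz, h0 z hz⟩
  | succ n ih =>
    obtain ⟨Z', h1, h2, h3⟩ := exists_zeros_of_deriv hI (hh 0) Z (n + 1) hZ hZI h0
    exact ih (fun i => h (i + 1)) (fun i => hh (i + 1)) Z' h1 h2 h3

/-- A function with many zeros in a short interval is small there. -/
lemma abs_le_of_zeros {I : Set ℝ} (hI : I.OrdConnected) (h : ℕ → ℝ → ℝ)
    (hh : ∀ i, ∀ t ∈ I, HasDerivAt (h i) (h (i + 1) t) t) (Z : Finset ℝ)
    (hZI : ∀ z ∈ Z, z ∈ I) (h0 : ∀ z ∈ Z, h 0 z = 0) {t ℓ M : ℝ} (ht : t ∈ I)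
    (hℓ : ∀ z ∈ Z, |t - z| ≤ ℓ) (hM : ∀ s ∈ I, |h Z.card s| ≤ M) :
    |h 0 t| ≤ M / (Z.card.factorial : ℝ) * ℓ ^ Z.card := by
  set n := Z.card with hn
  have hM0 : 0 ≤ M := (abs_nonneg _).trans (hM t ht)
  by_cases htZ : t ∈ Z
  · rw [h0 t htZ, abs_zero]
    have : 0 ≤ ℓ := (abs_nonneg _).trans (hℓ t htZ)
    positivity
  set P : Polynomial ℝ := ∏ z ∈ Z, (Polynomial.X - Polynomial.C z) with hP
  have hPeval : ∀ s, P.eval s = ∏ z ∈ Z, (s - z) := fun s => by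
    simp [hP, Polynomial.eval_prod]
  have hPt : P.eval t ≠ 0 := by
    rw [hPeval, Finset.prod_ne_zero_iff]
    intro z hz h
    exact htZ (by rw [sub_eq_zero.1 h]; exact hz)
  have hPn : Polynomial.derivative^[n] P = Polynomial.C (n.factorial : ℝ) := by
    have hmonic : P.Monic := Polynomial.monic_prod_of_monic _ _ fun z _ => Polynomial.monic_X_sub_C z
    have hdeg : P.natDegree = n := by
      rw [hP, Polynomial.natDegree_prod_of_monic _ _ fun z _ => Polynomial.monic_X_sub_C z]
      simp [hn]
    ext i
    rw [Polynomial.coeff_iterate_derivative, Polynomial.coeff_C]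
    rcases Nat.eq_zero_or_pos i with rfl | hi
    · have : P.coeff n = 1 := by rw [← hdeg]; exact hmonic
      simp [this, Nat.descFactorial_self]
    · rw [Polynomial.coeff_eq_zero_of_natDegree_lt (by omega)]
      simp [hi.ne']
  set K := h 0 t / P.eval t with hK
  obtain ⟨s, hs, hs0⟩ := exists_zero_iterated hI n
    (fun i x => h i x - K * (Polynomial.derivative^[i] P).eval x)
    (fun i x hx => (hh i x hx).sub (((Polynomial.derivative^[i] P).hasDerivAt x |>.const_mul K)
      |>.congr_deriv (by rw [Function.iterate_succ_apply'])))
    (insert t Z) (by rw [Finset.card_insert_of_notMem htZ])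
    (by
      intro z hz
      rcases Finset.mem_insert.1 hz with rfl | hz
      · exact ht
      · exact hZI z hz)
    (by
      intro z hz
      rcases Finset.mem_insert.1 hz with rfl | hz
      · simp [hK, hPt]
      · simp only [Function.iterate_zero, id]
        rw [h0 z hz, hPeval, Finset.prod_eq_zero hz (sub_self z)]
        simp)
  have hKn : |K| ≤ M / (n.factorial : ℝ) := by
    rw [hPn, Polynomial.eval_C, sub_eq_zero] at hs0
    have := hM s hs
    rw [hs0, abs_mul, Nat.abs_cast] at this
    rw [le_div_iff₀ (by positivity)]
    exact this
  have hPl : |P.eval t| ≤ ℓ ^ n := by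
    rw [hPeval, Finset.abs_prod, hn]
    calc ∏ z ∈ Z, |t - z| ≤ ∏ _z ∈ Z, ℓ :=
          Finset.prod_le_prod (fun z _ => abs_nonneg _) hℓ
      _ = ℓ ^ Z.card := by simp
  have : h 0 t = K * P.eval t := by rw [hK, div_mul_cancel₀ _ hPt]
  rw [this, abs_mul]
  gcongr

/-- If an integral is controlled on the intervals avoiding a finite set, it is controlled on
every interval. -/
lemma norm_setIntegral_le_of_gaps {f : ℝ → ℂ} {I S : Set ℝ}
    (hf : IntegrableOn f (S ∩ I)) {K : ℝ} (Z : Finset ℝ) (hI : I.OrdConnected)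
    (hK : ∀ J ⊆ I, J.OrdConnected → (∀ z ∈ Z, z ∉ J) → ‖∫ t in S ∩ J, f t‖ ≤ K) :
    ‖∫ t in S ∩ I, f t‖ ≤ (Z.card + 1) * K := by
  induction Z using Finset.induction_on_max generalizing I with
  | empty => simpa using hK I le_rfl hI (by simp)
  | insert z Z hz ih =>
    have hzZ : z ∉ Z := fun h => lt_irrefl _ (hz z h)
    have h1 := ih (I := I ∩ Iio z) (hf.mono_set (by gcongr; exact inter_subset_left))
      (hI.inter ordConnected_Iio) (fun J hJ hJo hJZ => hK J (fun t ht => (hJ ht).1) hJo (by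
        intro y hy
        rcases Finset.mem_insert.1 hy with rfl | hy
        · exact fun h => lt_irrefl y (mem_Iio.1 (hJ h).2)
        · exact hJZ y hy))
    have h2 := hK (I ∩ Ioi z) inter_subset_left (hI.inter ordConnected_Ioi) (by
        intro y hy h
        rcases Finset.mem_insert.1 hy with rfl | hy
        · exact lt_irrefl y (mem_Ioi.1 h.2)
        · exact lt_asymm (hz y hy) h.2)
    have hsplit : ∫ t in S ∩ I, f t =
        (∫ t in S ∩ (I ∩ Iio z), f t) + ∫ t in S ∩ (I ∩ Ioi z), f t := by
      have e1 : S ∩ (I ∩ Iio z) = (S ∩ I) ∩ Iio z := by rw [inter_assoc]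
      have e2 : S ∩ (I ∩ Ioi z) = (S ∩ I) ∩ Ioi z := by rw [inter_assoc]
      rw [← integral_inter_add_sdiff (s := S ∩ I) (t := Iio z) measurableSet_Iio hf, e1, e2]
      congr 1
      refine setIntegral_congr_set ?_
      have hne : ∀ᵐ t : ℝ, t ≠ z := by simp [ae_iff]
      filter_upwards [hne] with t ht
      apply propext
      change (t ∈ (S ∩ I) \ Iio z) ↔ (t ∈ (S ∩ I) ∩ Ioi z)
      simp only [mem_inter_iff, Set.mem_sdiff, mem_Iio, mem_Ioi, not_lt]
      constructor
      · rintro ⟨h, h'⟩; exact ⟨h, lt_of_le_of_ne h' (Ne.symm ht)⟩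
      · rintro ⟨h, h'⟩; exact ⟨h, h'.le⟩
    rw [hsplit, Finset.card_insert_of_notMem hzZ]
    refine (norm_add_le _ _).trans ?_
    push_cast
    linarith

end OneDim

section Averaging

open Filter Topology Set

variable {d : ℕ}

lemma measurable_add_smul (v : Fin d → ℝ) :
    Measurable fun z : (Fin d → ℝ) × ℝ => z.1 + z.2 • v := by fun_prop

lemma lintegral_volume_slice (v : Fin d → ℝ) {T : ℝ} {S : Set (Fin d → ℝ)}
    (hS : MeasurableSet S) :
    ∫⁻ x : Fin d → ℝ, volume {t ∈ Icc (-T) T | x + t • v ∈ S} =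
      ENNReal.ofReal (2 * T) * volume S := by
  have hm : MeasurableSet ((fun z : (Fin d → ℝ) × ℝ => z.1 + z.2 • v) ⁻¹' S) :=
    measurable_add_smul v hS
  have h1 : ∀ x : Fin d → ℝ, volume {t ∈ Icc (-T) T | x + t • v ∈ S} =
      (volume.restrict (Icc (-T) T))
        (Prod.mk x ⁻¹' ((fun z : (Fin d → ℝ) × ℝ => z.1 + z.2 • v) ⁻¹' S)) := by
    intro x
    rw [Measure.restrict_apply (measurable_prodMk_left hm)]
    congr 1
    ext t
    simp only [mem_ofPred_eq, mem_inter_iff, mem_preimage]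
    tauto
  simp only [h1]
  rw [← Measure.prod_apply hm, Measure.prod_apply_symm hm]
  have h2 : ∀ t : ℝ, volume ((fun x : Fin d → ℝ => (x, t)) ⁻¹'
      ((fun z : (Fin d → ℝ) × ℝ => z.1 + z.2 • v) ⁻¹' S)) = volume S := by
    intro t
    exact measure_preimage_add_right volume (t • v) S
  simp only [h2, lintegral_const, Measure.restrict_apply MeasurableSet.univ, univ_inter,
    Real.volume_Icc]
  rw [mul_comm]
  congr 2
  ring

lemma enorm_integral_le_slices (v : Fin d → ℝ) {T : ℝ} (hT : 0 ≤ T) {f : (Fin d → ℝ) → ℂ}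
    (hfm : Measurable f) (hf : Integrable f) :
    ENNReal.ofReal (2 * T) * ‖∫ x, f x‖ₑ ≤
      ∫⁻ x : Fin d → ℝ, ‖∫ t in Icc (-T) T, f (x + t • v)‖ₑ := by
  set ν : Measure ℝ := volume.restrict (Icc (-T) T) with hν
  have : IsFiniteMeasure ν := ⟨by simp [hν]⟩
  have hmeas : AEStronglyMeasurable (fun z : (Fin d → ℝ) × ℝ => f (z.1 + z.2 • v))
      ((volume : Measure (Fin d → ℝ)).prod ν) :=
    (hfm.comp (measurable_add_smul v)).aestronglyMeasurable
  have hint : Integrable (fun z : (Fin d → ℝ) × ℝ => f (z.1 + z.2 • v))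
      ((volume : Measure (Fin d → ℝ)).prod ν) := by
    rw [integrable_prod_iff' hmeas]
    refine ⟨ae_of_all _ fun t => hf.comp_add_right (t • v), ?_⟩
    have : (fun t : ℝ => ∫ x : Fin d → ℝ, ‖f (x + t • v)‖) = fun _ => ∫ x, ‖f x‖ := by
      ext t
      exact integral_add_right_eq_self (fun x => ‖f x‖) (t • v)
    rw [this]
    exact integrable_const _
  have hswap := integral_integral_swap (μ := (volume : Measure (Fin d → ℝ))) (ν := ν)
    (f := fun x t => f (x + t • v)) hint
  have h1 : ∀ t : ℝ, ∫ x : Fin d → ℝ, f (x + t • v) = ∫ x, f x := fun t =>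
    integral_add_right_eq_self f (t • v)
  simp only [h1, integral_const] at hswap
  have h2 : ν.real univ = 2 * T := by
    rw [hν, measureReal_restrict_apply MeasurableSet.univ, univ_inter, Real.volume_real_Icc,
      max_eq_left (by linarith)]
    ring
  rw [h2] at hswap
  have h3 : ENNReal.ofReal (2 * T) * ‖∫ x, f x‖ₑ = ‖(2 * T) • ∫ x, f x‖ₑ := by
    rw [enorm_smul, Real.enorm_eq_ofReal (by linarith)]
  rw [h3, ← hswap]
  exact enorm_integral_le_lintegral_enorm _

lemma norm_smul_le_of_mem_Icc {v : Fin d → ℝ} {R t : ℝ} (hR : 0 < R)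
    (ht : t ∈ Icc (-(R / (‖v‖ + 1))) (R / (‖v‖ + 1))) : ‖t • v‖ < R := by
  have hv : 0 < ‖v‖ + 1 := by positivity
  have h1 : |t| ≤ R / (‖v‖ + 1) := abs_le.2 ht
  rw [norm_smul, Real.norm_eq_abs]
  calc |t| * ‖v‖ ≤ R / (‖v‖ + 1) * ‖v‖ := by gcongr
    _ < R / (‖v‖ + 1) * (‖v‖ + 1) := by
      have : 0 < R / (‖v‖ + 1) := by positivity
      nlinarith
    _ = R := by field_simp

lemma add_smul_mem_ball {p x v : Fin d → ℝ} {r R t : ℝ} (hR : 0 < R) (hx : x ∈ Metric.ball p r)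
    (ht : t ∈ Icc (-(R / (‖v‖ + 1))) (R / (‖v‖ + 1))) : x + t • v ∈ Metric.ball p (r + R) := by
  rw [mem_ball_iff_norm] at hx ⊢
  have := norm_smul_le_of_mem_Icc hR ht
  calc ‖x + t • v - p‖ = ‖(x - p) + t • v‖ := by congr 1; abel
    _ ≤ ‖x - p‖ + ‖t • v‖ := norm_add_le _ _
    _ < r + R := by linarith

lemma mem_ball_of_add_smul_mem {p x v : Fin d → ℝ} {r R t : ℝ} (hR : 0 < R)
    (hx : x + t • v ∈ Metric.ball p r)
    (ht : t ∈ Icc (-(R / (‖v‖ + 1))) (R / (‖v‖ + 1))) : x ∈ Metric.ball p (r + R) := by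
  rw [mem_ball_iff_norm] at hx ⊢
  have := norm_smul_le_of_mem_Icc hR ht
  calc ‖x - p‖ = ‖(x + t • v - p) - t • v‖ := by congr 1; abel
    _ ≤ ‖x + t • v - p‖ + ‖t • v‖ := norm_sub_le _ _
    _ < r + R := by linarith

/-- The restriction of an analytic function to a line, with its derivatives. -/
lemma hasDerivAt_listDeriv_line {g : (Fin d → ℝ) → ℝ} {x v : Fin d → ℝ} {t : ℝ}
    (hg : AnalyticAt ℝ g (x + t • v)) (i : ℕ) :
    HasDerivAt (fun s : ℝ => listDeriv (List.replicate i v) g (x + s • v))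
      (listDeriv (List.replicate (i + 1) v) g (x + t • v)) t :=
  hasDerivAt_line (analyticAt_listDeriv hg _)

lemma exists_ball_analyticAt {g : (Fin d → ℝ) → ℝ} {p : Fin d → ℝ} (hg : AnalyticAt ℝ g p) :
    ∃ R > 0, ∀ x ∈ Metric.ball p R, AnalyticAt ℝ g x := by
  obtain ⟨R, hR, h⟩ := Metric.eventually_nhds_iff_ball.1 hg.eventually_analyticAt
  exact ⟨R, hR, h⟩

lemma measurableSet_ball_sublevel {g : (Fin d → ℝ) → ℝ} {p : Fin d → ℝ} {R : ℝ}
    (hg : ∀ x ∈ Metric.ball p R, AnalyticAt ℝ g x) (s : Set ℝ) (hs : MeasurableSet s) :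
    MeasurableSet {x ∈ Metric.ball p R | g x ∈ s} := by
  have hc : ContinuousOn g (Metric.ball p R) := fun x hx =>
    (hg x hx).continuousAt.continuousWithinAt
  have h1 : Measurable ((Metric.ball p R).domRestrict g) := hc.domRestrict.measurable
  have h2 : {x ∈ Metric.ball p R | g x ∈ s} =
      Subtype.val '' (((Metric.ball p R).domRestrict g) ⁻¹' s) := by
    ext x; simp [Set.domRestrict, and_comm]
  rw [h2]
  exact measurableSet_ball.subtype_image (h1 hs)

lemma volume_sublevel_inter_le {g : (Fin d → ℝ) → ℝ} {p w : Fin d → ℝ} (hg : AnalyticAt ℝ g p)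
    (b : ℕ) (hb : listDeriv (List.replicate (b + 1) w) g p ≠ 0) :
    ∃ R₀ > 0, ∀ R > 0, R ≤ R₀ → ∃ C > 0, ∀ B : Set (Fin d → ℝ), MeasurableSet B →
      (∀ (x : Fin d → ℝ) (t : ℝ), x + t • w ∈ B → x ∈ B) → ∀ ε > 0,
        volume ({x ∈ Metric.ball p R | |g x| ≤ ε} ∩ B) ≤
          ENNReal.ofReal (C * ε ^ ((1 : ℝ) / ((b + 1 : ℕ) : ℝ))) *
            volume (Metric.ball p (R + R) ∩ B) := by
  obtain ⟨R₁, hR₁, hR₁an⟩ := exists_ball_analyticAt hg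
  set D := listDeriv (List.replicate (b + 1) w) g with hD
  set c := |D p| / 2 with hc
  have hc0 : 0 < c := by have := abs_pos.2 hb; positivity
  have hcont : ContinuousAt (fun x => |D x|) p :=
    (analyticAt_listDeriv hg _).continuousAt.abs
  have hev : ∀ᶠ x in 𝓝 p, c ≤ |D x| := by
    filter_upwards [hcont.eventually_const_lt (u := c) (by rw [hc]; linarith)] with x hx
      using hx.le
  obtain ⟨R₂, hR₂, hR₂c⟩ := Metric.eventually_nhds_iff_ball.1 hev
  refine ⟨min R₁ R₂ / 4, by positivity, fun R hR hRR => ?_⟩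
  have h3R : R + R + R ≤ min R₁ R₂ := by linarith
  set T := R / (‖w‖ + 1) with hT
  have hT0 : 0 < T := by positivity
  refine ⟨4 ^ (b + 1) * (2 / c) ^ ((1 : ℝ) / ((b + 1 : ℕ) : ℝ)) / (2 * T), by positivity,
    fun B hB hBw ε hε => ?_⟩
  set e : ℝ := (1 : ℝ) / ((b + 1 : ℕ) : ℝ) with he
  set S := {x ∈ Metric.ball p R | |g x| ≤ ε} ∩ B with hS
  have hSm : MeasurableSet S := by
    refine MeasurableSet.inter ?_ hB
    exact measurableSet_ball_sublevel (fun x hx => hR₁an x (Metric.ball_subset_ball (by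
      have := min_le_left R₁ R₂; linarith) hx)) {y | |y| ≤ ε}
      (measurableSet_le (by fun_prop) measurable_const)
  have hslice := lintegral_volume_slice w (T := T) hSm
  have hin : ∀ x : Fin d → ℝ, volume {t ∈ Icc (-T) T | x + t • w ∈ S} ≤
      (Metric.ball p (R + R) ∩ B).indicator
        (fun _ => ENNReal.ofReal (4 ^ (b + 1) * (2 * ε / c) ^ e)) x := by
    intro x
    by_cases hx : x ∈ Metric.ball p (R + R) ∩ B
    · rw [indicator_of_mem hx]
      have hmem : ∀ t ∈ Icc (-T) T, x + t • w ∈ Metric.ball p (min R₁ R₂) := fun t ht =>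
        Metric.ball_subset_ball h3R (add_smul_mem_ball hR hx.1 ht)
      have h1 := volume_sublevel_le (J := Icc (-T) T) ordConnected_Icc
        (Metric.isBounded_Icc _ _) (fun i s => listDeriv (List.replicate i w) g (x + s • w))
        (fun i t ht => hasDerivAt_listDeriv_line
          (hR₁an _ (Metric.ball_subset_ball (min_le_left _ _) (hmem t ht))) i) b hc0 hε
        (fun t ht => hR₂c _ (Metric.ball_subset_ball (min_le_right _ _) (hmem t ht)))
      have hfin : volume {t ∈ Icc (-T) T | |listDeriv (List.replicate 0 w) g (x + t • w)| ≤ ε} ≠ ⊤ :=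
        ((measure_mono fun t ht => ht.1).trans_lt
          (measure_Icc_lt_top (μ := volume) (a := -T) (b := T))).ne
      refine (measure_mono (t := {t ∈ Icc (-T) T |
        |listDeriv (List.replicate 0 w) g (x + t • w)| ≤ ε}) fun t ht => ⟨ht.1, ht.2.1.2⟩).trans ?_
      rw [← ENNReal.ofReal_toReal hfin]
      exact ENNReal.ofReal_le_ofReal h1
    · have : {t ∈ Icc (-T) T | x + t • w ∈ S} = ∅ := by
        ext t
        simp only [mem_ofPred_eq, mem_empty_iff_false, iff_false, not_and]
        intro ht htS
        exact hx ⟨mem_ball_of_add_smul_mem hR htS.1.1 ht, hBw x t htS.2⟩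
      rw [this]; simp
  have hle : ENNReal.ofReal (2 * T) * volume S ≤
      ENNReal.ofReal (4 ^ (b + 1) * (2 * ε / c) ^ e) * volume (Metric.ball p (R + R) ∩ B) := by
    rw [← hslice]
    refine (lintegral_mono hin).trans ?_
    rw [lintegral_indicator (measurableSet_ball.inter hB), setLIntegral_const]
  have h2T : ENNReal.ofReal (2 * T) ≠ 0 := by simpa using hT0
  calc volume S = (ENNReal.ofReal (2 * T))⁻¹ * (ENNReal.ofReal (2 * T) * volume S) := by
        rw [← mul_assoc, ENNReal.inv_mul_cancel h2T ENNReal.ofReal_ne_top, one_mul]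
    _ ≤ (ENNReal.ofReal (2 * T))⁻¹ * (ENNReal.ofReal (4 ^ (b + 1) * (2 * ε / c) ^ e) *
          volume (Metric.ball p (R + R) ∩ B)) := by gcongr
    _ = _ := by
        rw [← mul_assoc, ← ENNReal.ofReal_inv_of_pos (by positivity),
          ← ENNReal.ofReal_mul (by positivity)]
        congr 2
        have : 2 * ε / c = (2 / c) * ε := by ring
        rw [this, Real.mul_rpow (by positivity) hε.le]
        ring

lemma volume_sublevel_le_rpow {g : (Fin d → ℝ) → ℝ} {p w : Fin d → ℝ} (hg : AnalyticAt ℝ g p)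
    (b : ℕ) (hb : listDeriv (List.replicate (b + 1) w) g p ≠ 0) :
    ∃ R₀ > 0, ∀ R > 0, R ≤ R₀ → ∃ C > 0, ∀ ε > 0,
        volume {x ∈ Metric.ball p R | |g x| ≤ ε} ≤
          ENNReal.ofReal (C * ε ^ ((1 : ℝ) / ((b + 1 : ℕ) : ℝ))) := by
  obtain ⟨R₀, hR₀, h⟩ := volume_sublevel_inter_le hg b hb
  refine ⟨R₀, hR₀, fun R hR hRR => ?_⟩
  obtain ⟨C, hC, h⟩ := h R hR hRR
  have hfin : volume (Metric.ball p (R + R)) ≠ ⊤ := measure_ball_lt_top.ne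
  refine ⟨C * ((volume (Metric.ball p (R + R))).toReal + 1), by positivity, fun ε hε => ?_⟩
  have := h univ MeasurableSet.univ (by simp) ε hε
  rw [inter_univ, inter_univ] at this
  refine this.trans ?_
  rw [← ENNReal.ofReal_toReal hfin, ← ENNReal.ofReal_mul (by positivity)]
  refine ENNReal.ofReal_le_ofReal ?_
  rw [ENNReal.toReal_ofReal ENNReal.toReal_nonneg]
  have : 0 ≤ C * ε ^ ((1 : ℝ) / ((b + 1 : ℕ) : ℝ)) := by positivity
  nlinarith

/-- Sublevel sets of an analytic function that is not locally zero have power-small measure. -/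
lemma exists_volume_sublevel_le {g : (Fin d → ℝ) → ℝ} {p : Fin d → ℝ} (hg : AnalyticAt ℝ g p)
    (hne : ¬ ∀ᶠ x in 𝓝 p, g x = 0) :
    ∃ R₀ > 0, ∃ τ > 0, ∀ R > 0, R ≤ R₀ → ∃ C > 0, ∀ ε > 0,
        volume {x ∈ Metric.ball p R | |g x| ≤ ε} ≤ ENNReal.ofReal (C * ε ^ (τ : ℝ)) := by
  have : ∃ (w : Fin d → ℝ) (n : ℕ), listDeriv (List.replicate n w) g p ≠ 0 := by
    by_contra! h
    exact hne (eventually_eq_zero_of_listDeriv hg h)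
  obtain ⟨w, n, hn⟩ := this
  rcases n with _ | b
  · replace hn : g p ≠ 0 := hn
    set c := |g p| / 2 with hc
    have hc0 : 0 < c := by have := abs_pos.2 hn; positivity
    have hev : ∀ᶠ x in 𝓝 p, c < |g x| :=
      hg.continuousAt.abs.eventually_const_lt (u := c) (by rw [hc]; linarith [abs_pos.2 hn])
    obtain ⟨R₂, hR₂, hR₂c⟩ := Metric.eventually_nhds_iff_ball.1 hev
    refine ⟨R₂, hR₂, 1, one_pos, fun R hR hRR => ?_⟩
    have hfin : volume (Metric.ball p R) ≠ ⊤ := measure_ball_lt_top.ne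
    refine ⟨(volume (Metric.ball p R)).toReal / c + 1, by positivity, fun ε hε => ?_⟩
    rcases lt_or_ge ε c with h | h
    · have : {x ∈ Metric.ball p R | |g x| ≤ ε} = ∅ := by
        ext x
        simp only [mem_ofPred_eq, mem_empty_iff_false, iff_false, not_and, not_le]
        intro hx
        exact h.trans (hR₂c x (Metric.ball_subset_ball hRR hx))
      rw [this]; simp
    · refine (measure_mono (t := Metric.ball p R) fun x hx => hx.1).trans ?_
      rw [← ENNReal.ofReal_toReal hfin]
      refine ENNReal.ofReal_le_ofReal ?_
      rw [ENNReal.toReal_ofReal ENNReal.toReal_nonneg, Real.rpow_one]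
      have h1 : (volume (Metric.ball p R)).toReal =
        (volume (Metric.ball p R)).toReal / c * c := by field_simp
      have h2 : 0 ≤ (volume (Metric.ball p R)).toReal / c := by positivity
      nlinarith
  · obtain ⟨R₀, hR₀, h⟩ := volume_sublevel_le_rpow hg b hn
    exact ⟨R₀, hR₀, _, by positivity, h⟩

end Averaging

section Straightening

open Filter Topology Set

/-- Analytic coordinates near `p` in which `H` becomes linear and whose coordinate changes only
move points along the direction `v`. -/
structure Straightening {E : Type*} [NormedAddCommGroup E] [NormedSpace ℝ E]
    (H : E → ℝ) (v p : E) where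
  /-- the linear form that `H` becomes -/
  ℓ : E →L[ℝ] ℝ
  /-- the parametrization -/
  Ψ : E → E
  /-- its inverse -/
  Φ : E → E
  /-- the preimage of the base point -/
  q : E
  apply_v : ℓ v = 1
  analyticAt : AnalyticAt ℝ Ψ q
  map_q : Ψ q = p
  map_p : Φ p = q
  straight : ∀ᶠ y in 𝓝 q, H (Ψ y) = ℓ y
  chain : ∀ G : E → ℝ, AnalyticAt ℝ G p → ∀ u : E, ∀ᶠ y in 𝓝 q, dirDeriv u G (Ψ y) =
    dirDeriv (u - ℓ u • v) (fun z => G (Ψ z)) y +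
      dirDeriv u H (Ψ y) * dirDeriv v (fun z => G (Ψ z)) y
  continuousAt_inv : ContinuousAt Φ p
  right_inv : ∀ᶠ x in 𝓝 p, Ψ (Φ x) = x

lemma exists_straightening {E : Type*} [NormedAddCommGroup E] [NormedSpace ℝ E]
    [CompleteSpace E] {H : E → ℝ} {v p : E} (hH : AnalyticAt ℝ H p) (hv : dirDeriv v H p ≠ 0) :
    Nonempty (Straightening H v p) := by
  have hv0 : v ≠ 0 := by
    rintro rfl
    simp [dirDeriv] at hv
  obtain ⟨ℓ, hℓ⟩ := SeparatingDual.exists_eq_one (R := ℝ) hv0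
  set Φ : E → E := fun x => x + (H x - ℓ x) • v with hΦ
  have hΦd : ∀ x, AnalyticAt ℝ H x → HasFDerivAt Φ
      (ContinuousLinearMap.id ℝ E + (fderiv ℝ H x - ℓ).smulRight v) x := by
    intro x hx
    exact (hasFDerivAt_id x).add
      ((hx.differentiableAt.hasFDerivAt.sub ℓ.hasFDerivAt).smul_const v)
  have hΦan : AnalyticAt ℝ Φ p := by
    exact analyticAt_id.add ((hH.sub (ℓ.analyticAt p)).smul analyticAt_const)
  set dH := fderiv ℝ H p with hdH
  have hdHv : dH v ≠ 0 := hv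
  set A : E →L[ℝ] E := ContinuousLinearMap.id ℝ E + (dH - ℓ).smulRight v with hA
  set B : E →L[ℝ] E := ContinuousLinearMap.id ℝ E - ((dH v)⁻¹ • (dH - ℓ)).smulRight v with hB
  let i : E ≃L[ℝ] E := ContinuousLinearEquiv.equivOfInverse A B
    (by
      intro x
      simp only [hA, hB, _root_.add_apply, _root_.sub_apply,
        ContinuousLinearMap.smulRight_apply, ContinuousLinearMap.id_apply,
        _root_.smul_apply, map_add, map_smul, smul_eq_mul, hℓ]
      match_scalars <;> field_simp
      ring)
    (by
      intro x
      simp only [hA, hB, _root_.add_apply, _root_.sub_apply,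
        ContinuousLinearMap.smulRight_apply, ContinuousLinearMap.id_apply,
        _root_.smul_apply, map_sub, map_smul, smul_eq_mul, hℓ]
      match_scalars <;> field_simp
      ring)
  have hfd : fderiv ℝ Φ p = (i : E →L[ℝ] E) := by
    rw [(hΦd p hH).fderiv]; rfl
  have hs : HasStrictFDerivAt Φ (i : E →L[ℝ] E) p := by
    rw [← hfd]; exact hΦan.hasStrictFDerivAt
  have hΨan : AnalyticAt ℝ (hs.localInverse Φ i p) (Φ p) :=
    OpenPartialHomeomorph.analyticAt_symm' (hs.toOpenPartialHomeomorph Φ) (i := i)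
      hs.mem_toOpenPartialHomeomorph_source hΦan hfd
  have htend : Tendsto (hs.localInverse Φ i p) (𝓝 (Φ p)) (𝓝 p) := hs.localInverse_tendsto
  refine ⟨⟨ℓ, hs.localInverse Φ i p, Φ, Φ p, hℓ, hΨan, hs.localInverse_apply_image, rfl, ?_, ?_,
    hΦan.continuousAt, hs.eventually_left_inverse⟩⟩
  · filter_upwards [hs.eventually_right_inverse] with y hy
    have := congrArg ℓ hy
    simp only [hΦ, map_add, map_smul, smul_eq_mul, hℓ] at this
    linarith
  · intro G hG u
    set G' : E → ℝ := fun z => G (hs.localInverse Φ i p z) with hG'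
    have hG'an : AnalyticAt ℝ G' (Φ p) :=
      AnalyticAt.comp (g := G) (by rw [hs.localInverse_apply_image]; exact hG) hΨan
    have h1 : ∀ᶠ x in 𝓝 p, G =ᶠ[𝓝 x] fun z => G' (Φ z) := by
      have : ∀ᶠ x in 𝓝 p, G x = G' (Φ x) := by
        filter_upwards [hs.eventually_left_inverse] with x hx
        simp only [hG', hx]
      exact this.eventually_nhds
    filter_upwards [htend.eventually h1, htend.eventually hH.eventually_analyticAt,
      hG'an.eventually_analyticAt, hs.eventually_right_inverse] with y h1 h2 h3 h4
    set x := hs.localInverse Φ i p y with hx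
    have h5 : dirDeriv u G x = fderiv ℝ (fun z => G' (Φ z)) x u := by
      simp only [dirDeriv]
      rw [h1.fderiv_eq]
    have h6 : HasFDerivAt (fun z => G' (Φ z)) ((fderiv ℝ G' y).comp _) x :=
      HasFDerivAt.comp (g := G') x (by rw [h4]; exact h3.differentiableAt.hasFDerivAt) (hΦd x h2)
    rw [h5, h6.fderiv]
    simp only [dirDeriv, ContinuousLinearMap.comp_apply, _root_.add_apply,
      _root_.sub_apply, ContinuousLinearMap.smulRight_apply,
      ContinuousLinearMap.id_apply, map_add, map_sub, map_smul, smul_eq_mul]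
    ring

namespace Straightening

variable {d : ℕ} {H : (Fin d → ℝ) → ℝ} {v p : Fin d → ℝ}

lemma analyticAt_comp (s : Straightening H v p) {G : (Fin d → ℝ) → ℝ} (hG : AnalyticAt ℝ G p) :
    AnalyticAt ℝ (fun y => G (s.Ψ y)) s.q :=
  AnalyticAt.comp (g := G) (by rw [s.map_q]; exact hG) s.analyticAt

lemma volume_sublevel_le (s : Straightening H v p) {g : (Fin d → ℝ) → ℝ} (hg : AnalyticAt ℝ g p)
    {w : Fin d → ℝ} (hw : s.ℓ w = 0) (b : ℕ)
    (hb : listDeriv (List.replicate (b + 1) w) (fun y => g (s.Ψ y)) s.q ≠ 0) :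
    ∃ R > 0, ∃ C > 0, ∀ ε > 0, volume {x ∈ Metric.ball p R | |H x| ≤ ε ∧ |g x| ≤ ε} ≤
      ENNReal.ofReal (C * ε ^ (1 + (1 : ℝ) / ((b + 1 : ℕ) : ℝ))) := by
  obtain ⟨R₁, hR₁, h1⟩ := volume_sublevel_inter_le (s.analyticAt_comp hg) b hb
  have hℓan : AnalyticAt ℝ (fun y => s.ℓ y) s.q := s.ℓ.analyticAt _
  obtain ⟨R₂, hR₂, h2⟩ := volume_sublevel_le_rpow hℓan (w := v) 0 (by
    have : fderiv ℝ (fun y => s.ℓ y) s.q = s.ℓ := s.ℓ.fderiv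
    simp [dirDeriv, this, s.apply_v])
  set A := fderiv ℝ s.Ψ s.q
  obtain ⟨m, hm⟩ : ∃ m : NNReal, ENNReal.ofReal |A.det| < m :=
    ⟨Real.toNNReal (|A.det| + 1), by
      change ENNReal.ofReal _ < ENNReal.ofReal _
      rw [ENNReal.ofReal_lt_ofReal_iff] <;> have := abs_nonneg A.det <;> linarith⟩
  obtain ⟨δ, hδ, hδ0⟩ := ((addHaar_image_le_mul_of_det_lt volume A hm).and
    self_mem_nhdsWithin).exists
  obtain ⟨S, hS, hSA⟩ := s.analyticAt.hasStrictFDerivAt.approximates_deriv_on_nhds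
    (c := δ) (Or.inr hδ0)
  obtain ⟨R₃, hR₃, h3⟩ := Metric.eventually_nhds_iff_ball.1
    ((eventually_mem_nhds_iff.2 hS).and s.straight)
  set R := min R₁ (min (R₂ / 2) R₃) with hR
  have hR0 : 0 < R := by positivity
  obtain ⟨C₁, hC₁, h1⟩ := h1 R hR0 (min_le_left _ _)
  obtain ⟨C₂, hC₂, h2⟩ := h2 (R + R) (by positivity) (by
    have : R ≤ R₂ / 2 := (min_le_right _ _).trans (min_le_left _ _)
    linarith)
  have hRR₃ : R ≤ R₃ := (min_le_right _ _).trans (min_le_right _ _)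
  have hΦ : ∀ᶠ x in 𝓝 p, s.Φ x ∈ Metric.ball s.q R := by
    have := s.continuousAt_inv
    rw [ContinuousAt, s.map_p] at this
    exact this (Metric.ball_mem_nhds _ hR0)
  obtain ⟨R', hR', h4⟩ := Metric.eventually_nhds_iff_ball.1 (hΦ.and s.right_inv)
  refine ⟨R', hR', m * (C₁ * C₂) + 1, by positivity, fun ε hε => ?_⟩
  set B : Set (Fin d → ℝ) := {y | |s.ℓ y| ≤ ε} with hB
  have hBm : MeasurableSet B := measurableSet_le (by fun_prop) (by fun_prop)
  have h1 := h1 B hBm (by intro x t hx; simpa [hB, hw] using hx) ε hε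
  have h2 := h2 ε hε
  set Y := {y ∈ Metric.ball s.q R | |g (s.Ψ y)| ≤ ε} ∩ B with hY
  have hsub : {x ∈ Metric.ball p R' | |H x| ≤ ε ∧ |g x| ≤ ε} ⊆ s.Ψ '' Y := by
    rintro x ⟨hx, hx1, hx2⟩
    obtain ⟨h5, h6⟩ := h4 x hx
    refine ⟨s.Φ x, ⟨⟨h5, by rwa [h6]⟩, ?_⟩, h6⟩
    rw [hB, mem_ofPred_eq, ← (h3 _ (Metric.ball_subset_ball hRR₃ h5)).2, h6]
    exact hx1
  have hYS : Y ⊆ S := fun y hy =>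
    mem_of_mem_nhds (h3 y (Metric.ball_subset_ball hRR₃ hy.1.1)).1
  have hpow : ε ^ (1 + (1 : ℝ) / ((b + 1 : ℕ) : ℝ)) = ε ^ ((1 : ℝ) / ((b + 1 : ℕ) : ℝ)) * ε := by
    rw [add_comm, Real.rpow_add hε, Real.rpow_one]
  calc volume {x ∈ Metric.ball p R' | |H x| ≤ ε ∧ |g x| ≤ ε}
      ≤ volume (s.Ψ '' Y) := measure_mono hsub
    _ ≤ m * volume Y := hδ Y s.Ψ (hSA.mono_set hYS)
    _ ≤ m * (ENNReal.ofReal (C₁ * ε ^ ((1 : ℝ) / ((b + 1 : ℕ) : ℝ))) *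
          ENNReal.ofReal (C₂ * ε)) := by
        gcongr
        refine h1.trans ?_
        gcongr
        have h7 : Metric.ball s.q (R + R) ∩ B = {y ∈ Metric.ball s.q (R + R) | |s.ℓ y| ≤ ε} := rfl
        rw [h7]
        simpa using h2
    _ = ENNReal.ofReal (m * (C₁ * C₂) * ε ^ (1 + (1 : ℝ) / ((b + 1 : ℕ) : ℝ))) := by
        rw [← ENNReal.ofReal_mul (by positivity), ← ENNReal.ofReal_coe_nnreal,
          ← ENNReal.ofReal_mul (by positivity), hpow]
        congr 1
        ring
    _ ≤ _ := by
        gcongr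
        linarith

end Straightening

end Straightening

section WeightedOrder

open Filter Topology Set

variable {E : Type*} [NormedAddCommGroup E] [NormedSpace ℝ E] {ι : Type*}

/-- `G` is analytic at `q` and vanishes there to weighted order at least `s`, where derivatives in
the direction `dir a` have weight `wt a`. -/
def HasOrder (dir : ι → E) (wt : ι → ℝ) (q : E) (s : ℝ) (G : E → ℝ) : Prop :=
  AnalyticAt ℝ G q ∧
    ∀ W : List ι, (W.map wt).sum < s → listDeriv (W.map dir) G q = 0

variable {dir : ι → E} {wt : ι → ℝ} {q : E} {s t : ℝ} {G G' : E → ℝ}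

namespace HasOrder

lemma congr (h : HasOrder dir wt q s G) (hG : G =ᶠ[𝓝 q] G') : HasOrder dir wt q s G' :=
  ⟨h.1.congr hG, fun W hW => by rw [← h.2 W hW, (listDeriv_congr hG _).eq_of_nhds]⟩

lemma mono (h : HasOrder dir wt q s G) (hst : t ≤ s) : HasOrder dir wt q t G :=
  ⟨h.1, fun W hW => h.2 W (hW.trans_le hst)⟩

lemma of_nonpos (hwt : ∀ a, 0 ≤ wt a) (hG : AnalyticAt ℝ G q) (hs : s ≤ 0) :
    HasOrder dir wt q s G := by
  refine ⟨hG, fun W hW => absurd hW (not_lt.2 (hs.trans ?_))⟩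
  refine List.sum_nonneg fun x hx => ?_
  obtain ⟨a, -, rfl⟩ := List.mem_map.1 hx
  exact hwt a

lemma apply_eq_zero (h : HasOrder dir wt q s G) (hs : 0 < s) : G q = 0 := by
  simpa using h.2 [] (by simpa using hs)

lemma zero : HasOrder dir wt q s (fun _ => 0) :=
  ⟨analyticAt_const, fun W _ => by simp⟩

lemma add (h : HasOrder dir wt q s G) (h' : HasOrder dir wt q s G') :
    HasOrder dir wt q s (fun y => G y + G' y) :=
  ⟨h.1.add h'.1, fun W hW => by
    rw [(listDeriv_add h.1 h'.1 _).eq_of_nhds, h.2 W hW, h'.2 W hW, add_zero]⟩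

lemma const_mul (h : HasOrder dir wt q s G) (c : ℝ) :
    HasOrder dir wt q s (fun y => c * G y) :=
  ⟨analyticAt_const.mul h.1, fun W hW => by
    rw [(listDeriv_const_mul h.1 c _).eq_of_nhds, h.2 W hW, mul_zero]⟩

lemma sum {κ : Type*} (A : Finset κ) {f : κ → E → ℝ}
    (h : ∀ i ∈ A, HasOrder dir wt q s (f i)) : HasOrder dir wt q s (fun y => ∑ i ∈ A, f i y) := by
  classical
  induction A using Finset.induction_on with
  | empty => simpa using zero
  | insert a A ha ih =>
    simp only [Finset.sum_insert ha]
    exact (h a (by simp)).add (ih fun i hi => h i (by simp [hi]))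

lemma dirDeriv (h : HasOrder dir wt q s G) (a : ι) :
    HasOrder dir wt q (s - wt a) (dirDeriv (dir a) G) := by
  refine ⟨analyticAt_dirDeriv h.1 _, fun W hW => ?_⟩
  have := h.2 (W ++ [a]) (by simp; linarith)
  simpa [listDeriv_append] using this

lemma mul (h : HasOrder dir wt q s G) (h' : HasOrder dir wt q t G') :
    HasOrder dir wt q (s + t) (fun y => G y * G' y) := by
  refine ⟨h.1.mul h'.1, fun W => ?_⟩
  induction W using List.reverseRecOn generalizing G G' s t with
  | nil =>
    intro hW
    have : 0 < s ∨ 0 < t := by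
      by_contra! hc
      simp at hW
      linarith [hc.1, hc.2]
    rcases this with hs | ht
    · simp [h.apply_eq_zero hs]
    · simp [h'.apply_eq_zero ht]
  | append_singleton W a ih =>
    intro hW
    have hW' : (W.map wt).sum + wt a < s + t := by simpa using hW
    rw [List.map_append, listDeriv_append]
    have e : listDeriv ([a].map dir) (fun y => G y * G' y) =ᶠ[𝓝 q]
        fun y => (fun z => _root_.dirDeriv (dir a) G z * G' z) y +
          (fun z => G z * _root_.dirDeriv (dir a) G' z) y := dirDeriv_mul h.1 h'.1 (dir a)
    rw [(listDeriv_congr e _).eq_of_nhds, (listDeriv_add ((h.dirDeriv a).1.fun_mul h'.1)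
      (h.1.fun_mul (h'.dirDeriv a).1) _).eq_of_nhds, ih (h.dirDeriv a) h' (by linarith),
      ih h (h'.dirDeriv a) (by linarith), add_zero]

lemma mul_left (hwt : ∀ a, 0 ≤ wt a) (h : HasOrder dir wt q s G) (hG' : AnalyticAt ℝ G' q) :
    HasOrder dir wt q s (fun y => G' y * G y) := by
  have := (of_nonpos (dir := dir) hwt hG' le_rfl).mul h
  rwa [zero_add] at this

lemma prod (hwt : ∀ a, 0 ≤ wt a) {κ : Type*} (A : Finset κ) {f : κ → E → ℝ} {σ : κ → ℝ}
    (h : ∀ i ∈ A, HasOrder dir wt q (σ i) (f i)) :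
    HasOrder dir wt q (∑ i ∈ A, σ i) (fun y => ∏ i ∈ A, f i y) := by
  classical
  induction A using Finset.induction_on with
  | empty => simpa using of_nonpos hwt analyticAt_const le_rfl
  | insert a A ha ih =>
    simp only [Finset.sum_insert ha, Finset.prod_insert ha]
    exact (h a (by simp)).mul (ih fun i hi => h i (by simp [hi]))

lemma det (hwt : ∀ a, 0 ≤ wt a) {κ : Type*} [Fintype κ] [DecidableEq κ]
    {M : κ → κ → E → ℝ} {ρ σ : κ → ℝ} (h : ∀ r k, HasOrder dir wt q (ρ r + σ k) (M r k)) :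
    HasOrder dir wt q (∑ r, ρ r + ∑ k, σ k)
      (fun y => (Matrix.of fun r k => M r k y).det) := by
  simp only [Matrix.det_apply', Matrix.of_apply]
  refine sum _ fun τ _ => const_mul ?_ _
  have := prod hwt Finset.univ (fun k (_ : k ∈ Finset.univ) => h (τ k) k)
  rwa [Finset.sum_add_distrib, Equiv.sum_comp] at this

end HasOrder

/-- The determinant of a rank one perturbation as a bordered determinant. -/
lemma det_add_rankOne {n : ℕ} (A : Fin n → Fin n → ℝ) (h u : Fin n → ℝ) :
    (Matrix.of fun r k => A r k + h r * u k).det =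
      (Matrix.of fun r k : Unit ⊕ Fin n =>
        Sum.elim (fun _ => Sum.elim (fun _ => 1) (fun k => -1 * u k) k)
          (fun r => Sum.elim (fun _ => h r) (fun k => A r k) k) r).det := by
  have e : (Matrix.of fun r k : Unit ⊕ Fin n =>
        Sum.elim (fun _ => Sum.elim (fun _ => 1) (fun k => -1 * u k) k)
          (fun r => Sum.elim (fun _ => h r) (fun k => A r k) k) r) =
      Matrix.fromBlocks (1 : Matrix Unit Unit ℝ) (Matrix.of fun _ k => -1 * u k)
        (Matrix.of fun r _ => h r) (Matrix.of A) := by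
    ext r k
    rcases r with r | r <;> rcases k with k | k <;> simp [Matrix.fromBlocks]
  rw [e, Matrix.det_fromBlocks_one₁₁]
  congr 1
  ext r k
  simp [Matrix.mul_apply]

variable {d : ℕ} {α : ℕ} {β : Fin d → ℕ} {L : ((Fin d → ℝ) → ℝ) → (Fin d → ℝ) → ℝ}

lemma pderiv'_eq_dirDeriv (i : Fin d) (f : (Fin d → ℝ) → ℝ) :
    pderiv' i f = _root_.dirDeriv (Pi.single i 1) f := rfl

namespace IsAdmissible

lemma one_le (h : IsAdmissible d α β L) : 1 ≤ α := by
  induction h with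
  | id => exact le_rfl
  | det n hn hnd i hi αs βs Ls hLs L hL ih =>
    calc 1 ≤ αs ⟨0, hn⟩ := ih _
      _ ≤ ∑ k, αs k := Finset.single_le_sum (f := αs) (fun _ _ => Nat.zero_le _) (Finset.mem_univ _)

lemma sum_index {n : ℕ} (i : Fin n → Fin d) (βs : Fin n → Fin d → ℕ) :
    ∑ j, ((∑ k, βs k) + ∑ k, (Pi.single (i k) 1 : Fin d → ℕ)) j = ∑ k, ∑ j, βs k j + n := by
  simp only [Pi.add_apply, Finset.sum_apply, Finset.sum_add_distrib]
  rw [Finset.sum_comm, Finset.sum_comm (f := fun j k => (Pi.single (i k) 1 : Fin d → ℕ) j)]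
  simp

lemma le_sum_add_one (h : IsAdmissible d α β L) : α ≤ ∑ j, β j + 1 := by
  induction h with
  | id => simp
  | det n hn hnd i hi αs βs Ls hLs L hL ih =>
    rw [sum_index]
    have := Finset.sum_le_sum fun k (_ : k ∈ Finset.univ) => ih k
    rw [Finset.sum_add_distrib] at this
    simp at this
    omega

lemma le_sum (h : IsAdmissible d α β L) (hne : ¬(α = 1 ∧ β = 0)) : α ≤ ∑ j, β j := by
  cases h with
  | id => exact absurd ⟨rfl, rfl⟩ hne
  | det n hn hnd i hi αs βs Ls hLs L hL =>
    rw [sum_index]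
    have := Finset.sum_le_sum fun k (_ : k ∈ Finset.univ) => (hLs k).le_sum_add_one
    rw [Finset.sum_add_distrib] at this
    simpa using this

lemma analyticAt (h : IsAdmissible d α β L) {F : (Fin d → ℝ) → ℝ} {p : Fin d → ℝ}
    (hF : AnalyticAt ℝ F p) : AnalyticAt ℝ (L F) p := by
  induction h with
  | id => exact hF
  | det n hn hnd i hi αs βs Ls hLs L hL ih =>
    have e : L F =ᶠ[𝓝 p] fun x => (Matrix.of fun r k : Fin n => pderiv' (i r) (Ls k F) x).det := by
      filter_upwards [hF.eventually_analyticAt] with x hx using hL F x hx.contDiffAt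
    refine AnalyticAt.congr ?_ e.symm
    simp only [Matrix.det_apply', Matrix.of_apply]
    exact Finset.univ.analyticAt_fun_sum fun τ _ => analyticAt_const.mul
      (Finset.univ.analyticAt_fun_prod fun k _ => analyticAt_dirDeriv (ih k) _)

/-- Vanishing orders of `F` are inherited by `L F`, computed in coordinates `Ψ` in which every
partial derivative is a combination of `dir (some i)`, of weight `θ`, and `dir none`, of
weight one. -/
theorem hasOrder (hL : IsAdmissible d α β L) {p q : Fin d → ℝ} {Ψ : (Fin d → ℝ) → Fin d → ℝ}
    (hΨ : AnalyticAt ℝ Ψ q) (hΨq : Ψ q = p) {dir : Option (Fin d) → Fin d → ℝ}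
    {wt : Option (Fin d) → ℝ} {θ : ℝ} (hθ0 : 0 ≤ θ) (hθ1 : θ ≤ 1) (hnone : wt none = 1)
    (hsome : ∀ i, wt (some i) = θ) {h : Fin d → (Fin d → ℝ) → ℝ} (hh : ∀ i, AnalyticAt ℝ (h i) q)
    (hchain : ∀ G : (Fin d → ℝ) → ℝ, AnalyticAt ℝ G p → ∀ i, ∀ᶠ y in 𝓝 q,
      pderiv' i G (Ψ y) = _root_.dirDeriv (dir (some i)) (fun z => G (Ψ z)) y +
        h i y * _root_.dirDeriv (dir none) (fun z => G (Ψ z)) y)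
    {F : (Fin d → ℝ) → ℝ} (hF : AnalyticAt ℝ F p) {κ : ℝ}
    (hord : ∀ a, HasOrder dir wt q (κ - wt a) (_root_.dirDeriv (dir a) (fun z => F (Ψ z)))) :
    (∀ a, HasOrder dir wt q (κ * α - (∑ j, β j : ℕ) + (1 - θ) * (α - 1) - wt a)
      (_root_.dirDeriv (dir a) (fun z => L F (Ψ z)))) ∧
    (¬(α = 1 ∧ β = 0) → HasOrder dir wt q (κ * α - (∑ j, β j : ℕ) + (1 - θ) * (α - 1))
      (fun z => L F (Ψ z))) := by
  have hwt : ∀ a, 0 ≤ wt a := by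
    rintro (_ | i)
    · rw [hnone]; exact zero_le_one
    · rw [hsome]; exact hθ0
  induction hL with
  | id => simpa using hord
  | det n hn hnd i hi αs βs Ls hLs L hL ih =>
    have hmain : HasOrder dir wt q (κ * (∑ k, αs k : ℕ) -
        (∑ j, ((∑ k, βs k) + ∑ k, (Pi.single (i k) 1 : Fin d → ℕ)) j : ℕ) +
          (1 - θ) * ((∑ k, αs k : ℕ) - 1)) (fun z => L F (Ψ z)) := by
      set o : Fin n → ℝ := fun k => κ * αs k - (∑ j, βs k j : ℕ) + (1 - θ) * (αs k - 1) with ho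
      have hent : ∀ r k : Unit ⊕ Fin n, HasOrder dir wt q
          (Sum.elim (fun _ => -1) (fun _ => -θ) r + Sum.elim (fun _ => θ) o k)
          (Sum.elim (fun _ => Sum.elim (fun _ _ => 1)
            (fun k y => -1 * _root_.dirDeriv (dir none) (fun z => Ls k F (Ψ z)) y) k)
          (fun r => Sum.elim (fun _ => h (i r))
            (fun k => _root_.dirDeriv (dir (some (i r))) (fun z => Ls k F (Ψ z))) k) r) := by
        rintro (r | r) (k | k)
        · exact HasOrder.of_nonpos hwt analyticAt_const (by simp; linarith)
        · have := ((ih k).1 none).const_mul (-1)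
          rw [hnone] at this
          exact this.mono (by simp only [Sum.elim_inl, Sum.elim_inr, ho]; linarith)
        · exact HasOrder.of_nonpos hwt (hh _) (by simp)
        · have := (ih k).1 (some (i r))
          rw [hsome] at this
          exact this.mono (by simp only [Sum.elim_inr, ho]; linarith)
      have hdet := HasOrder.det hwt hent
      have e1 : ∀ᶠ y in 𝓝 q, L F (Ψ y) =
          (Matrix.of fun r k : Fin n => pderiv' (i r) (Ls k F) (Ψ y)).det := by
        have : Tendsto Ψ (𝓝 q) (𝓝 p) := hΨq ▸ hΨ.continuousAt
        filter_upwards [this.eventually hF.eventually_analyticAt] with y hy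
          using hL F (Ψ y) hy.contDiffAt
      have e2 : ∀ᶠ y in 𝓝 q, ∀ r k : Fin n, pderiv' (i r) (Ls k F) (Ψ y) =
          _root_.dirDeriv (dir (some (i r))) (fun z => Ls k F (Ψ z)) y +
            h (i r) y * _root_.dirDeriv (dir none) (fun z => Ls k F (Ψ z)) y :=
        Filter.eventually_all.2 fun r => Filter.eventually_all.2 fun k =>
          hchain _ ((hLs k).analyticAt hF) (i r)
      refine (hdet.congr ?_).mono (le_of_eq ?_)
      · filter_upwards [e1, e2] with y h1 h2
        rw [h1]
        simp only [h2]
        rw [det_add_rankOne (fun r k => _root_.dirDeriv (dir (some (i r)))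
          (fun z => Ls k F (Ψ z)) y) (fun r => h (i r) y)
          (fun k => _root_.dirDeriv (dir none) (fun z => Ls k F (Ψ z)) y)]
        congr 1
        ext r k
        rcases r with r | r <;> rcases k with k | k <;> rfl
      · rw [sum_index]
        simp only [Fintype.sum_sum_type, Sum.elim_inl, Sum.elim_inr, ho, Finset.sum_add_distrib,
          Finset.sum_sub_distrib, ← Finset.mul_sum]
        push_cast
        simp
        ring
    exact ⟨fun a => hmain.dirDeriv a, fun _ => hmain⟩

end IsAdmissible

end WeightedOrder

section Valuation

open Filter Topology Set

variable {d : ℕ} {α : ℕ} {β : Fin d → ℕ} {L : ((Fin d → ℝ) → ℝ) → (Fin d → ℝ) → ℝ}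
  {F : (Fin d → ℝ) → ℝ} {p : Fin d → ℝ}

/-- If `L F` does not vanish at `p`, then some derivative of `F` of low order does not vanish. -/
lemma IsAdmissible.exists_listDeriv_ne_zero (hL : IsAdmissible d α β L)
    (hne : ¬(α = 1 ∧ β = 0)) (hF : AnalyticAt ℝ F p) (hLF : L F p ≠ 0) :
    ∃ (w : Fin d → ℝ) (j : ℕ), 1 ≤ j ∧ j * α ≤ ∑ i, β i ∧
      listDeriv (List.replicate j w) F p ≠ 0 := by
  by_contra! hcon
  have hα := hL.one_le
  set N := (∑ i, β i) / α with hN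
  have hNα : ∑ i, β i < (N + 1) * α := by
    rw [add_mul, one_mul]
    exact Nat.lt_div_mul_add hα
  have hzero : ∀ l : List (Fin d → ℝ), 1 ≤ l.length → l.length ≤ N → listDeriv l F p = 0 := by
    intro l h1 h2
    refine listDeriv_eq_zero_of_pure ⊤ hF l.length (fun w _ => hcon w _ h1 ?_) l rfl (by simp)
    calc l.length * α ≤ N * α := by gcongr
      _ ≤ _ := Nat.div_mul_le_self _ _
  set dir : Option (Fin d) → Fin d → ℝ := fun a => a.elim 0 (fun i => Pi.single i 1) with hdir
  have hord : ∀ a, HasOrder dir (fun _ => 1) p (((N + 1 : ℕ) : ℝ) - 1)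
      (dirDeriv (dir a) (fun z => F (_root_.id z))) := by
    intro a
    refine ⟨analyticAt_dirDeriv hF _, fun W hW => ?_⟩
    have hW' : W.length < N := by
      have : (W.length : ℝ) < N := by simpa using hW
      exact_mod_cast this
    have := hzero (W.map dir ++ [dir a]) (by simp) (by simpa using hW')
    rwa [listDeriv_append] at this
  have := (hL.hasOrder (q := p) (Ψ := _root_.id) (analyticAt_id) rfl (dir := dir) (wt := fun _ => 1)
    zero_le_one le_rfl rfl (fun _ => rfl) (h := fun _ _ => 0) (fun _ => analyticAt_const)
    (fun G hG i => Eventually.of_forall fun y => by simp [pderiv'_eq_dirDeriv, hdir]) hF hord).2 hne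
  refine hLF (this.apply_eq_zero ?_)
  have : ((∑ i, β i : ℕ) : ℝ) < ((N + 1 : ℕ) : ℝ) * α := by exact_mod_cast hNα
  linarith

lemma exists_perm_map_some_append {ι : Type*} (V : List (Option ι)) :
    ∃ (us : List ι) (a : ℕ), V.Perm (us.map some ++ List.replicate a none) := by
  induction V with
  | nil => exact ⟨[], 0, by simp⟩
  | cons x V ih =>
    obtain ⟨us, a, h⟩ := ih
    rcases x with _ | i
    · refine ⟨us, a + 1, (h.cons none).trans ?_⟩
      rw [List.replicate_succ]
      exact List.perm_middle.symm
    · exact ⟨i :: us, a, by simpa using h⟩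

namespace Straightening

variable {H : (Fin d → ℝ) → ℝ} {v : Fin d → ℝ}

/-- In straightened coordinates, differentiation along `v` is differentiation of the original
function along `v` divided by the derivative of `H`. -/
lemma dirDeriv_comp (s : Straightening H v p) (hH : AnalyticAt ℝ H p) (hv : dirDeriv v H p ≠ 0)
    {K : (Fin d → ℝ) → ℝ} (hK : AnalyticAt ℝ K p) :
    dirDeriv v (fun z => K (s.Ψ z)) =ᶠ[𝓝 s.q]
      fun y => (dirDeriv v H (s.Ψ y))⁻¹ * dirDeriv v K (s.Ψ y) := by
  have ht : Tendsto s.Ψ (𝓝 s.q) (𝓝 p) := by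
    have := s.analyticAt.continuousAt
    rwa [ContinuousAt, s.map_q] at this
  have hne : ∀ᶠ y in 𝓝 s.q, dirDeriv v H (s.Ψ y) ≠ 0 :=
    ht.eventually ((analyticAt_dirDeriv hH v).continuousAt.eventually_ne hv)
  filter_upwards [hne, s.chain K hK v] with y h1 h2
  have : dirDeriv (v - s.ℓ v • v) (fun z => K (s.Ψ z)) y = 0 := by
    rw [s.apply_v, one_smul, sub_self]
    simp [dirDeriv]
  rw [this, zero_add] at h2
  rw [h2]
  field_simp

variable {ι : Type*} {w : ι → Fin d → ℝ} {wt : ι → ℝ} {σ : ℝ}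

lemma hasOrder_mul (s : Straightening H v p) (hwt : ∀ a, 0 ≤ wt a) (n : ℕ)
    {e K : (Fin d → ℝ) → ℝ} (he : AnalyticAt ℝ e p) (hK : AnalyticAt ℝ K p)
    (h : ∀ i ≤ n, HasOrder w wt s.q σ (fun y => listDeriv (List.replicate i v) K (s.Ψ y))) :
    ∀ i ≤ n, HasOrder w wt s.q σ
      (fun y => listDeriv (List.replicate i v) (fun x => e x * K x) (s.Ψ y)) := by
  have ht : Tendsto s.Ψ (𝓝 s.q) (𝓝 p) := by
    have := s.analyticAt.continuousAt
    rwa [ContinuousAt, s.map_q] at this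
  induction n generalizing e K with
  | zero =>
    intro i hi
    obtain rfl : i = 0 := by omega
    exact (h 0 le_rfl).mul_left hwt (s.analyticAt_comp he)
  | succ n ih =>
    intro i hi
    rcases i with _ | i
    · exact (h 0 (by omega)).mul_left hwt (s.analyticAt_comp he)
    · have h1 := ih (analyticAt_dirDeriv he v) hK (fun j hj => h j (by omega)) i (by omega)
      have h2 := ih he (analyticAt_dirDeriv hK v) (fun j hj => by
        have := h (j + 1) (by omega)
        rwa [List.replicate_succ', listDeriv_append] at this) i (by omega)
      refine (h1.add h2).congr ?_
      have e1 : listDeriv (List.replicate (i + 1) v) (fun x => e x * K x) =ᶠ[𝓝 p]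
          fun x => listDeriv (List.replicate i v) (fun x => dirDeriv v e x * K x) x +
            listDeriv (List.replicate i v) (fun x => e x * dirDeriv v K x) x := by
        rw [List.replicate_succ', listDeriv_append]
        exact (listDeriv_congr (dirDeriv_mul he hK v) _).trans
          (listDeriv_add ((analyticAt_dirDeriv he v).fun_mul hK)
            (he.fun_mul (analyticAt_dirDeriv hK v)) _)
      filter_upwards [ht.eventually e1] with y hy
      exact hy.symm

lemma hasOrder_listDeriv (s : Straightening H v p) (hwt : ∀ a, 0 ≤ wt a)
    (hH : AnalyticAt ℝ H p) (hv : dirDeriv v H p ≠ 0) (n : ℕ)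
    {K : (Fin d → ℝ) → ℝ} (hK : AnalyticAt ℝ K p)
    (h : ∀ i ≤ n, HasOrder w wt s.q σ (fun y => listDeriv (List.replicate i v) K (s.Ψ y))) :
    ∀ i ≤ n, HasOrder w wt s.q σ
      (listDeriv (List.replicate i v) (fun y => K (s.Ψ y))) := by
  induction n generalizing K with
  | zero =>
    intro i hi
    obtain rfl : i = 0 := by omega
    exact h 0 le_rfl
  | succ n ih =>
    intro i hi
    rcases i with _ | i
    · exact h 0 (by omega)
    · have hinv : AnalyticAt ℝ (fun x => (dirDeriv v H x)⁻¹) p := (analyticAt_dirDeriv hH v).inv hv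
      have h1 := s.hasOrder_mul hwt n hinv (analyticAt_dirDeriv hK v) (fun j hj => by
        have := h (j + 1) (by omega)
        rwa [List.replicate_succ', listDeriv_append] at this)
      have h2 := ih (hinv.fun_mul (analyticAt_dirDeriv hK v)) h1 i (by omega)
      refine h2.congr ?_
      rw [List.replicate_succ', listDeriv_append]
      exact (listDeriv_congr (s.dirDeriv_comp hH hv hK) _).symm

end Straightening

/-- If all derivatives of `F` of order below `k` vanish at `p` while `k` is too large for van der
Corput's lemma in one direction, then two derivatives of `F` of order at most `k - 1` have a
small common sublevel set. -/
lemma IsAdmissible.exists_volume_sublevel_le (hL : IsAdmissible d α β L)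
    (hne : ¬(α = 1 ∧ β = 0)) (hF : AnalyticAt ℝ F p) (hLF : L F p ≠ 0) {k : ℕ} {v : Fin d → ℝ}
    (hk0 : 1 ≤ k) (hmin : ∀ (w : Fin d → ℝ) (j : ℕ), 1 ≤ j → j < k →
      listDeriv (List.replicate j w) F p = 0)
    (hkv : listDeriv (List.replicate k v) F p ≠ 0) {θ : ℝ} (hθ0 : 0 < θ) (hθ1 : θ < 1)
    (hθ : θ * α = k * α - ((∑ i, β i : ℕ) + 1 - α)) :
    ∃ (u : Fin d → ℝ) (j : ℕ), 1 ≤ j ∧ j < k ∧ ∃ e : ℝ, 1 ≤ e ∧ k < (k - θ) * e ∧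
      ∃ R > 0, ∃ C > 0, ∀ ε > 0, volume {x ∈ Metric.ball p R |
        |listDeriv (List.replicate (k - 1) v) F x| ≤ ε ∧
        |listDeriv (List.replicate j u) F x| ≤ ε} ≤ ENNReal.ofReal (C * ε ^ (e : ℝ)) := by
  set H := listDeriv (List.replicate (k - 1) v) F with hH
  have hHan : AnalyticAt ℝ H p := analyticAt_listDeriv hF _
  have hHv : dirDeriv v H p ≠ 0 := by
    have e : k = (k - 1) + 1 := by omega
    rwa [e, List.replicate_succ, listDeriv_cons] at hkv
  obtain ⟨s⟩ := exists_straightening hHan hHv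
  have ht : Tendsto s.Ψ (𝓝 s.q) (𝓝 p) := by
    have := s.analyticAt.continuousAt
    rwa [ContinuousAt, s.map_q] at this
  set w : Fin d → Fin d → ℝ := fun i => Pi.single i 1 - s.ℓ (Pi.single i 1) • v with hw
  have hℓw : ∀ i, s.ℓ (w i) = 0 := fun i => by simp [hw, s.apply_v]
  set dir : Option (Fin d) → Fin d → ℝ := fun a => a.elim v w with hdir
  set wt : Option (Fin d) → ℝ := fun a => a.elim 1 (fun _ => θ) with hwt
  set Ft : (Fin d → ℝ) → ℝ := fun z => F (s.Ψ z) with hFt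
  have hFtan : AnalyticAt ℝ Ft s.q := s.analyticAt_comp hF
  have hchain : ∀ G : (Fin d → ℝ) → ℝ, AnalyticAt ℝ G p → ∀ i, ∀ᶠ y in 𝓝 s.q,
      pderiv' i G (s.Ψ y) = dirDeriv (dir (some i)) (fun z => G (s.Ψ z)) y +
        dirDeriv (Pi.single i 1) H (s.Ψ y) * dirDeriv (dir none) (fun z => G (s.Ψ z)) y :=
    fun G hG i => s.chain G hG _
  have hlead : ¬ ∀ a, HasOrder dir wt s.q (k - wt a) (dirDeriv (dir a) Ft) := by
    intro hord
    refine hLF ?_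
    have := ((hL.hasOrder s.analyticAt s.map_q hθ0.le hθ1.le rfl (fun _ => rfl)
      (fun i => s.analyticAt_comp (analyticAt_dirDeriv hHan _)) hchain hF hord).2
      hne).apply_eq_zero ?_
    · simpa [s.map_q] using this
    · have : (k : ℝ) * α - (∑ j, β j : ℕ) + (1 - θ) * (α - 1) = θ := by linarith
      rw [this]; exact hθ0
  have hwords : ¬ ∀ V : List (Option (Fin d)), V ≠ [] → (V.map wt).sum < k →
      listDeriv (V.map dir) Ft s.q = 0 := by
    intro hV
    refine hlead fun a => ⟨analyticAt_dirDeriv hFtan _, fun W hW => ?_⟩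
    have := hV (W ++ [a]) (by simp) (by simp; linarith)
    rwa [List.map_append, listDeriv_append] at this
  have hwt' : ∀ a : Fin d, (0 : ℝ) ≤ (fun _ => θ) a := fun _ => hθ0.le
  -- the cotangential orders of the derivatives of `Ft` suffice
  have hpure : ¬ ((∀ a : ℕ, 1 ≤ a → a < k → HasOrder w (fun _ => θ) s.q (k - θ)
      (listDeriv (List.replicate a v) Ft)) ∧
      ∀ i, HasOrder w (fun _ => θ) s.q (k - θ) (dirDeriv (w i) Ft)) := by
    rintro ⟨hA, hB⟩
    refine hwords fun V hV hVk => ?_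
    obtain ⟨us, a, hperm⟩ := exists_perm_map_some_append V
    rw [(listDeriv_perm hFtan (hperm.map dir)).eq_of_nhds, List.map_append, List.map_map,
      List.map_replicate]
    have hsum : us.length * θ + a < k := by
      rw [(hperm.map wt).sum_eq] at hVk
      simpa [hwt, Function.comp_def] using hVk
    have hdw : (dir ∘ some : Fin d → Fin d → ℝ) = w := rfl
    rw [hdw]
    rcases Nat.eq_zero_or_pos a with rfl | ha
    · have hus : us ≠ [] := by
        rintro rfl
        exact hV (List.perm_nil.1 (by simpa using hperm))
      obtain ⟨us, i, rfl⟩ := (List.eq_nil_or_concat us).resolve_left hus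
      have := (hB i).2 us (by simp at hsum ⊢; linarith)
      simpa [listDeriv_append] using this
    · have hak : a < k := by
        have : (a : ℝ) < k := by
          have : 0 ≤ us.length * θ := by positivity
          linarith
        exact_mod_cast this
      rw [listDeriv_append]
      refine (hA a ha hak).2 us ?_
      have : (1 : ℝ) ≤ a := by exact_mod_cast ha
      simp
      linarith
  have hk2 : 2 ≤ k := by
    by_contra hk
    obtain rfl : k = 1 := by omega
    refine hpure ⟨fun a h1 h2 => by omega, fun i => ?_⟩
    refine HasOrder.zero.congr ?_
    have e : Ft =ᶠ[𝓝 s.q] s.ℓ := s.straight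
    refine EventuallyEq.trans ?_ (dirDeriv_congr e (w i)).symm
    refine Eventually.of_forall fun y => ?_
    simp [dirDeriv, s.ℓ.fderiv, hℓw]
  have hfam : ∃ (u : Fin d → ℝ) (j : ℕ), 1 ≤ j ∧ j < k ∧
      ¬ HasOrder w (fun _ => θ) s.q (k - θ)
        (fun y => listDeriv (List.replicate j u) F (s.Ψ y)) := by
    by_contra! hcon
    have hone : ∀ u, HasOrder w (fun _ => θ) s.q (k - θ) (fun y => dirDeriv u F (s.Ψ y)) :=
      fun u => hcon u 1 le_rfl (by omega)
    have hinv : AnalyticAt ℝ (fun x => (dirDeriv v H x)⁻¹) p :=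
      (analyticAt_dirDeriv hHan v).inv hHv
    have hA : ∀ a ≤ k - 2, HasOrder w (fun _ => θ) s.q (k - θ)
        (listDeriv (List.replicate a v) (dirDeriv v Ft)) := by
      intro a ha
      have h1 := s.hasOrder_mul hwt' (k - 2) hinv (analyticAt_dirDeriv hF v) (fun j hj => by
        have := hcon v (j + 1) (by omega) (by omega)
        rwa [List.replicate_succ', listDeriv_append] at this)
      have h2 := s.hasOrder_listDeriv hwt' hHan hHv (k - 2)
        (hinv.fun_mul (analyticAt_dirDeriv hF v)) h1 a ha
      exact h2.congr (listDeriv_congr (s.dirDeriv_comp hHan hHv hF) _).symm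
    refine hpure ⟨fun a h1 h2 => ?_, fun i => ?_⟩
    · obtain ⟨a, rfl⟩ : ∃ b, a = b + 1 := ⟨a - 1, by omega⟩
      rw [List.replicate_succ', listDeriv_append]
      exact hA a (by omega)
    · have h1 := (hA 0 (by omega)).mul_left hwt'
        (s.analyticAt_comp (analyticAt_dirDeriv hHan (Pi.single i 1)))
      refine ((hone (Pi.single i 1)).add (h1.const_mul (-1))).congr ?_
      filter_upwards [hchain F hF i] with y hy
      rw [pderiv'_eq_dirDeriv] at hy
      rw [hy]
      simp only [hdir, Option.elim, List.replicate_zero, listDeriv_nil, hFt]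
      ring
  obtain ⟨u, j, hj1, hjk, hord⟩ := hfam
  have hgan : AnalyticAt ℝ (listDeriv (List.replicate j u) F) p := analyticAt_listDeriv hF _
  refine ⟨u, j, hj1, hjk, ?_⟩
  obtain ⟨us, hus, hus0⟩ : ∃ us : List (Fin d), us.length * θ < k - θ ∧
      listDeriv (us.map w) (fun y => listDeriv (List.replicate j u) F (s.Ψ y)) s.q ≠ 0 := by
    by_contra! hcon
    exact hord ⟨s.analyticAt_comp hgan, fun W hW => hcon W (by simpa using hW)⟩
  have hlen : us ≠ [] := by
    rintro rfl
    simp [s.map_q, hmin u j hj1 hjk] at hus0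
  obtain ⟨b, hb⟩ : ∃ b, us.length = b + 1 :=
    ⟨us.length - 1, by have := List.length_pos_iff.2 hlen; omega⟩
  obtain ⟨w', hw', hw'0⟩ : ∃ w' ∈ LinearMap.ker (s.ℓ : (Fin d → ℝ) →ₗ[ℝ] ℝ),
      listDeriv (List.replicate (b + 1) w')
        (fun y => listDeriv (List.replicate j u) F (s.Ψ y)) s.q ≠ 0 := by
    by_contra! hcon
    refine hus0 (listDeriv_eq_zero_of_pure (LinearMap.ker (s.ℓ : (Fin d → ℝ) →ₗ[ℝ] ℝ))
      (s.analyticAt_comp hgan) (b + 1) hcon _ (by simpa using hb) ?_)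
    intro x hx
    obtain ⟨i, -, rfl⟩ := List.mem_map.1 hx
    exact hℓw i
  obtain ⟨R, hR, C, hC, hvol⟩ := s.volume_sublevel_le hgan hw' b hw'0
  refine ⟨1 + 1 / ((b + 1 : ℕ) : ℝ), ?_, ?_, R, hR, C, hC, hvol⟩
  · have : (0 : ℝ) ≤ 1 / ((b + 1 : ℕ) : ℝ) := by positivity
    linarith
  · rw [hb] at hus
    have hb0 : (0 : ℝ) < ((b + 1 : ℕ) : ℝ) := by positivity
    have : (k - θ) * (1 + 1 / ((b + 1 : ℕ) : ℝ)) =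
        ((k - θ) * (((b + 1 : ℕ) : ℝ) + 1)) / ((b + 1 : ℕ) : ℝ) := by
      field_simp
    rw [this, lt_div_iff₀ hb0]
    linarith

end Valuation

section SliceEstimate

open Filter Topology Set

variable {d : ℕ}

lemma exists_volume_zero_eq_zero {g : (Fin d → ℝ) → ℝ} {p : Fin d → ℝ} (hg : AnalyticAt ℝ g p)
    (hne : ¬ ∀ᶠ x in 𝓝 p, g x = 0) :
    ∃ R > 0, volume {x ∈ Metric.ball p R | g x = 0} = 0 := by
  obtain ⟨R, hR, τ, hτ, h⟩ := exists_volume_sublevel_le hg hne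
  obtain ⟨C, hC, h⟩ := h R hR le_rfl
  refine ⟨R, hR, ?_⟩
  have hlim : Tendsto (fun ε : ℝ => ENNReal.ofReal (C * ε ^ τ)) (𝓝[>] 0) (𝓝 0) := by
    have h1 : Tendsto (fun ε : ℝ => ε ^ τ) (𝓝 0) (𝓝 (0 ^ τ)) :=
      (Real.continuousAt_rpow_const 0 τ (Or.inr hτ.le)).tendsto
    rw [Real.zero_rpow hτ.ne'] at h1
    have h2 := ENNReal.tendsto_ofReal (h1.const_mul C)
    rw [mul_zero, ENNReal.ofReal_zero] at h2
    exact h2.mono_left nhdsWithin_le_nhds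
  refine le_antisymm (ge_of_tendsto hlim ?_) bot_le
  filter_upwards [self_mem_nhdsWithin] with ε hε
  refine le_trans (measure_mono ?_) (h ε hε)
  rintro x ⟨hx, hx'⟩
  refine ⟨hx, ?_⟩
  rw [hx', abs_zero]
  exact le_of_lt hε

lemma not_eventually_mul_eq_zero {f g : (Fin d → ℝ) → ℝ} {p : Fin d → ℝ}
    (hf : AnalyticAt ℝ f p) (hg : AnalyticAt ℝ g p) (hf0 : ¬ ∀ᶠ x in 𝓝 p, f x = 0)
    (hg0 : ¬ ∀ᶠ x in 𝓝 p, g x = 0) : ¬ ∀ᶠ x in 𝓝 p, f x * g x = 0 := by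
  intro h
  obtain ⟨R₁, hR₁, h₁⟩ := exists_volume_zero_eq_zero hf hf0
  obtain ⟨R₂, hR₂, h₂⟩ := exists_volume_zero_eq_zero hg hg0
  obtain ⟨R₃, hR₃, h₃⟩ := Metric.eventually_nhds_iff_ball.1 h
  set R := min R₁ (min R₂ R₃) with hR
  have hR0 : 0 < R := by positivity
  have hpos : 0 < volume (Metric.ball p R) := Metric.measure_ball_pos _ _ hR0
  refine hpos.ne' (measure_mono_null (fun x hx => ?_) (measure_union_null h₁ h₂))
  rcases mul_eq_zero.1 (h₃ x (Metric.ball_subset_ball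
    ((min_le_right _ _).trans (min_le_right _ _)) hx)) with h | h
  · exact Or.inl ⟨Metric.ball_subset_ball (min_le_left _ _) hx, h⟩
  · exact Or.inr ⟨Metric.ball_subset_ball ((min_le_right _ _).trans (min_le_left _ _)) hx, h⟩

/-- A finite family of analytic germs is controlled by one nonzero analytic germ: where the
latter does not vanish, neither do the nontrivial members of the family. -/
lemma exists_common_germ {ι : Type*} (s : Finset ι) (g : ι → (Fin d → ℝ) → ℝ) {p : Fin d → ℝ}
    (hg : ∀ i ∈ s, AnalyticAt ℝ (g i) p) :
    ∃ G : (Fin d → ℝ) → ℝ, AnalyticAt ℝ G p ∧ (¬ ∀ᶠ x in 𝓝 p, G x = 0) ∧ ∃ R > 0, ∀ i ∈ s,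
      (∀ x, G x ≠ 0 → g i x ≠ 0) ∨ (∀ x ∈ Metric.ball p R, g i x = 0) := by
  classical
  induction s using Finset.induction_on with
  | empty =>
    refine ⟨fun _ => 1, analyticAt_const, fun h => ?_, 1, one_pos, by simp⟩
    exact one_ne_zero h.self_of_nhds
  | insert i s _ ih =>
    obtain ⟨G, hG, hG0, R, hR, h⟩ := ih fun j hj => hg j (Finset.mem_insert_of_mem hj)
    have hi := hg i (Finset.mem_insert_self i s)
    by_cases hi0 : ∀ᶠ x in 𝓝 p, g i x = 0
    · obtain ⟨R', hR', h'⟩ := Metric.eventually_nhds_iff_ball.1 hi0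
      refine ⟨G, hG, hG0, min R R', by positivity, fun j hj => ?_⟩
      rcases Finset.mem_insert.1 hj with rfl | hj
      · exact Or.inr fun x hx => h' x (Metric.ball_subset_ball (min_le_right _ _) hx)
      · exact (h j hj).imp_right fun h x hx =>
          h x (Metric.ball_subset_ball (min_le_left _ _) hx)
    · refine ⟨fun x => g i x * G x, hi.fun_mul hG, not_eventually_mul_eq_zero hi hG hi0 hG0, R, hR,
        fun j hj => ?_⟩
      rcases Finset.mem_insert.1 hj with rfl | hj
      · exact Or.inl fun x hx => left_ne_zero_of_mul hx
      · exact (h j hj).imp_left fun h x hx => h x (right_ne_zero_of_mul hx)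

lemma norm_slice_le_of_lt_abs {g : (Fin d → ℝ) → ℝ} {p : Fin d → ℝ} (hg : AnalyticAt ℝ g p)
    (v : Fin d → ℝ) :
    ∃ r₀ > 0, ∃ C > 0, ∀ r > 0, r ≤ r₀ → ∀ x ∈ Metric.ball p (r + r), ∀ f : ℝ → ℂ,
      IntegrableOn f (Icc (-(r / (‖v‖ + 1))) (r / (‖v‖ + 1))) → ∀ K : ℝ, 0 ≤ K →
      (∀ J ⊆ Icc (-(r / (‖v‖ + 1))) (r / (‖v‖ + 1)), J.OrdConnected →
        (∀ t ∈ J, g (x + t • v) ≠ 0) → ‖∫ t in J, f t‖ ≤ K) →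
      ∀ n : ℕ, C * (1 / 2) ^ n < |g x| →
        ‖∫ t in Icc (-(r / (‖v‖ + 1))) (r / (‖v‖ + 1)), f t‖ ≤ (n + 1) * K := by
  obtain ⟨r₁, hr₁, C, hC, ρ, hρ, hb⟩ := exists_listDeriv_bound hg v
  obtain ⟨r₂, hr₂, ha⟩ := exists_ball_analyticAt hg
  refine ⟨min (r₁ / 3) (min (r₂ / 3) (ρ / 2)), by positivity, C, hC, fun r hr hrr x hx f hf K hK hJ
    n hn => ?_⟩
  have hrr₁ : r ≤ r₁ / 3 := hrr.trans (min_le_left _ _)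
  have hrr₂ : r ≤ r₂ / 3 := hrr.trans ((min_le_right _ _).trans (min_le_left _ _))
  have hrρ : r ≤ ρ / 2 := hrr.trans ((min_le_right _ _).trans (min_le_right _ _))
  set T := r / (‖v‖ + 1) with hT
  have hT0 : 0 < T := by positivity
  have hTr : T ≤ r := div_le_self hr.le (by linarith [norm_nonneg v])
  have hball : ∀ t ∈ Icc (-T) T, x + t • v ∈ Metric.ball p (r + r + r) := fun t ht =>
    add_smul_mem_ball hr hx ht
  have key : ∀ Z : Finset ℝ, (∀ z ∈ Z, z ∈ Icc (-T) T ∧ g (x + z • v) = 0) → Z.card ≠ n := by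
    intro Z hZ hZn
    have := abs_le_of_zeros (ordConnected_Icc (a := -T) (b := T))
      (fun i s => listDeriv (List.replicate i v) g (x + s • v))
      (fun i t ht => hasDerivAt_listDeriv_line
        (ha _ (Metric.ball_subset_ball (by linarith) (hball t ht))) i) Z
      (fun z hz => (hZ z hz).1) (fun z hz => (hZ z hz).2) (t := 0) (ℓ := T)
      (M := C * n.factorial * ρ⁻¹ ^ n) ⟨by linarith, hT0.le⟩
      (fun z hz => by rw [zero_sub, abs_neg]; exact abs_le.2 (hZ z hz).1)
      (fun s hs => by
        rw [hZn]
        exact hb _ (Metric.ball_subset_ball (by linarith) (hball s hs)) n)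
    rw [hZn] at this
    simp only [List.replicate_zero, listDeriv_nil, zero_smul, add_zero] at this
    refine absurd (hn.trans_le this) (not_lt.2 ?_)
    have hfac : (0 : ℝ) < n.factorial := by exact_mod_cast n.factorial_pos
    calc C * n.factorial * ρ⁻¹ ^ n / n.factorial * T ^ n = C * (T / ρ) ^ n := by
          rw [div_eq_mul_inv T, mul_pow]
          field_simp
      _ ≤ C * (1 / 2) ^ n := by
          have : T / ρ ≤ 1 / 2 := by rw [div_le_iff₀ hρ]; linarith
          exact mul_le_mul_of_nonneg_left (pow_le_pow_left₀ (by positivity) this n) hC.le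
  have hfin : {t ∈ Icc (-T) T | g (x + t • v) = 0}.Finite := by
    by_contra hinf
    obtain ⟨Z, hZ, hZn⟩ := (Set.Infinite.exists_subset_card_eq hinf n)
    exact key Z (fun z hz => hZ hz) hZn
  have hcard : hfin.toFinset.card ≤ n := by
    by_contra! hlt
    obtain ⟨Z, hZ, hZn⟩ := Finset.exists_subset_card_eq hlt.le
    exact key Z (fun z hz => by simpa using hZ hz) hZn
  have := norm_setIntegral_le_of_gaps (f := f) (I := Icc (-T) T) (S := univ) (by simpa using hf)
    (K := K) hfin.toFinset ordConnected_Icc (fun J hJI hJo hJZ => by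
      rw [univ_inter]
      refine hJ J hJI hJo fun t ht h0 => hJZ t ?_ ht
      simpa using ⟨hJI ht, h0⟩)
  rw [univ_inter] at this
  refine this.trans ?_
  have : (hfin.toFinset.card : ℝ) ≤ n := by exact_mod_cast hcard
  gcongr

lemma measure_inter_le_rpow {X : Type*} [MeasurableSpace X] {μ : Measure X} (A B : Set X) {η : ℝ}
    (hη0 : 0 ≤ η) (hη1 : η ≤ 1) : μ (A ∩ B) ≤ μ A ^ η * μ B ^ (1 - η) := by
  calc μ (A ∩ B) = μ (A ∩ B) ^ η * μ (A ∩ B) ^ (1 - η) := by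
        rw [← ENNReal.rpow_add_of_nonneg _ _ hη0 (by linarith)]; simp
    _ ≤ μ A ^ η * μ B ^ (1 - η) := by
        have : 0 ≤ 1 - η := by linarith
        gcongr
        · exact inter_subset_left
        · exact inter_subset_right

lemma enorm_integral_le_of_slices {g : (Fin d → ℝ) → ℝ} {p : Fin d → ℝ} (hg : AnalyticAt ℝ g p)
    (hne : ¬ ∀ᶠ x in 𝓝 p, g x = 0) (v : Fin d → ℝ) {η : ℝ} (hη0 : 0 < η) (hη1 : η ≤ 1) :
    ∃ r₀ > 0, ∀ r > 0, r ≤ r₀ → ∃ C > 0, ∀ f : (Fin d → ℝ) → ℂ, Measurable f →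
      (∀ x, ‖f x‖ ≤ 1) → (∀ x ∉ Metric.ball p r, f x = 0) → ∀ P : Set (Fin d → ℝ),
      (∀ x ∈ Metric.ball p (r + r) \ P,
        ∀ t ∈ Icc (-(r / (‖v‖ + 1))) (r / (‖v‖ + 1)), f (x + t • v) = 0) →
      ∀ K : ℝ, 0 < K →
      (∀ x ∈ Metric.ball p (r + r), ∀ J ⊆ Icc (-(r / (‖v‖ + 1))) (r / (‖v‖ + 1)), J.OrdConnected →
        (∀ t ∈ J, g (x + t • v) ≠ 0) → ‖∫ t in J, f (x + t • v)‖ ≤ K) →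
      ‖∫ x, f x‖ₑ ≤ ENNReal.ofReal (C * K) * volume P ^ (1 - η) := by
  obtain ⟨r₁, hr₁, C₁, hC₁, hslice⟩ := norm_slice_le_of_lt_abs hg v
  obtain ⟨r₂, hr₂, τ, hτ, hvol⟩ := exists_volume_sublevel_le hg hne
  obtain ⟨r₃, hr₃, ha⟩ := exists_ball_analyticAt hg
  refine ⟨min r₁ (min (r₂ / 2) (r₃ / 2)), by positivity, fun r hr hrr => ?_⟩
  have hrr₁ : r ≤ r₁ := hrr.trans (min_le_left _ _)
  have hrr₂ : r + r ≤ r₂ := by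
    linarith [hrr.trans ((min_le_right _ _).trans (min_le_left _ _))]
  have hrr₃ : r + r ≤ r₃ := by
    linarith [hrr.trans ((min_le_right _ _).trans (min_le_right _ _))]
  obtain ⟨C₂, hC₂, hvol⟩ := hvol (r + r) (by linarith) hrr₂
  set T := r / (‖v‖ + 1) with hT
  have hT0 : 0 < T := by positivity
  set B : ℕ → Set (Fin d → ℝ) := fun n =>
    {x ∈ Metric.ball p (r + r) | |g x| ≤ C₁ * (1 / 2) ^ n} with hB
  have hBm : ∀ n, MeasurableSet (B n) := fun n => by
    have := measurableSet_ball_sublevel (p := p) (R := r + r)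
      (fun x hx => ha x (Metric.ball_subset_ball hrr₃ hx)) {y | |y| ≤ C₁ * (1 / 2) ^ n}
      (measurableSet_le (by fun_prop) measurable_const)
    exact this
  set q : ℝ := (((1 / 2 : ℝ) ^ τ) ^ η) with hq
  have hq0 : 0 < q := by positivity
  have hq1 : q < 1 := by
    refine Real.rpow_lt_one (by positivity) ?_ hη0
    exact Real.rpow_lt_one (by positivity) (by norm_num) hτ
  set A : ℝ := (C₂ * C₁ ^ τ) ^ η with hA
  have hA0 : 0 < A := by positivity
  have hBvol : ∀ n, volume (B n) ^ η ≤ ENNReal.ofReal (A * q ^ n) := by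
    intro n
    have hp : (0 : ℝ) < C₁ * (1 / 2) ^ n := by positivity
    refine (ENNReal.rpow_le_rpow (hvol _ hp) hη0.le).trans ?_
    rw [ENNReal.ofReal_rpow_of_nonneg (by positivity) hη0.le]
    refine ENNReal.ofReal_le_ofReal (le_of_eq ?_)
    rw [Real.mul_rpow hC₁.le (by positivity), ← mul_assoc, Real.mul_rpow (by positivity)
      (by positivity), hA, hq]
    congr 1
    rw [← Real.rpow_natCast, ← Real.rpow_natCast, ← Real.rpow_mul, ← Real.rpow_mul,
      ← Real.rpow_mul, ← Real.rpow_mul]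
    · ring_nf
    all_goals positivity
  set V := (volume (Metric.ball p (r + r))).toReal with hV
  have hVfin : volume (Metric.ball p (r + r)) ≠ ⊤ := measure_ball_lt_top.ne
  set C := (V ^ η + A * (1 - q)⁻¹) / (2 * T) + 1 with hC
  have h1q : 0 < 1 - q := by linarith
  have hV0 : 0 ≤ V := ENNReal.toReal_nonneg
  refine ⟨C, by positivity, fun f hfm hf1 hfs P hP K hK hJ => ?_⟩
  have hfint : Integrable f := by
    have h1 : IntegrableOn f (Metric.ball p r) :=
      integrableOn_of_bound measure_ball_lt_top.ne hfm.aestronglyMeasurable hf1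
    exact (integrableOn_iff_integrable_of_support_subset fun x hx => by
      by_contra h; exact hx (hfs x h)).1 h1
  have hline : ∀ x : Fin d → ℝ, Measurable fun t : ℝ => f (x + t • v) := fun x =>
    hfm.comp (by fun_prop)
  set P' := toMeasurable volume P with hP'
  have hP'm : MeasurableSet P' := measurableSet_toMeasurable _ _
  have hPP' : P ⊆ P' := subset_toMeasurable _ _
  have hinner : ∀ x, ‖∫ t in Icc (-T) T, f (x + t • v)‖ₑ ≤
      (Metric.ball p (r + r) ∩ P').indicator
        (fun x => ENNReal.ofReal K * (1 + ∑' n, (B n).indicator 1 x)) x := by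
    intro x
    by_cases hx : x ∈ Metric.ball p (r + r)
    swap
    · have : ∫ t in Icc (-T) T, f (x + t • v) = 0 := by
        refine setIntegral_eq_zero_of_forall_eq_zero fun t ht => hfs _ fun h => hx ?_
        exact mem_ball_of_add_smul_mem hr h ht
      rw [this]; simp
    by_cases hxP : x ∈ P
    swap
    · have : ∫ t in Icc (-T) T, f (x + t • v) = 0 :=
        setIntegral_eq_zero_of_forall_eq_zero fun t ht => hP x ⟨hx, hxP⟩ t ht
      rw [this]; simp
    rw [indicator_of_mem (show x ∈ Metric.ball p (r + r) ∩ P' from ⟨hx, hPP' hxP⟩)]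
    by_cases hgx : g x = 0
    · have : ∑' n, (B n).indicator (1 : (Fin d → ℝ) → ℝ≥0∞) x = ⊤ := by
        have h1 : ∀ n, (B n).indicator (1 : (Fin d → ℝ) → ℝ≥0∞) x = 1 := fun n =>
          indicator_of_mem (show x ∈ B n from
            ⟨hx, by rw [hgx, abs_zero]; positivity⟩) _
        simp [h1]
      rw [this, add_top, ENNReal.mul_top (by simpa using hK)]
      exact le_top
    · have hex : ∃ n : ℕ, C₁ * (1 / 2) ^ n < |g x| := by
        obtain ⟨n, hn⟩ := exists_pow_lt_of_lt_one
          (div_pos (abs_pos.2 hgx) hC₁) (by norm_num : (1 / 2 : ℝ) < 1)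
        exact ⟨n, by rwa [lt_div_iff₀' hC₁] at hn⟩
      classical
      set n := Nat.find hex with hn
      have hsum : (n : ℝ≥0∞) ≤ ∑' n, (B n).indicator (1 : (Fin d → ℝ) → ℝ≥0∞) x := by
        refine le_trans (le_of_eq ?_) (ENNReal.sum_le_tsum (Finset.range n))
        rw [Finset.sum_congr rfl (g := fun _ => 1) fun m hm => ?_]
        · simp
        · exact indicator_of_mem (show x ∈ B m from ⟨hx, not_lt.1 (Nat.find_min hex (Finset.mem_range.1 hm))⟩) _
      have := hslice r hr hrr₁ x hx (fun t => f (x + t • v))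
        (integrableOn_of_bound isCompact_Icc.measure_lt_top.ne
          (hline x).aestronglyMeasurable fun t => hf1 _) K hK.le (hJ x hx) n (Nat.find_spec hex)
      rw [← ofReal_norm]
      refine (ENNReal.ofReal_le_ofReal this).trans ?_
      rw [mul_comm, ENNReal.ofReal_mul hK.le]
      gcongr
      rw [ENNReal.ofReal_add (by positivity) zero_le_one, ENNReal.ofReal_natCast,
        ENNReal.ofReal_one, add_comm]
      gcongr
  have hmain := (enorm_integral_le_slices v hT0.le hfm hfint).trans (lintegral_mono hinner)
  have hmB : MeasurableSet (Metric.ball p (r + r) ∩ P') := Metric.isOpen_ball.measurableSet.inter hP'm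
  rw [lintegral_indicator hmB, lintegral_const_mul' _ _ ENNReal.ofReal_ne_top,
    lintegral_add_left measurable_const,
    lintegral_tsum fun n => (measurable_one.indicator (hBm n)).aemeasurable] at hmain
  set W := volume P ^ (1 - η) with hW
  have hW' : volume P' ^ (1 - η) = W := by rw [hP', measure_toMeasurable]
  have h1 : ∫⁻ _ in Metric.ball p (r + r) ∩ P', 1 ≤ ENNReal.ofReal (V ^ η) * W := by
    rw [setLIntegral_one, ← ENNReal.ofReal_rpow_of_nonneg hV0 hη0.le, hV,
      ENNReal.ofReal_toReal hVfin, ← hW']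
    exact measure_inter_le_rpow _ _ hη0.le hη1
  have h2 : ∀ n, ∫⁻ x in Metric.ball p (r + r) ∩ P', (B n).indicator 1 x ≤
      ENNReal.ofReal (A * q ^ n) * W := by
    intro n
    rw [lintegral_indicator_one (hBm n), Measure.restrict_apply (hBm n)]
    refine (measure_mono (t := B n ∩ P') fun x hx => ⟨hx.1, hx.2.2⟩).trans ?_
    refine (measure_inter_le_rpow _ _ hη0.le hη1).trans ?_
    rw [hW']
    gcongr
    exact hBvol n
  have h3 : ∑' n, ∫⁻ x in Metric.ball p (r + r) ∩ P', (B n).indicator 1 x ≤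
      ENNReal.ofReal (A * (1 - q)⁻¹) * W := by
    refine (ENNReal.tsum_le_tsum h2).trans ?_
    rw [ENNReal.tsum_mul_right, ← tsum_geometric_of_lt_one hq0.le hq1, ← tsum_mul_left,
      ENNReal.ofReal_tsum_of_nonneg (fun n => by positivity)
        ((summable_geometric_of_lt_one hq0.le hq1).mul_left A)]
  have h4 : ENNReal.ofReal (2 * T) * ‖∫ x, f x‖ₑ ≤
      ENNReal.ofReal (2 * T) * (ENNReal.ofReal (C * K) * W) := by
    refine hmain.trans ((mul_le_mul_right (add_le_add h1 h3) _).trans ?_)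
    rw [← add_mul, ← ENNReal.ofReal_add (by positivity) (by positivity), ← mul_assoc, ← mul_assoc,
      ← ENNReal.ofReal_mul hK.le, ← ENNReal.ofReal_mul (by positivity)]
    refine mul_le_mul_left (ENNReal.ofReal_le_ofReal ?_) _
    rw [hC]
    have : 2 * T * (((V ^ η + A * (1 - q)⁻¹) / (2 * T) + 1) * K) =
      K * (V ^ η + A * (1 - q)⁻¹) + 2 * T * K := by field_simp
    rw [this]
    have : 0 < 2 * T * K := by positivity
    linarith
  exact (ENNReal.mul_le_mul_iff_right (by simpa using hT0) ENNReal.ofReal_ne_top).1 h4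

end SliceEstimate

section Semianalytic

open Filter Topology Set

variable {d : ℕ}

lemma monotoneOn_or_antitoneOn_line {g : (Fin d → ℝ) → ℝ} {x v : Fin d → ℝ} {J : Set ℝ}
    (hJ : J.OrdConnected) (hg : ∀ t ∈ J, AnalyticAt ℝ g (x + t • v))
    (h0 : (∀ t ∈ J, dirDeriv v g (x + t • v) ≠ 0) ∨ (∀ t ∈ J, dirDeriv v g (x + t • v) = 0)) :
    MonotoneOn (fun t : ℝ => g (x + t • v)) J ∨ AntitoneOn (fun t : ℝ => g (x + t • v)) J := by
  have hd : ∀ t ∈ J, HasDerivAt (fun s : ℝ => g (x + s • v)) (dirDeriv v g (x + t • v)) t :=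
    fun t ht => hasDerivAt_line (hg t ht)
  rcases h0 with h0 | h0
  · refine monotoneOn_or_antitoneOn_of_ne_zero hJ hd (fun t ht => ?_) h0
    exact (hasDerivAt_line (analyticAt_dirDeriv (hg t ht) v)).continuousAt.continuousWithinAt
  · left
    refine monotoneOn_of_deriv_nonneg hJ.convex
      (fun t ht => (hd t ht).continuousAt.continuousWithinAt)
      (fun t ht => (hd t (interior_subset ht)).differentiableAt.differentiableWithinAt)
      fun t ht => ?_
    rw [(hd t (interior_subset ht)).deriv, h0 t (interior_subset ht)]

lemma pos_iff_pos_of_ne_zero {J : Set ℝ} (hJ : J.OrdConnected) {f : ℝ → ℝ} (hf : ContinuousOn f J)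
    (h0 : (∀ t ∈ J, f t ≠ 0) ∨ (∀ t ∈ J, f t = 0)) {s t : ℝ} (hs : s ∈ J) (ht : t ∈ J) :
    (0 < f s ↔ 0 < f t) := by
  rcases h0 with h0 | h0
  swap
  · rw [h0 s hs, h0 t ht]
  have key : ∀ s ∈ J, ∀ t ∈ J, 0 < f s → 0 < f t := by
    intro s hs t ht hfs
    by_contra! hft
    obtain ⟨z, hz, hz'⟩ := hJ.isPreconnected.intermediate_value ht hs hf ⟨hft, hfs.le⟩
    exact h0 z hz hz'
  exact ⟨key s hs t ht, key t ht s hs⟩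

lemma eq_zero_iff_of_ne_zero {J : Set ℝ} {f : ℝ → ℝ}
    (h0 : (∀ t ∈ J, f t ≠ 0) ∨ (∀ t ∈ J, f t = 0)) {s t : ℝ} (hs : s ∈ J) (ht : t ∈ J) :
    (f s = 0 ↔ f t = 0) := by
  rcases h0 with h0 | h0
  · simp [h0 s hs, h0 t ht]
  · simp [h0 s hs, h0 t ht]

lemma IsSemianalytic.exists_germ {U D : Set (Fin d → ℝ)} (hU : IsOpen U) (hD : IsSemianalytic U D)
    {p : Fin d → ℝ} (hp : p ∈ U) {ι : Type} [Fintype ι] (h : ι → (Fin d → ℝ) → ℝ)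
    (hh : ∀ i, AnalyticAt ℝ (h i) p) :
    ∃ G : (Fin d → ℝ) → ℝ, AnalyticAt ℝ G p ∧ (¬ ∀ᶠ x in 𝓝 p, G x = 0) ∧ ∃ R > 0,
      ∀ (x v : Fin d → ℝ) (J : Set ℝ), J.OrdConnected →
        (∀ t ∈ J, x + t • v ∈ Metric.ball p R) → (∀ t ∈ J, G (x + t • v) ≠ 0) →
        ((∀ t ∈ J, x + t • v ∈ D) ∨ (∀ t ∈ J, x + t • v ∉ D)) ∧
        ∀ i, (∀ t ∈ J, h i (x + t • v) ≠ 0) ∨ (∀ t ∈ J, h i (x + t • v) = 0) := by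
  obtain ⟨n, k, l, f, g, hf, hg, rfl⟩ := hD
  set q : ((Σ i : Fin n, Fin (k i)) ⊕ (Σ i : Fin n, Fin (l i))) ⊕ ι → (Fin d → ℝ) → ℝ :=
    Sum.elim (Sum.elim (fun s => f s.1 s.2) (fun s => g s.1 s.2)) h with hq
  have hqa : ∀ i ∈ Finset.univ, AnalyticAt ℝ (q i) p := by
    rintro ((s | s) | s) -
    · exact hf s.1 s.2 p hp
    · exact hg s.1 s.2 p hp
    · exact hh s
  obtain ⟨G, hG, hG0, R, hR, hGq⟩ := exists_common_germ Finset.univ q hqa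
  obtain ⟨R', hR', hR'U⟩ := Metric.isOpen_iff.1 hU p hp
  refine ⟨G, hG, hG0, min R R', by positivity, fun x v J hJ hball hne => ?_⟩
  have hB : ∀ t ∈ J, x + t • v ∈ Metric.ball p R := fun t ht =>
    Metric.ball_subset_ball (min_le_left _ _) (hball t ht)
  have hBU : ∀ t ∈ J, x + t • v ∈ U := fun t ht =>
    hR'U (Metric.ball_subset_ball (min_le_right _ _) (hball t ht))
  have hgood : ∀ i, (∀ t ∈ J, q i (x + t • v) ≠ 0) ∨ (∀ t ∈ J, q i (x + t • v) = 0) := by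
    intro i
    rcases hGq i (Finset.mem_univ i) with h | h
    · exact Or.inl fun t ht => h _ (hne t ht)
    · exact Or.inr fun t ht => h _ (hB t ht)
  refine ⟨?_, fun i => hgood (Sum.inr i)⟩
  have hconst : ∀ s ∈ J, ∀ t ∈ J,
      x + s • v ∈ ⋃ i, {x ∈ U | (∀ j, f i j x = 0) ∧ ∀ j, 0 < g i j x} →
      x + t • v ∈ ⋃ i, {x ∈ U | (∀ j, f i j x = 0) ∧ ∀ j, 0 < g i j x} := by
    intro s hs t ht hmem
    obtain ⟨i, -, h1, h2⟩ := mem_iUnion.1 hmem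
    refine mem_iUnion.2 ⟨i, hBU t ht, fun j => ?_, fun j => ?_⟩
    · exact (eq_zero_iff_of_ne_zero (f := fun t : ℝ => f i j (x + t • v))
        (hgood (Sum.inl (Sum.inl ⟨i, j⟩))) hs ht).1 (h1 j)
    · refine (pos_iff_pos_of_ne_zero hJ (f := fun t : ℝ => g i j (x + t • v)) (fun t ht => ?_)
        (hgood (Sum.inl (Sum.inr ⟨i, j⟩))) hs ht).1 (h2 j)
      exact (hasDerivAt_line (hg i j _ (hBU t ht))).continuousAt.continuousWithinAt
  by_cases hex : ∃ s ∈ J, x + s • v ∈ ⋃ i, {x ∈ U | (∀ j, f i j x = 0) ∧ ∀ j, 0 < g i j x}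
  · obtain ⟨s, hs, hsD⟩ := hex
    exact Or.inl fun t ht => hconst s hs t ht hsD
  · push Not at hex
    exact Or.inr hex

lemma IsSemianalytic.measurableSet {U D : Set (Fin d → ℝ)} (hU : IsOpen U)
    (hD : IsSemianalytic U D) : MeasurableSet D := by
  obtain ⟨n, k, l, f, g, hf, hg, rfl⟩ := hD
  have key : ∀ q : (Fin d → ℝ) → ℝ, AnalyticOnNhd ℝ q U → ∀ s : Set ℝ, MeasurableSet s →
      MeasurableSet {x ∈ U | q x ∈ s} := by
    intro q hq s hs
    have h1 : Measurable (U.domRestrict q) := hq.continuousOn.domRestrict.measurable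
    have h2 : {x ∈ U | q x ∈ s} = Subtype.val '' ((U.domRestrict q) ⁻¹' s) := by
      ext x; simp [Set.domRestrict, and_comm]
    rw [h2]
    exact hU.measurableSet.subtype_image (h1 hs)
  refine MeasurableSet.iUnion fun i => ?_
  have : {x ∈ U | (∀ j, f i j x = 0) ∧ ∀ j, 0 < g i j x} =
      U ∩ ((⋂ j, {x ∈ U | f i j x ∈ ({0} : Set ℝ)}) ∩ ⋂ j, {x ∈ U | g i j x ∈ Ioi 0}) := by
    ext x
    simp only [mem_ofPred_eq, mem_inter_iff, mem_iInter, mem_singleton_iff, mem_Ioi]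
    constructor
    · rintro ⟨h, h1, h2⟩
      exact ⟨h, fun j => ⟨h, h1 j⟩, fun j => ⟨h, h2 j⟩⟩
    · rintro ⟨h, h1, h2⟩
      exact ⟨h, fun j => (h1 j).2, fun j => (h2 j).2⟩
  rw [this]
  exact hU.measurableSet.inter ((MeasurableSet.iInter fun j =>
    key _ (hf i j) _ (measurableSet_singleton 0)).inter (MeasurableSet.iInter fun j =>
    key _ (hg i j) _ measurableSet_Ioi))

lemma measurable_indicator_exp {F : (Fin d → ℝ) → ℝ} {p : Fin d → ℝ} {R : ℝ}
    (hF : ∀ x ∈ Metric.ball p R, AnalyticAt ℝ F x) {S : Set (Fin d → ℝ)} (hS : MeasurableSet S)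
    (hSR : S ⊆ Metric.ball p R) (lam : ℝ) :
    Measurable (S.indicator fun x => Complex.exp (Complex.I * lam * F x)) := by
  have hc : ContinuousOn (fun x => Complex.exp (Complex.I * lam * F x)) S := by
    have : ContinuousOn F S := fun x hx => (hF x (hSR hx)).continuousAt.continuousWithinAt
    fun_prop
  have h1 : Measurable (S.domRestrict fun x => Complex.exp (Complex.I * lam * F x)) :=
    hc.domRestrict.measurable
  classical
  rw [← piecewise_eq_indicator]
  exact measurable_of_restrict_of_restrict_compl hS (by
    have : S.domRestrict (S.piecewise (fun x => Complex.exp (Complex.I * lam * F x)) 0) =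
      S.domRestrict fun x => Complex.exp (Complex.I * lam * F x) := by
        ext x; simp
    rw [this]; exact h1) (by
    have : Sᶜ.domRestrict (S.piecewise (fun x => Complex.exp (Complex.I * lam * F x)) 0) = 0 := by
        ext ⟨x, hx⟩; exact piecewise_eq_of_notMem _ _ _ hx
    rw [this]; exact measurable_const)

lemma measurableSet_region {A B : (Fin d → ℝ) → ℝ} {p : Fin d → ℝ} {r : ℝ}
    {E : Set (Fin d → ℝ)} (hE : MeasurableSet E) (hEr : E ⊆ Metric.ball p r)
    (hA : ∀ x ∈ Metric.ball p r, AnalyticAt ℝ A x) (hB : ∀ x ∈ Metric.ball p r, AnalyticAt ℝ B x)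
    {S₁ S₂ : Set ℝ} (hS₁ : MeasurableSet S₁) (hS₂ : MeasurableSet S₂) :
    MeasurableSet {x ∈ E | A x ∈ S₁ ∧ B x ∈ S₂} := by
  have h1 := measurableSet_ball_sublevel hA S₁ hS₁
  have h2 := measurableSet_ball_sublevel hB S₂ hS₂
  have : {x ∈ E | A x ∈ S₁ ∧ B x ∈ S₂} = E ∩ ({x ∈ Metric.ball p r | A x ∈ S₁} ∩
      {x ∈ Metric.ball p r | B x ∈ S₂}) := by
    ext x
    constructor
    · intro hx
      exact ⟨hx.1, ⟨hEr hx.1, hx.2.1⟩, ⟨hEr hx.1, hx.2.2⟩⟩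
    · intro hx
      exact ⟨hx.1, hx.2.1.2, hx.2.2.2⟩
  rw [this]
  exact hE.inter (h1.inter h2)

lemma norm_exp_I_mul (lam y : ℝ) : ‖Complex.exp (Complex.I * lam * y)‖ = 1 := by
  have : Complex.I * lam * y = ((lam * y : ℝ) : ℂ) * Complex.I := by push_cast; ring
  rw [this, Complex.norm_exp_ofReal_mul_I]

/-- The oscillatory integral over a piece of `D` cut out by two monotone-along-lines functions,
one of which is a directional derivative of the phase and is bounded from below there. -/
lemma enorm_setIntegral_region_le {U D : Set (Fin d → ℝ)} (hU : IsOpen U)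
    (hD : IsSemianalytic U D) {F B : (Fin d → ℝ) → ℝ} (hF : AnalyticOnNhd ℝ F U)
    {p : Fin d → ℝ} (hp : p ∈ U) (hB : AnalyticAt ℝ B p) (v : Fin d → ℝ) (b : ℕ) {η : ℝ}
    (hη0 : 0 < η) (hη1 : η ≤ 1) :
    ∃ r₀ > 0, ∀ r > 0, r ≤ r₀ → ∃ C > 0, ∀ Q ⊆ Metric.ball p r, Convex ℝ Q → MeasurableSet Q →
      ∀ S₁ S₂ : Set ℝ, S₁.OrdConnected → S₂.OrdConnected → ∀ c > 0, (∀ y ∈ S₁, c ≤ |y|) →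
      ∀ lam : ℝ, lam ≠ 0 → ∀ P : Set (Fin d → ℝ),
      (∀ x ∈ Metric.ball p (r + r) \ P, ∀ t ∈ Icc (-(r / (‖v‖ + 1))) (r / (‖v‖ + 1)),
        listDeriv (List.replicate (b + 1) v) F (x + t • v) ∈ S₁ → B (x + t • v) ∉ S₂) →
      ‖∫ x in {x ∈ D ∩ Q | listDeriv (List.replicate (b + 1) v) F x ∈ S₁ ∧ B x ∈ S₂},
        Complex.exp (Complex.I * lam * F x)‖ₑ ≤
      ENNReal.ofReal (C * (|lam| * c) ^ (-((1 : ℝ) / ((b + 1 : ℕ) : ℝ)))) *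
        volume P ^ (1 - η) := by
  set A := listDeriv (List.replicate (b + 1) v) F with hA
  have hFp := hF p hp
  have hAp : AnalyticAt ℝ A p := analyticAt_listDeriv hFp _
  obtain ⟨G, hG, hG0, R₁, hR₁, hgood⟩ := hD.exists_germ hU hp
    (![dirDeriv v A, dirDeriv v B, dirDeriv v (dirDeriv v F)]) (by
      intro i
      fin_cases i
      · exact analyticAt_dirDeriv hAp v
      · exact analyticAt_dirDeriv hB v
      · exact analyticAt_dirDeriv (analyticAt_dirDeriv hFp v) v)
  obtain ⟨r₂, hr₂, hslice⟩ := enorm_integral_le_of_slices hG hG0 v hη0 hη1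
  obtain ⟨R₃, hR₃, hFa⟩ := exists_ball_analyticAt hFp
  obtain ⟨R₄, hR₄, hBa⟩ := exists_ball_analyticAt hB
  refine ⟨min r₂ (min (R₁ / 3) (min (R₃ / 3) (R₄ / 3))), by positivity, fun r hr hrr => ?_⟩
  simp only [le_min_iff] at hrr
  obtain ⟨hrr₂, hrr₁, hrr₃, hrr₄⟩ := hrr
  obtain ⟨C, hC, hslice⟩ := hslice r hr hrr₂
  refine ⟨C * (4 ^ (b + 1) * 4 ^ ((1 : ℝ) / ((b + 1 : ℕ) : ℝ))), by positivity,
    fun Q hQ hQc hQm S₁ S₂ hS₁ hS₂ c hc hcS lam hlam P hP => ?_⟩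
  have hlam' : 0 < |lam| := abs_pos.2 hlam
  set S := {x ∈ D ∩ Q | A x ∈ S₁ ∧ B x ∈ S₂} with hS
  have hSb : S ⊆ Metric.ball p r := fun x hx => hQ hx.1.2
  have hFr : ∀ x ∈ Metric.ball p r, AnalyticAt ℝ F x := fun x hx =>
    hFa x (Metric.ball_subset_ball (by linarith) hx)
  have hSm : MeasurableSet S := by
    exact measurableSet_region ((hD.measurableSet hU).inter hQm) (fun x hx => hQ hx.2)
      (fun x hx => analyticAt_listDeriv (hFr x hx) _)
      (fun x hx => hBa x (Metric.ball_subset_ball (by linarith) hx))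
      hS₁.measurableSet hS₂.measurableSet
  set f := S.indicator fun x => Complex.exp (Complex.I * lam * F x) with hf
  have hrpow : (4 : ℝ) ^ (b + 1) * (4 / |lam| / c) ^ ((1 : ℝ) / ((b + 1 : ℕ) : ℝ)) =
      4 ^ (b + 1) * 4 ^ ((1 : ℝ) / ((b + 1 : ℕ) : ℝ)) *
        (|lam| * c) ^ (-((1 : ℝ) / ((b + 1 : ℕ) : ℝ))) := by
    rw [div_div, div_eq_mul_inv, Real.mul_rpow (by norm_num) (by positivity), mul_assoc,
      Real.inv_rpow (by positivity), Real.rpow_neg (by positivity)]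
  have := hslice f (measurable_indicator_exp hFr hSm hSb lam) (fun x => ?_)
    (fun x hx => indicator_of_notMem (fun h => hx (hSb h)) _) P (fun x hx t ht => ?_)
    (4 ^ (b + 1) * (4 / |lam| / c) ^ ((1 : ℝ) / ((b + 1 : ℕ) : ℝ))) (by positivity)
    (fun x hx J hJT hJ hJG => ?_)
  · rw [hf, integral_indicator hSm, hrpow] at this
    rwa [mul_assoc C]
  · refine (norm_indicator_le_norm_self _ _).trans (le_of_eq (norm_exp_I_mul _ _))
  · refine indicator_of_notMem (fun h => hP x hx t ht h.2.1 h.2.2) _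
  · have hball : ∀ t ∈ J, x + t • v ∈ Metric.ball p (r + r + r) := fun t ht =>
      add_smul_mem_ball hr hx (hJT ht)
    obtain ⟨hDJ, hfam⟩ := hgood x v J hJ
      (fun t ht => Metric.ball_subset_ball (by linarith) (hball t ht)) hJG
    have hFJ : ∀ t ∈ J, AnalyticAt ℝ F (x + t • v) := fun t ht =>
      hFa _ (Metric.ball_subset_ball (by linarith) (hball t ht))
    have hK0 : (0 : ℝ) ≤ 4 ^ (b + 1) * (4 / |lam| / c) ^ ((1 : ℝ) / ((b + 1 : ℕ) : ℝ)) := by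
      positivity
    rcases hDJ with hDJ | hDJ
    swap
    · rw [setIntegral_eq_zero_of_forall_eq_zero]
      · simpa using hK0
      · intro t ht
        exact indicator_of_notMem (fun h => hDJ t ht h.1.1) _
    have hQJ : {t ∈ J | x + t • v ∈ Q}.OrdConnected := by
      have : Convex ℝ {t : ℝ | x + t • v ∈ Q} := by
        intro s hs t ht a b ha hb hab
        have h1 := hQc hs ht ha hb hab
        have h2 : a • (x + s • v) + b • (x + t • v) = x + (a • s + b • t) • v := by
          rw [smul_add, smul_add, add_add_add_comm, ← add_smul, hab, one_smul, smul_smul,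
            smul_smul, ← add_smul]
          rfl
        rwa [h2] at h1
      exact hJ.inter this.ordConnected
    have hAmon := monotoneOn_or_antitoneOn_line hJ
      (fun t ht => analyticAt_listDeriv (hFJ t ht) (List.replicate (b + 1) v)) (hfam 0)
    have hBmon := monotoneOn_or_antitoneOn_line hJ (fun t ht =>
      hBa _ (Metric.ball_subset_ball (by linarith) (hball t ht))) (hfam 1)
    have hFmon := monotoneOn_or_antitoneOn_line hJ
      (fun t ht => analyticAt_dirDeriv (hFJ t ht) v) (hfam 2)
    set J' := {t ∈ J | x + t • v ∈ S} with hJ'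
    have hJ'J : J' ⊆ J := fun t ht => ht.1
    have hJ'o : J'.OrdConnected := by
      have h1 := ordConnected_sep_of_monotoneOn hJ hAmon hS₁
      have h2 := ordConnected_sep_of_monotoneOn hJ hBmon hS₂
      have : J' = {t ∈ J | x + t • v ∈ Q} ∩ ({t ∈ J | A (x + t • v) ∈ S₁} ∩
          {t ∈ J | B (x + t • v) ∈ S₂}) := by
        ext t
        constructor
        · intro h
          exact ⟨⟨h.1, h.2.1.2⟩, ⟨h.1, h.2.2.1⟩, ⟨h.1, h.2.2.2⟩⟩
        · intro h
          exact ⟨h.1.1, ⟨hDJ t h.1.1, h.1.2⟩, h.2.1.2, h.2.2.2⟩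
      rw [this]
      exact hQJ.inter (h1.inter h2)
    have hint : ∫ t in J, f (x + t • v) =
        ∫ t in J', Complex.exp (Complex.I * lam * F (x + t • v)) := by
      have hpre : MeasurableSet {t : ℝ | x + t • v ∈ S} :=
        (by fun_prop : Measurable fun t : ℝ => x + t • v) hSm
      have h1 : (fun t : ℝ => f (x + t • v)) = {t : ℝ | x + t • v ∈ S}.indicator
          fun t => Complex.exp (Complex.I * lam * F (x + t • v)) := by
        ext t
        by_cases h : x + t • v ∈ S
        · rw [indicator_of_mem (show t ∈ {t : ℝ | x + t • v ∈ S} from h), hf, indicator_of_mem h]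
        · rw [indicator_of_notMem (show t ∉ {t : ℝ | x + t • v ∈ S} from h), hf,
            indicator_of_notMem h]
      rw [h1, setIntegral_indicator hpre]
      rfl
    rw [hint]
    refine vanDerCorput hJ'o (((Metric.isBounded_Icc _ _).subset hJT).subset hJ'J)
      (fun i t => listDeriv (List.replicate i v) F (x + t • v))
      (fun i t ht => hasDerivAt_listDeriv_line (hFJ t (hJ'J ht)) i) b hc hlam
      (fun t ht => hcS _ ht.2.2.1) (Or.inr ?_)
    exact hFmon.imp (fun h => h.mono hJ'J) (fun h => h.mono hJ'J)

end Semianalytic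

section LocalEstimate

open Filter Topology Set

variable {d : ℕ}

lemma volume_tube_le {A B : (Fin d → ℝ) → ℝ} {p : Fin d → ℝ} (hA : AnalyticAt ℝ A p)
    (hB : AnalyticAt ℝ B p) (v : Fin d → ℝ) {e R C₀ : ℝ} (hR : 0 < R) (hC₀ : 0 < C₀)
    (hvol : ∀ ε > 0, volume {x ∈ Metric.ball p R | |A x| ≤ ε ∧ |B x| ≤ ε} ≤
      ENNReal.ofReal (C₀ * ε ^ e)) :
    ∃ r₀ > 0, ∀ r > 0, r ≤ r₀ → ∃ C > 0, ∀ ε > 0, ε ≤ 1 →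
      volume {x ∈ Metric.ball p (r + r) | ∃ t ∈ Icc (-(r / (‖v‖ + 1))) (r / (‖v‖ + 1)),
        |A (x + t • v)| ≤ ε ∧ |B (x + t • v)| ≤ ε} ≤ ENNReal.ofReal (C * ε ^ (e - 1)) := by
  obtain ⟨KA, sA, hsA, hKA⟩ := (hA.contDiffAt (n := 1)).exists_lipschitzOnWith
  obtain ⟨KB, sB, hsB, hKB⟩ := (hB.contDiffAt (n := 1)).exists_lipschitzOnWith
  obtain ⟨R₁, hR₁, hR₁A⟩ := Metric.mem_nhds_iff.1 hsA
  obtain ⟨R₂, hR₂, hR₂B⟩ := Metric.mem_nhds_iff.1 hsB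
  obtain ⟨R₃, hR₃, hAa⟩ := exists_ball_analyticAt hA
  obtain ⟨R₄, hR₄, hBa⟩ := exists_ball_analyticAt hB
  refine ⟨min R (min R₁ (min R₂ (min R₃ R₄))) / 4, by positivity, fun r hr hrr => ?_⟩
  have hr4 : r + r + (r + r) ≤ min R (min R₁ (min R₂ (min R₃ R₄))) := by linarith
  simp only [le_min_iff] at hr4
  obtain ⟨hrR, hrR₁, hrR₂, hrR₃, hrR₄⟩ := hr4
  set T := r / (‖v‖ + 1) with hT
  have hT0 : 0 < T := by positivity
  set M : ℝ := 1 + (KA + KB) * ‖v‖ * T with hM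
  have hM0 : 0 < M := by positivity
  refine ⟨2 * (C₀ * M ^ e), by positivity, fun ε hε hε1 => ?_⟩
  set S := {x ∈ Metric.ball p (r + r + (r + r)) | |A x| ≤ M * ε ∧ |B x| ≤ M * ε} with hS
  have habs : MeasurableSet {y : ℝ | |y| ≤ M * ε} :=
    measurableSet_le (by fun_prop) measurable_const
  have hSm : MeasurableSet S :=
    measurableSet_region measurableSet_ball le_rfl
      (fun x hx => hAa x (Metric.ball_subset_ball hrR₃ hx))
      (fun x hx => hBa x (Metric.ball_subset_ball hrR₄ hx)) habs habs
  have h2T : 2 * T = (r + r) / (‖v‖ + 1) := by rw [hT]; ring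
  have hlip : ∀ (H : (Fin d → ℝ) → ℝ) (K : NNReal) (x : Fin d → ℝ) (s t : ℝ),
      LipschitzOnWith K H (Metric.ball p (r + r + (r + r))) → (K : ℝ) ≤ KA + KB →
      x ∈ Metric.ball p (r + r) → t ∈ Icc (-(2 * T)) (2 * T) → s ∈ Icc (-(2 * T)) (2 * T) →
      |s - t| ≤ T * ε → |H (x + t • v)| ≤ ε → |H (x + s • v)| ≤ M * ε := by
    intro H K x s t hH hK hx ht hs hst hHt
    rw [h2T] at ht hs
    have hr2 : 0 < r + r := by linarith
    have h1 := hH.dist_le_mul _ (add_smul_mem_ball hr2 hx hs) _ (add_smul_mem_ball hr2 hx ht)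
    rw [Real.dist_eq, dist_eq_norm] at h1
    have h2 : x + s • v - (x + t • v) = (s - t) • v := by rw [sub_smul]; abel
    rw [h2, norm_smul, Real.norm_eq_abs] at h1
    have h3 : (K : ℝ) * (|s - t| * ‖v‖) ≤ (KA + KB) * ((T * ε) * ‖v‖) := by gcongr
    have h4 := abs_sub_abs_le_abs_sub (H (x + s • v)) (H (x + t • v))
    rw [hM]
    nlinarith
  set P := {x ∈ Metric.ball p (r + r) | ∃ t ∈ Icc (-T) T,
        |A (x + t • v)| ≤ ε ∧ |B (x + t • v)| ≤ ε} with hP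
  have hslice : ∀ x ∈ P, ENNReal.ofReal (2 * T * ε) ≤
      volume {t ∈ Icc (-(2 * T)) (2 * T) | x + t • v ∈ S} := by
    rintro x ⟨hx, t, ht, htA, htB⟩
    have hTε : T * ε ≤ T := by nlinarith
    have hsub : Icc (t - T * ε) (t + T * ε) ⊆
        {t ∈ Icc (-(2 * T)) (2 * T) | x + t • v ∈ S} := by
      intro s hs
      have hs2 : s ∈ Icc (-(2 * T)) (2 * T) :=
        ⟨by linarith [hs.1, ht.1], by linarith [hs.2, ht.2]⟩
      have ht2 : t ∈ Icc (-(2 * T)) (2 * T) := ⟨by linarith [ht.1], by linarith [ht.2]⟩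
      have hst : |s - t| ≤ T * ε := abs_le.2 ⟨by linarith [hs.1], by linarith [hs.2]⟩
      refine ⟨hs2, ?_, ?_, ?_⟩
      · rw [h2T] at hs2
        exact add_smul_mem_ball (by linarith) hx hs2
      · exact hlip A KA x s t
          (hKA.mono ((Metric.ball_subset_ball hrR₁).trans hR₁A)) (by simp) hx ht2 hs2 hst htA
      · exact hlip B KB x s t
          (hKB.mono ((Metric.ball_subset_ball hrR₂).trans hR₂B)) (by simp) hx ht2 hs2 hst htB
    refine le_trans (le_of_eq ?_) (measure_mono hsub)
    rw [Real.volume_Icc]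
    congr 1; ring
  have hmeas : Measurable fun x : Fin d → ℝ =>
      volume {t ∈ Icc (-(2 * T)) (2 * T) | x + t • v ∈ S} := by
    have hm : MeasurableSet ((fun z : (Fin d → ℝ) × ℝ => z.1 + z.2 • v) ⁻¹' S) :=
      measurable_add_smul v hSm
    have h1 : ∀ x : Fin d → ℝ, volume {t ∈ Icc (-(2 * T)) (2 * T) | x + t • v ∈ S} =
        (volume.restrict (Icc (-(2 * T)) (2 * T)))
          (Prod.mk x ⁻¹' ((fun z : (Fin d → ℝ) × ℝ => z.1 + z.2 • v) ⁻¹' S)) := by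
      intro x
      rw [Measure.restrict_apply (measurable_prodMk_left hm)]
      congr 1
      ext t
      simp only [mem_ofPred_eq, mem_inter_iff, mem_preimage]
      tauto
    simp only [h1]
    exact measurable_measure_prodMk_left hm
  have hmark := mul_meas_ge_le_lintegral (μ := volume) hmeas (ENNReal.ofReal (2 * T * ε))
  rw [lintegral_volume_slice v hSm] at hmark
  have hSvol : volume S ≤ ENNReal.ofReal (C₀ * (M * ε) ^ e) := by
    refine (measure_mono ?_).trans (hvol (M * ε) (by positivity))
    rintro x ⟨hx, hx'⟩
    exact ⟨Metric.ball_subset_ball hrR hx, hx'⟩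
  have hfinal : ENNReal.ofReal (2 * T * ε) * volume P ≤
      ENNReal.ofReal (2 * T * ε) * ENNReal.ofReal (2 * (C₀ * M ^ e) * ε ^ (e - 1)) := by
    calc ENNReal.ofReal (2 * T * ε) * volume P ≤ _ := by
          refine mul_le_mul_right (measure_mono ?_) _
          exact hslice
      _ ≤ _ := hmark
      _ ≤ ENNReal.ofReal (2 * (2 * T)) * ENNReal.ofReal (C₀ * (M * ε) ^ e) := by gcongr
      _ = _ := by
        rw [← ENNReal.ofReal_mul (by positivity), ← ENNReal.ofReal_mul (by positivity)]
        congr 1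
        rw [Real.mul_rpow hM0.le hε.le, Real.rpow_sub_one hε.ne']
        field_simp
  exact (ENNReal.mul_le_mul_iff_right (by simpa using by positivity) ENNReal.ofReal_ne_top).1 hfinal

lemma exists_scales {K ρ e : ℝ} (hK : 1 < K) (he : 1 ≤ e) (h1 : ρ < 1 / (K - 1))
    (h2 : ρ < e / K) : ∃ η : ℝ, 0 < η ∧ η ≤ 1 ∧ ∃ I : ℕ, 1 ≤ I ∧ ∀ i < I,
      ρ ≤ (1 - (i + 1) / (I * K)) / (K - 1) + (e - 1) * (1 - η) * (i / (I * K)) := by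
  have hK0 : 0 < K := by linarith
  have hK1 : 0 < K - 1 := by linarith
  set δ := min (1 / (K - 1) - ρ) (e / K - ρ) with hδ
  have hδ0 : 0 < δ := lt_min (by linarith) (by linarith)
  obtain ⟨I, hI⟩ := exists_nat_ge (max 1 (2 / (K * (K - 1) * δ)))
  have hI1 : (1 : ℝ) ≤ I := (le_max_left _ _).trans hI
  have hI2 : 2 / (K * (K - 1) * δ) ≤ I := (le_max_right _ _).trans hI
  have hI0 : (0 : ℝ) < I := by linarith
  refine ⟨min 1 (δ * K / (2 * e)), by positivity, min_le_left _ _, I, by exact_mod_cast hI1,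
    fun i hi => ?_⟩
  set η := min 1 (δ * K / (2 * e)) with hη
  have hη0 : 0 < η := by positivity
  set x : ℝ := i / I with hx
  have hx0 : 0 ≤ x := by positivity
  have hx1 : x ≤ 1 := by
    rw [hx, div_le_one hI0]
    exact_mod_cast hi.le
  have hηe : η * (e - 1) / K ≤ δ / 2 := by
    have h3 : η ≤ δ * K / (2 * e) := min_le_right _ _
    have h4 : η * e ≤ δ * K / 2 := by
      rw [le_div_iff₀ (by positivity)] at h3
      linarith
    rw [div_le_iff₀ hK0]
    nlinarith
  have hIδ : 1 / (I * K) / (K - 1) ≤ δ / 2 := by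
    rw [div_le_iff₀ (by positivity)] at hI2
    rw [div_div, div_le_iff₀ (by positivity)]
    nlinarith
  have hexp : (1 - (i + 1) / (I * K)) / (K - 1) + (e - 1) * (1 - η) * (i / (I * K)) =
      (1 - x) * (1 / (K - 1)) + x * (e / K) - 1 / (I * K) / (K - 1) -
        x * (η * (e - 1) / K) := by
    rw [hx]
    field_simp
    ring
  rw [hexp]
  have h5 : x * (η * (e - 1) / K) ≤ δ / 2 := by
    have : 0 ≤ η * (e - 1) / K := div_nonneg (mul_nonneg hη0.le (by linarith)) hK0.le
    nlinarith
  have h6 : ρ + δ ≤ 1 / (K - 1) := by linarith [min_le_left (1 / (K - 1) - ρ) (e / K - ρ)]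
  have h7 : ρ + δ ≤ e / K := by linarith [min_le_right (1 / (K - 1) - ρ) (e / K - ρ)]
  nlinarith

/-- The region estimate at a single scale. -/
lemma enorm_setIntegral_scale_le {U D : Set (Fin d → ℝ)} (hU : IsOpen U)
    (hD : IsSemianalytic U D) {F B : (Fin d → ℝ) → ℝ} (hF : AnalyticOnNhd ℝ F U)
    {p : Fin d → ℝ} (hp : p ∈ U) (hB : AnalyticAt ℝ B p) (v : Fin d → ℝ) (b : ℕ) {η : ℝ}
    (hη0 : 0 < η) (hη1 : η ≤ 1) {e R C₀ : ℝ} (hR : 0 < R) (hC₀ : 0 < C₀)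
    (hvol : ∀ ε > 0, volume {x ∈ Metric.ball p R |
      |listDeriv (List.replicate (b + 1) v) F x| ≤ ε ∧ |B x| ≤ ε} ≤ ENNReal.ofReal (C₀ * ε ^ e)) :
    ∃ r₀ > 0, ∀ r > 0, r ≤ r₀ → ∃ C > 0, ∀ Q ⊆ Metric.ball p r, Convex ℝ Q → MeasurableSet Q →
      ∀ S₁ S₂ : Set ℝ, S₁.OrdConnected → S₂.OrdConnected → ∀ c > 0, (∀ y ∈ S₁, c ≤ |y|) →
      ∀ ε > 0, ε ≤ 1 → (∀ y ∈ S₁, |y| ≤ ε) → (∀ y ∈ S₂, |y| ≤ ε) → ∀ lam : ℝ, lam ≠ 0 →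
      ‖∫ x in {x ∈ D ∩ Q | listDeriv (List.replicate (b + 1) v) F x ∈ S₁ ∧ B x ∈ S₂},
        Complex.exp (Complex.I * lam * F x)‖ ≤
      C * (|lam| * c) ^ (-((1 : ℝ) / ((b + 1 : ℕ) : ℝ))) * ε ^ ((e - 1) * (1 - η)) := by
  obtain ⟨r₁, hr₁, h1⟩ := enorm_setIntegral_region_le hU hD hF hp hB v b hη0 hη1
  obtain ⟨r₂, hr₂, h2⟩ := volume_tube_le (analyticAt_listDeriv (hF p hp) _) hB v hR hC₀ hvol
  refine ⟨min r₁ r₂, by positivity, fun r hr hrr => ?_⟩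
  obtain ⟨C₁, hC₁, h1⟩ := h1 r hr (hrr.trans (min_le_left _ _))
  obtain ⟨C₂, hC₂, h2⟩ := h2 r hr (hrr.trans (min_le_right _ _))
  refine ⟨C₁ * C₂ ^ (1 - η), by positivity, fun Q hQ hQc hQm S₁ S₂ hS₁ hS₂ c hc hcS ε hε hε1 hS₁ε
    hS₂ε lam hlam => ?_⟩
  have hlam' : 0 < |lam| := abs_pos.2 hlam
  have h3 := h1 Q hQ hQc hQm S₁ S₂ hS₁ hS₂ c hc hcS lam hlam
    {x ∈ Metric.ball p (r + r) | ∃ t ∈ Icc (-(r / (‖v‖ + 1))) (r / (‖v‖ + 1)),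
      |listDeriv (List.replicate (b + 1) v) F (x + t • v)| ≤ ε ∧ |B (x + t • v)| ≤ ε}
    fun x hx t ht hA hB => hx.2 ⟨hx.1, t, ht, hS₁ε _ hA, hS₂ε _ hB⟩
  have h1η : 0 ≤ 1 - η := by linarith
  have h4 := h3.trans (mul_le_mul_right (ENNReal.rpow_le_rpow (h2 ε hε hε1) h1η) _)
  rw [ENNReal.ofReal_rpow_of_nonneg (by positivity) h1η, ← ENNReal.ofReal_mul (by positivity),
    ← ofReal_norm] at h4
  refine ((ENNReal.ofReal_le_ofReal_iff (by positivity)).1 h4).trans (le_of_eq ?_)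
  rw [Real.mul_rpow hC₂.le (by positivity), ← Real.rpow_mul hε.le]
  ring

lemma integrableOn_exp {F : (Fin d → ℝ) → ℝ} {p : Fin d → ℝ} {R : ℝ}
    (hF : ∀ x ∈ Metric.ball p R, AnalyticAt ℝ F x) {S : Set (Fin d → ℝ)} (hS : MeasurableSet S)
    (hSR : S ⊆ Metric.ball p R) (lam : ℝ) :
    IntegrableOn (fun x => Complex.exp (Complex.I * lam * F x)) S := by
  refine integrableOn_of_bound (((measure_mono hSR).trans_lt measure_ball_lt_top).ne) ?_
    (fun x => (norm_exp_I_mul _ _).le)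
  rw [← aestronglyMeasurable_indicator_iff hS]
  exact (measurable_indicator_exp hF hS hSR lam).aestronglyMeasurable

/-- Local estimate when the best directional derivative alone suffices. -/
lemma exists_norm_setIntegral_le_of_listDeriv {U D : Set (Fin d → ℝ)} (hU : IsOpen U)
    (hD : IsSemianalytic U D) {F : (Fin d → ℝ) → ℝ} (hF : AnalyticOnNhd ℝ F U)
    {p : Fin d → ℝ} (hp : p ∈ U) (v : Fin d → ℝ) (b : ℕ)
    (hb : listDeriv (List.replicate (b + 1) v) F p ≠ 0) :
    ∃ r > 0, ∃ C > 0, ∀ Q ⊆ Metric.ball p r, Convex ℝ Q → MeasurableSet Q → ∀ lam : ℝ, lam ≠ 0 →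
      ‖∫ x in D ∩ Q, Complex.exp (Complex.I * lam * F x)‖ ≤
        C * |lam| ^ (-((1 : ℝ) / ((b + 1 : ℕ) : ℝ))) := by
  set A := listDeriv (List.replicate (b + 1) v) F with hA
  have hAp : AnalyticAt ℝ A p := analyticAt_listDeriv (hF p hp) _
  obtain ⟨r₁, hr₁, h1⟩ := enorm_setIntegral_region_le hU hD hF hp (B := fun _ => 0)
    analyticAt_const v b one_pos le_rfl
  have hS : ∃ S : Set ℝ, S.OrdConnected ∧ (∀ y ∈ S, |A p| / 2 ≤ |y|) ∧ ∀ᶠ x in 𝓝 p, A x ∈ S := by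
    rcases lt_or_gt_of_ne hb with h | h
    · refine ⟨Iic (A p / 2), ordConnected_Iic, fun y hy => ?_, ?_⟩
      · rw [abs_of_neg h, abs_of_neg (lt_of_le_of_lt hy (by linarith))]
        linarith [mem_Iic.1 hy]
      · exact hAp.continuousAt.eventually (Iic_mem_nhds (by linarith))
    · refine ⟨Ici (A p / 2), ordConnected_Ici, fun y hy => ?_, ?_⟩
      · rw [abs_of_pos h, abs_of_pos (lt_of_lt_of_le (by linarith) (mem_Ici.1 hy))]
        exact hy
      · exact hAp.continuousAt.eventually (Ici_mem_nhds (by linarith))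
  obtain ⟨S, hSo, hSc, hSA⟩ := hS
  obtain ⟨r₂, hr₂, h2⟩ := Metric.eventually_nhds_iff_ball.1 hSA
  have hc : 0 < |A p| / 2 := by have := abs_pos.2 hb; positivity
  obtain ⟨C, hC, h1⟩ := h1 (min r₁ r₂) (by positivity) (min_le_left _ _)
  refine ⟨min r₁ r₂, by positivity, C * (|A p| / 2) ^ (-((1 : ℝ) / ((b + 1 : ℕ) : ℝ))),
    by positivity, fun Q hQ hQc hQm lam hlam => ?_⟩
  have h3 := h1 Q hQ hQc hQm S univ hSo ordConnected_univ _ hc hSc lam hlam univ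
    fun x hx => absurd (mem_univ x) hx.2
  have hset : {x ∈ D ∩ Q | A x ∈ S ∧ (0 : ℝ) ∈ univ} = D ∩ Q := by
    ext x
    refine ⟨fun h => h.1, fun h => ⟨h, ?_, mem_univ _⟩⟩
    exact h2 x (Metric.ball_subset_ball (min_le_right _ _) (hQ h.2))
  rw [hset, sub_self, ENNReal.rpow_zero, mul_one, ← ofReal_norm] at h3
  refine ((ENNReal.ofReal_le_ofReal_iff (by positivity)).1 h3).trans (le_of_eq ?_)
  rw [Real.mul_rpow (abs_nonneg _) hc.le]
  ring

end LocalEstimate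

section MultiScale

open Filter Topology Set

variable {d : ℕ}

lemma norm_setIntegral_union_le {X : Type*} [MeasurableSpace X] {μ : Measure X} {S T : Set X}
    {f : X → ℂ} (hd : Disjoint S T) (hT : MeasurableSet T) (hS : IntegrableOn f S μ)
    (hfT : IntegrableOn f T μ) :
    ‖∫ x in S ∪ T, f x ∂μ‖ ≤ ‖∫ x in S, f x ∂μ‖ + ‖∫ x in T, f x ∂μ‖ := by
  rw [setIntegral_union hd hT hS hfT]
  exact norm_add_le _ _

lemma norm_setIntegral_Icc_le {X : Type*} [MeasurableSpace X] {μ : Measure X} {E : Set X}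
    {f : X → ℂ} {A B : X → ℝ} (hf : IntegrableOn f E μ)
    (hm : ∀ S T : Set ℝ, MeasurableSet S → MeasurableSet T →
      MeasurableSet {x ∈ E | A x ∈ S ∧ B x ∈ T}) {δ ε : ℝ} (hδ : 0 ≤ δ) (hδε : δ ≤ ε)
    {T : Set ℝ} (hT : MeasurableSet T) :
    ‖∫ x in {x ∈ E | A x ∈ Icc (-ε) ε ∧ B x ∈ T}, f x ∂μ‖ ≤
      ‖∫ x in {x ∈ E | A x ∈ Icc (-δ) δ ∧ B x ∈ T}, f x ∂μ‖ +
      ‖∫ x in {x ∈ E | A x ∈ Ioc δ ε ∧ B x ∈ T}, f x ∂μ‖ +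
      ‖∫ x in {x ∈ E | A x ∈ Ico (-ε) (-δ) ∧ B x ∈ T}, f x ∂μ‖ := by
  have hint : ∀ S : Set ℝ, IntegrableOn f {x ∈ E | A x ∈ S ∧ B x ∈ T} μ := fun S =>
    hf.mono_set fun x hx => hx.1
  have hset : {x ∈ E | A x ∈ Icc (-ε) ε ∧ B x ∈ T} =
      ({x ∈ E | A x ∈ Icc (-δ) δ ∧ B x ∈ T} ∪ {x ∈ E | A x ∈ Ioc δ ε ∧ B x ∈ T}) ∪
      {x ∈ E | A x ∈ Ico (-ε) (-δ) ∧ B x ∈ T} := by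
    ext x
    simp only [mem_ofPred_eq, mem_union, mem_Icc, mem_Ioc, mem_Ico]
    constructor
    · rintro ⟨h1, ⟨h2, h3⟩, h4⟩
      rcases lt_or_ge (A x) (-δ) with h | h
      · exact Or.inr ⟨h1, ⟨h2, h⟩, h4⟩
      · rcases lt_or_ge δ (A x) with h' | h'
        · exact Or.inl (Or.inr ⟨h1, ⟨h', h3⟩, h4⟩)
        · exact Or.inl (Or.inl ⟨h1, ⟨h, h'⟩, h4⟩)
    · rintro ((⟨h1, ⟨h2, h3⟩, h4⟩ | ⟨h1, ⟨h2, h3⟩, h4⟩) | ⟨h1, ⟨h2, h3⟩, h4⟩)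
      · exact ⟨h1, ⟨by linarith, by linarith⟩, h4⟩
      · exact ⟨h1, ⟨by linarith, by linarith⟩, h4⟩
      · exact ⟨h1, ⟨by linarith, by linarith⟩, h4⟩
  rw [hset]
  have hd1 : Disjoint {x ∈ E | A x ∈ Icc (-δ) δ ∧ B x ∈ T}
      {x ∈ E | A x ∈ Ioc δ ε ∧ B x ∈ T} :=
    Set.disjoint_left.2 fun x hx hx' => not_lt.2 hx.2.1.2 hx'.2.1.1
  have hd2 : Disjoint ({x ∈ E | A x ∈ Icc (-δ) δ ∧ B x ∈ T} ∪
      {x ∈ E | A x ∈ Ioc δ ε ∧ B x ∈ T}) {x ∈ E | A x ∈ Ico (-ε) (-δ) ∧ B x ∈ T} := by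
    refine Set.disjoint_left.2 fun x hx hx' => ?_
    have h1 : A x < -δ := hx'.2.1.2
    rcases hx with hx | hx
    · exact absurd hx.2.1.1 (not_le.2 h1)
    · exact absurd hx.2.1.1 (not_lt.2 (by linarith))
  refine (norm_setIntegral_union_le hd2 (hm _ _ measurableSet_Ico hT)
    ((hint _).union (hint _)) (hint _)).trans ?_
  gcongr
  exact norm_setIntegral_union_le hd1 (hm _ _ measurableSet_Ioc hT) (hint _) (hint _)

lemma rpow_scale_le {Λ s t E ρ m n : ℝ} (hΛ : 1 ≤ Λ) (hm : 0 < m) (hmn : m ≤ n) (ht : t ≤ 1)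
    (h : ρ ≤ (1 - t) / n + E * s) :
    (Λ * Λ ^ (-t)) ^ (-(1 / m)) * (Λ ^ (-s)) ^ E ≤ Λ ^ (-ρ) := by
  have hΛ0 : 0 < Λ := by linarith
  have h1 : Λ * Λ ^ (-t) = Λ ^ (1 - t) := by
    rw [sub_eq_add_neg, Real.rpow_add hΛ0, Real.rpow_one]
  rw [h1, ← Real.rpow_mul hΛ0.le, ← Real.rpow_mul hΛ0.le, ← Real.rpow_add hΛ0]
  refine Real.rpow_le_rpow_of_exponent_le hΛ ?_
  have h2 : (1 - t) / n ≤ (1 - t) / m :=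
    div_le_div_of_nonneg_left (by linarith) hm hmn
  have h3 : (1 - t) * -(1 / m) = -((1 - t) / m) := by ring
  rw [h3]
  linarith

/-- Local estimate from a joint sublevel bound for two directional derivatives. -/
lemma exists_norm_setIntegral_le_of_sublevel {U D : Set (Fin d → ℝ)} (hU : IsOpen U)
    (hD : IsSemianalytic U D) {F : (Fin d → ℝ) → ℝ} (hF : AnalyticOnNhd ℝ F U)
    {p : Fin d → ℝ} (hp : p ∈ U) (v u : Fin d → ℝ) (b c : ℕ) (hcb : c ≤ b)
    (hv : listDeriv (List.replicate (b + 1) v) F p = 0)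
    (hu : listDeriv (List.replicate (c + 1) u) F p = 0) {e R C₀ ρ : ℝ} (he : 1 ≤ e)
    (hR : 0 < R) (hC₀ : 0 < C₀)
    (hvol : ∀ ε > 0, volume {x ∈ Metric.ball p R |
      |listDeriv (List.replicate (b + 1) v) F x| ≤ ε ∧
      |listDeriv (List.replicate (c + 1) u) F x| ≤ ε} ≤ ENNReal.ofReal (C₀ * ε ^ e))
    (hρ1 : ρ < 1 / ((b : ℝ) + 1)) (hρ2 : ρ < e / ((b : ℝ) + 2)) :
    ∃ r > 0, ∃ C > 0, ∀ Q ⊆ Metric.ball p r, Convex ℝ Q → MeasurableSet Q → ∀ lam : ℝ,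
      1 ≤ |lam| → ‖∫ x in D ∩ Q, Complex.exp (Complex.I * lam * F x)‖ ≤ C * |lam| ^ (-ρ) := by
  have hKb : (b : ℝ) + 2 - 1 = b + 1 := by ring
  obtain ⟨η, hη0, hη1, I, hI, hscale⟩ := exists_scales (K := (b : ℝ) + 2) (ρ := ρ) (e := e)
    (by linarith [(Nat.cast_nonneg b : (0 : ℝ) ≤ b)]) he (by rwa [hKb]) hρ2
  rw [hKb] at hscale
  set A := listDeriv (List.replicate (b + 1) v) F with hA
  set B := listDeriv (List.replicate (c + 1) u) F with hB
  have hAp : AnalyticAt ℝ A p := analyticAt_listDeriv (hF p hp) _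
  have hBp : AnalyticAt ℝ B p := analyticAt_listDeriv (hF p hp) _
  obtain ⟨r₁, hr₁, h1⟩ := enorm_setIntegral_scale_le hU hD hF hp hBp v b hη0 hη1 hR hC₀ hvol
  obtain ⟨r₂, hr₂, h2⟩ := enorm_setIntegral_scale_le hU hD hF hp hAp u c hη0 hη1 hR hC₀
    (by simpa only [and_comm] using hvol)
  obtain ⟨r₃, hr₃, hFa⟩ := exists_ball_analyticAt (hF p hp)
  have hsmall : ∀ᶠ x in 𝓝 p, |A x| < 1 ∧ |B x| < 1 := by
    refine (hAp.continuousAt.abs.eventually_lt_const ?_).and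
      (hBp.continuousAt.abs.eventually_lt_const ?_)
    · show |A p| < 1
      rw [hv]; simp
    · show |B p| < 1
      rw [hu]; simp
  obtain ⟨r₄, hr₄, h4⟩ := Metric.eventually_nhds_iff_ball.1 hsmall
  set r := min R (min r₁ (min r₂ (min r₃ r₄))) with hr
  have hr0 : 0 < r := by positivity
  obtain ⟨hrR, hrr₁, hrr₂, hrr₃, hrr₄⟩ : r ≤ R ∧ r ≤ r₁ ∧ r ≤ r₂ ∧ r ≤ r₃ ∧ r ≤ r₄ := by
    simpa only [le_min_iff] using hr.le
  obtain ⟨C₁, hC₁, h1⟩ := h1 r hr0 hrr₁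
  obtain ⟨C₂, hC₂, h2⟩ := h2 r hr0 hrr₂
  refine ⟨r, hr0, C₀ + I * (2 * C₁ + 2 * C₂), by positivity,
    fun Q hQ hQc hQm lam hlam1 => ?_⟩
  set Λ := |lam| with hΛ
  have hΛ0 : 0 < Λ := by linarith
  have hlam : lam ≠ 0 := abs_pos.1 hΛ0
  have hFr : ∀ x ∈ Metric.ball p r, AnalyticAt ℝ F x := fun x hx =>
    hFa x (Metric.ball_subset_ball hrr₃ hx)
  have hE : MeasurableSet (D ∩ Q) := (hD.measurableSet hU).inter hQm
  have hEr : D ∩ Q ⊆ Metric.ball p r := fun x hx => hQ hx.2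
  have hint := integrableOn_exp hFr hE hEr lam
  set φ : (Fin d → ℝ) → ℂ := fun x => Complex.exp (Complex.I * lam * F x) with hφ
  set sc : ℕ → ℝ := fun i => Λ ^ (-((i : ℝ) / (I * ((b : ℝ) + 2)))) with hsc
  have hsc0 : ∀ i, 0 < sc i := fun i => by positivity
  have hscanti : ∀ i, sc (i + 1) ≤ sc i := fun i => by
    refine Real.rpow_le_rpow_of_exponent_le hlam1 ?_
    push_cast
    gcongr
    linarith
  have hsc1 : ∀ i, sc i ≤ 1 := fun i => by
    refine Real.rpow_le_one_of_one_le_of_nonpos hlam1 ?_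
    rw [neg_nonpos]
    positivity
  have hmAB : ∀ S T : Set ℝ, MeasurableSet S → MeasurableSet T →
      MeasurableSet {x ∈ D ∩ Q | A x ∈ S ∧ B x ∈ T} := fun S T hS hT =>
    measurableSet_region hE hEr (fun x hx => analyticAt_listDeriv (hFr x hx) _)
      (fun x hx => analyticAt_listDeriv (hFr x hx) _) hS hT
  have hmBA : ∀ S T : Set ℝ, MeasurableSet S → MeasurableSet T →
      MeasurableSet {x ∈ D ∩ Q | B x ∈ S ∧ A x ∈ T} := fun S T hS hT =>
    measurableSet_region hE hEr (fun x hx => analyticAt_listDeriv (hFr x hx) _)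
      (fun x hx => analyticAt_listDeriv (hFr x hx) _) hS hT
  have hIoc : ∀ i, ∀ y ∈ Ioc (sc (i + 1)) (sc i), sc (i + 1) ≤ |y| ∧ |y| ≤ sc i := by
    intro i y hy
    rw [abs_of_pos ((hsc0 _).trans hy.1)]
    exact ⟨hy.1.le, hy.2⟩
  have hIco : ∀ i, ∀ y ∈ Ico (-(sc i)) (-(sc (i + 1))), sc (i + 1) ≤ |y| ∧ |y| ≤ sc i := by
    intro i y hy
    rw [abs_of_neg (hy.2.trans (neg_neg_of_pos (hsc0 _)))]
    exact ⟨by linarith [hy.2], by linarith [hy.1]⟩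
  have hpow : ∀ i < I, ∀ n : ℕ, n ≤ b → (Λ * sc (i + 1)) ^ (-((1 : ℝ) / ((n + 1 : ℕ) : ℝ))) *
      (sc i) ^ ((e - 1) * (1 - η)) ≤ Λ ^ (-ρ) := by
    intro i hi n hn
    refine rpow_scale_le hlam1 (n := (b : ℝ) + 1) (by positivity) ?_ ?_ ?_
    · push_cast
      gcongr
    · have hI0 : (0 : ℝ) < I := by exact_mod_cast hI
      have h5 : ((i + 1 : ℕ) : ℝ) ≤ I := by exact_mod_cast hi
      rw [div_le_one (by positivity)]
      nlinarith [(Nat.cast_nonneg b : (0 : ℝ) ≤ b)]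
    · have := hscale i hi
      push_cast
      exact this
  have hstep : ∀ i < I,
      ‖∫ x in {x ∈ D ∩ Q | A x ∈ Icc (-(sc i)) (sc i) ∧ B x ∈ Icc (-(sc i)) (sc i)}, φ x‖ ≤
      ‖∫ x in {x ∈ D ∩ Q | A x ∈ Icc (-(sc (i + 1))) (sc (i + 1)) ∧
        B x ∈ Icc (-(sc (i + 1))) (sc (i + 1))}, φ x‖ + (2 * C₁ + 2 * C₂) * Λ ^ (-ρ) := by
    intro i hi
    have a1 := norm_setIntegral_Icc_le hint hmAB (hsc0 (i + 1)).le (hscanti i)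
      (T := Icc (-(sc i)) (sc i)) measurableSet_Icc
    have a2 := norm_setIntegral_Icc_le hint hmBA (hsc0 (i + 1)).le (hscanti i)
      (T := Icc (-(sc (i + 1))) (sc (i + 1))) measurableSet_Icc
    have hcomm : ∀ S T : Set ℝ, {x ∈ D ∩ Q | B x ∈ S ∧ A x ∈ T} =
        {x ∈ D ∩ Q | A x ∈ T ∧ B x ∈ S} := fun S T => by
      ext x; simp only [mem_ofPred_eq, and_comm]
    rw [hcomm (Icc _ _), hcomm (Icc _ _)] at a2
    have hb1 : ∀ S : Set ℝ, S.OrdConnected →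
        (∀ y ∈ S, sc (i + 1) ≤ |y| ∧ |y| ≤ sc i) →
        ‖∫ x in {x ∈ D ∩ Q | A x ∈ S ∧ B x ∈ Icc (-(sc i)) (sc i)}, φ x‖ ≤
          C₁ * Λ ^ (-ρ) := by
      intro S hS hS'
      refine (h1 Q hQ hQc hQm S (Icc (-(sc i)) (sc i)) hS ordConnected_Icc (sc (i + 1)) (hsc0 _)
        (fun y hy => (hS' y hy).1) (sc i) (hsc0 i) (hsc1 i) (fun y hy => (hS' y hy).2)
        (fun y hy => abs_le.2 hy) lam hlam).trans ?_
      rw [mul_assoc]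
      exact mul_le_mul_of_nonneg_left (hpow i hi b le_rfl) hC₁.le
    have hb2 : ∀ S : Set ℝ, S.OrdConnected →
        (∀ y ∈ S, sc (i + 1) ≤ |y| ∧ |y| ≤ sc i) →
        ‖∫ x in {x ∈ D ∩ Q | B x ∈ S ∧ A x ∈ Icc (-(sc (i + 1))) (sc (i + 1))}, φ x‖ ≤
          C₂ * Λ ^ (-ρ) := by
      intro S hS hS'
      refine (h2 Q hQ hQc hQm S (Icc (-(sc (i + 1))) (sc (i + 1))) hS ordConnected_Icc
        (sc (i + 1)) (hsc0 _) (fun y hy => (hS' y hy).1) (sc i) (hsc0 i) (hsc1 i)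
        (fun y hy => (hS' y hy).2) (fun y hy => (abs_le.2 hy).trans (hscanti i)) lam hlam).trans ?_
      rw [mul_assoc]
      exact mul_le_mul_of_nonneg_left (hpow i hi c hcb) hC₂.le
    have a3 := hb1 _ ordConnected_Ioc (hIoc i)
    have a4 := hb1 _ ordConnected_Ico (hIco i)
    have a5 := hb2 _ ordConnected_Ioc (hIoc i)
    have a6 := hb2 _ ordConnected_Ico (hIco i)
    linarith
  have hiter : ∀ i ≤ I, ‖∫ x in D ∩ Q, φ x‖ ≤
      ‖∫ x in {x ∈ D ∩ Q | A x ∈ Icc (-(sc i)) (sc i) ∧ B x ∈ Icc (-(sc i)) (sc i)}, φ x‖ +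
        i * ((2 * C₁ + 2 * C₂) * Λ ^ (-ρ)) := by
    intro i
    induction i with
    | zero =>
      intro _
      have hsc00 : sc 0 = 1 := by simp [hsc]
      have : {x ∈ D ∩ Q | A x ∈ Icc (-(sc 0)) (sc 0) ∧ B x ∈ Icc (-(sc 0)) (sc 0)} = D ∩ Q := by
        ext x
        refine ⟨fun h => h.1, fun h => ⟨h, ?_⟩⟩
        obtain ⟨h5, h6⟩ := h4 x (Metric.ball_subset_ball hrr₄ (hEr h))
        rw [hsc00]
        exact ⟨abs_le.1 h5.le, abs_le.1 h6.le⟩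
      rw [this]
      simp
    | succ i ih =>
      intro hi
      have a1 := ih (by omega)
      have a2 := hstep i (by omega)
      push_cast
      linarith
  have hlast : ‖∫ x in {x ∈ D ∩ Q | A x ∈ Icc (-(sc I)) (sc I) ∧ B x ∈ Icc (-(sc I)) (sc I)},
      φ x‖ ≤ C₀ * Λ ^ (-ρ) := by
    have hI0 : (0 : ℝ) < I := by exact_mod_cast hI
    have hsub : {x ∈ D ∩ Q | A x ∈ Icc (-(sc I)) (sc I) ∧ B x ∈ Icc (-(sc I)) (sc I)} ⊆
        {x ∈ Metric.ball p R | |A x| ≤ sc I ∧ |B x| ≤ sc I} := fun x hx =>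
      ⟨Metric.ball_subset_ball hrR (hEr hx.1), abs_le.2 hx.2.1, abs_le.2 hx.2.2⟩
    have hv1 := (measure_mono hsub).trans (hvol (sc I) (hsc0 I))
    have hle := norm_setIntegral_le_of_norm_le_const (μ := volume) (f := φ)
      (hv1.trans_lt ENNReal.ofReal_lt_top) (C := 1) fun x _ => (norm_exp_I_mul _ _).le
    refine hle.trans ?_
    rw [one_mul]
    refine (ENNReal.toReal_mono ENNReal.ofReal_ne_top hv1).trans ?_
    rw [ENNReal.toReal_ofReal (by have := hsc0 I; positivity)]
    gcongr
    rw [hsc, ← Real.rpow_mul hΛ0.le]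
    refine Real.rpow_le_rpow_of_exponent_le hlam1 ?_
    have : -((I : ℝ) / (I * (b + 2))) * e = -(e / (b + 2)) := by field_simp
    rw [this]
    linarith
  have := hiter I le_rfl
  nlinarith

end MultiScale

section Main

open Filter Topology Set

variable {d α : ℕ} {β : Fin d → ℕ} {L : ((Fin d → ℝ) → ℝ) → (Fin d → ℝ) → ℝ}

/-- The oscillatory integral estimate near a point where `L F` does not vanish. -/
lemma IsAdmissible.exists_norm_setIntegral_le (hL : IsAdmissible d α β L)
    (hne : ¬(α = 1 ∧ β = 0)) {U D : Set (Fin d → ℝ)} (hU : IsOpen U)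
    (hD : IsSemianalytic U D) {F : (Fin d → ℝ) → ℝ} (hF : AnalyticOnNhd ℝ F U)
    {p : Fin d → ℝ} (hp : p ∈ U) (hLF : L F p ≠ 0) :
    ∃ r > 0, ∃ C > 0, ∀ Q ⊆ Metric.ball p r, Convex ℝ Q → MeasurableSet Q → ∀ lam : ℝ,
      1 ≤ |lam| → ‖∫ x in D ∩ Q, Complex.exp (Complex.I * lam * F x)‖ ≤
        C * |lam| ^ (-((α : ℝ) / (((∑ i, β i : ℕ) : ℝ) + 1 - α))) := by
  classical
  have hα : (1 : ℝ) ≤ α := by exact_mod_cast hL.one_le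
  have hαβ : (α : ℝ) ≤ ((∑ i, β i : ℕ) : ℝ) := by exact_mod_cast hL.le_sum hne
  set m : ℝ := ((∑ i, β i : ℕ) : ℝ) + 1 - α with hm
  have hm1 : 1 ≤ m := by linarith
  have hm0 : 0 < m := by linarith
  have hα0 : (0 : ℝ) < α := by linarith
  obtain ⟨w, j, hj1, hjα, hw⟩ := hL.exists_listDeriv_ne_zero hne (hF p hp) hLF
  have hex : ∃ k, 1 ≤ k ∧ ∃ w, listDeriv (List.replicate k w) F p ≠ 0 := ⟨j, hj1, w, hw⟩
  obtain ⟨k, hk, hkmin⟩ : ∃ k, (1 ≤ k ∧ ∃ w, listDeriv (List.replicate k w) F p ≠ 0) ∧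
      ∀ i < k, ¬(1 ≤ i ∧ ∃ w, listDeriv (List.replicate i w) F p ≠ 0) :=
    ⟨Nat.find hex, Nat.find_spec hex, fun i hi => Nat.find_min hex hi⟩
  obtain ⟨hk1, v, hv⟩ := hk
  have hmin : ∀ (w : Fin d → ℝ) (i : ℕ), 1 ≤ i → i < k →
      listDeriv (List.replicate i w) F p = 0 := fun w i hi hik => by
    by_contra h
    exact hkmin i hik ⟨hi, w, h⟩
  have hkj : k ≤ j := by
    by_contra h
    exact hkmin j (not_le.1 h) ⟨hj1, w, hw⟩
  have hkα : (k : ℝ) * α ≤ ((∑ i, β i : ℕ) : ℝ) := by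
    exact_mod_cast (Nat.mul_le_mul_right α hkj).trans hjα
  rcases le_or_gt ((k : ℝ) * α) m with hcase | hcase
  · obtain ⟨b, rfl⟩ : ∃ b, k = b + 1 := ⟨k - 1, by omega⟩
    obtain ⟨r, hr, C, hC, h⟩ := exists_norm_setIntegral_le_of_listDeriv hU hD hF hp v b hv
    refine ⟨r, hr, C, hC, fun Q hQ hQc hQm lam hlam => ?_⟩
    refine (h Q hQ hQc hQm lam (abs_pos.1 (by linarith))).trans ?_
    refine mul_le_mul_of_nonneg_left (Real.rpow_le_rpow_of_exponent_le hlam ?_) hC.le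
    rw [neg_le_neg_iff, div_le_div_iff₀ hm0 (by positivity)]
    linarith
  · set θ : ℝ := k - m / α with hθ
    have hmα : 0 < m / α := by positivity
    have hθ0 : 0 < θ := by
      rw [hθ, sub_pos, div_lt_iff₀ hα0]
      exact hcase
    have hk' : (k : ℝ) - 1 < m / α := by
      rw [lt_div_iff₀ hα0]
      linarith
    obtain ⟨u, i, hi1, hik, e, he, hke, R, hR, C₀, hC₀, hvol⟩ :=
      hL.exists_volume_sublevel_le hne (hF p hp) hLF hk1 hmin hv hθ0 (by linarith)
        (by rw [hθ, sub_mul, div_mul_cancel₀ _ hα0.ne'])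
    obtain ⟨b, rfl⟩ : ∃ b, k = b + 2 := ⟨k - 2, by omega⟩
    obtain ⟨c, rfl⟩ : ∃ c, i = c + 1 := ⟨i - 1, by omega⟩
    have hρ : (α : ℝ) / m = 1 / (m / α) := by rw [one_div_div]
    push_cast at hk' hke
    refine exists_norm_setIntegral_le_of_sublevel hU hD hF hp v u b c (by omega)
      (hmin v (b + 1) (by omega) (by omega)) (hmin u (c + 1) (by omega) hik) he hR hC₀ hvol ?_ ?_
    · rw [hρ]
      exact one_div_lt_one_div_of_lt (by positivity) (by linarith)
    · have h2 : ((b : ℝ) + 2) - θ = m / α := by rw [hθ]; push_cast; ring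
      rw [h2] at hke
      rw [hρ, div_lt_div_iff₀ hmα (by positivity)]
      linarith

/-- Uniform estimates on small convex cells add up to an estimate on a whole box. -/
lemma exists_norm_setIntegral_box_le {D : Set (Fin d → ℝ)} (hDm : MeasurableSet D)
    {f : ℝ → (Fin d → ℝ) → ℂ} (hint : ∀ lam, IntegrableOn (f lam) D) {g : ℝ → ℝ}
    (I : BoxIntegral.Box (Fin d))
    (hloc : ∀ p ∈ closure D, ∃ r > 0, ∃ C > 0, ∀ Q ⊆ Metric.ball p r, Convex ℝ Q →
      MeasurableSet Q → ∀ lam : ℝ, 1 ≤ |lam| → ‖∫ x in D ∩ Q, f lam x‖ ≤ C * g lam) :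
    ∃ C ≥ 0, ∀ lam : ℝ, 1 ≤ |lam| → ‖∫ x in D ∩ I, f lam x‖ ≤ C * g lam := by
  induction I using BoxIntegral.Box.subbox_induction_on' with
  | H_ind J hJ ih =>
    choose C hC0 hC using ih
    refine ⟨∑ s, C s, Finset.sum_nonneg fun s _ => hC0 s, fun lam hlam => ?_⟩
    have hU : D ∩ (J : Set (Fin d → ℝ)) = ⋃ s, D ∩ (J.splitCenterBox s : Set (Fin d → ℝ)) := by
      rw [← inter_iUnion, BoxIntegral.Box.iUnion_coe_splitCenterBox]
    rw [hU, integral_iUnion_fintype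
      (fun s => hDm.inter (J.splitCenterBox s).measurableSet_coe)
      (fun s t hst => (J.disjoint_splitCenterBox hst).mono inter_subset_right inter_subset_right)
      (fun s => (hint lam).mono_set inter_subset_left), Finset.sum_mul]
    exact (norm_sum_le _ _).trans (Finset.sum_le_sum fun s _ => hC s lam hlam)
  | H_nhds z hz =>
    by_cases hzD : z ∈ closure D
    · obtain ⟨r, hr, C, hC, h⟩ := hloc z hzD
      refine ⟨Metric.ball z r, mem_nhdsWithin_of_mem_nhds (Metric.ball_mem_nhds z hr),
        fun J _ _ _ hJ _ => ⟨C, hC.le, ?_⟩⟩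
      refine h J (BoxIntegral.Box.coe_subset_Icc.trans hJ) ?_ J.measurableSet_coe
      rw [BoxIntegral.Box.coe_eq_pi]
      exact convex_pi fun i _ => convex_Ioc _ _
    · refine ⟨(closure D)ᶜ, mem_nhdsWithin_of_mem_nhds
        (isClosed_closure.isOpen_compl.mem_nhds hzD), fun J _ _ _ hJ _ => ⟨0, le_rfl, ?_⟩⟩
      have hempty : D ∩ (J : Set (Fin d → ℝ)) = ∅ := by
        rw [← disjoint_iff_inter_eq_empty, Set.disjoint_left]
        exact fun x hx hxJ => hJ (BoxIntegral.Box.coe_subset_Icc hxJ) (subset_closure hx)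
      intro lam _
      simp [hempty]

end Main

/-- Improved Carbery–Christ–Wright oscillatory integral estimate (Theorem 2 of the paper),
real-analytic case. -/
theorem oscillatory_estimate_admissible
    (d : ℕ) (U : Set (Fin d → ℝ)) (hUopen : IsOpen U) (hUconn : IsConnected U)
    (hcube : Set.Icc (0 : Fin d → ℝ) 1 ⊆ U)
    (F : (Fin d → ℝ) → ℝ) (hF : AnalyticOnNhd ℝ F U)
    (D : Set (Fin d → ℝ)) (hD : D ⊆ Set.Icc (0 : Fin d → ℝ) 1)
    (hDsa : IsSemianalytic U D)
    (α : ℕ) (β : Fin d → ℕ) (L : ((Fin d → ℝ) → ℝ) → (Fin d → ℝ) → ℝ)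
    (hL : IsAdmissible d α β L) (hne : ¬(α = 1 ∧ β = 0)) :
    ∃ C : ℝ, ∀ c : ℝ, 0 < c → (∀ x ∈ D, c ≤ |L F x|) → ∀ lam : ℝ, lam ≠ 0 →
      ‖∫ x in D, Complex.exp (Complex.I * lam * F x)‖ ≤
        C * |lam| ^ (-(α : ℝ) / (((∑ i, β i : ℕ) : ℝ) + 1 - (α : ℝ))) *
          c ^ (-(1 : ℝ) / (((∑ i, β i : ℕ) : ℝ) + 1 - (α : ℝ))) := by
  by_cases hc₀ : ∃ c₀ : ℝ, 0 < c₀ ∧ ∀ x ∈ D, c₀ ≤ |L F x|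
  swap
  · exact ⟨0, fun c hc h => absurd ⟨c, hc, h⟩ hc₀⟩
  obtain ⟨c₀, hc₀, hLD⟩ := hc₀
  rcases D.eq_empty_or_nonempty with rfl | ⟨x₀, hx₀⟩
  · exact ⟨0, fun c _ _ lam _ => by simp⟩
  have hα : (1 : ℝ) ≤ α := by exact_mod_cast hL.one_le
  have hαβ : (α : ℝ) ≤ ((∑ i, β i : ℕ) : ℝ) := by exact_mod_cast hL.le_sum hne
  have hDm := hDsa.measurableSet hUopen
  have hvol : volume D ≤ 1 := by
    refine (measure_mono hD).trans (le_of_eq ?_)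
    rw [Real.volume_Icc_pi]
    simp
  have hDtop : volume D < ⊤ := hvol.trans_lt ENNReal.one_lt_top
  have hclosure : closure D ⊆ U := (closure_minimal hD isClosed_Icc).trans hcube
  have hmeas : ∀ lam : ℝ, IntegrableOn (fun x => Complex.exp (Complex.I * lam * F x)) D := by
    intro lam
    refine integrableOn_of_bound hDtop.ne ?_ (fun x => (norm_exp_I_mul _ _).le)
    refine ContinuousOn.aestronglyMeasurable ?_ hDm
    have hFc : ContinuousOn F D := fun x hx =>
      (hF x (hclosure (subset_closure hx))).continuousAt.continuousWithinAt
    fun_prop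
  have hLne : ∀ p ∈ closure D, L F p ≠ 0 := by
    intro p hp
    have hcont : ContinuousAt (fun x => |L F x|) p :=
      (hL.analyticAt (hF p (hclosure hp))).continuousAt.abs
    have hge : c₀ ≤ |L F p| := by
      obtain ⟨u, hu, hup⟩ := mem_closure_iff_seq_limit.1 hp
      exact ge_of_tendsto' (hcont.tendsto.comp hup) fun n => hLD _ (hu n)
    exact abs_pos.1 (hc₀.trans_le hge)
  set m : ℝ := ((∑ i, β i : ℕ) : ℝ) + 1 - α with hm
  have hm0 : 0 < m := by linarith
  let I : BoxIntegral.Box (Fin d) := ⟨fun _ => -1, fun _ => 1, fun _ => by norm_num⟩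
  obtain ⟨C₀, hC₀, hI⟩ := exists_norm_setIntegral_box_le hDm
    (f := fun lam x => Complex.exp (Complex.I * lam * F x)) hmeas
    (g := fun lam => |lam| ^ (-((α : ℝ) / m))) I fun p hp =>
      hL.exists_norm_setIntegral_le hne hUopen hDsa hF (hclosure hp) (hLne p hp)
  have hDI : D ∩ (I : Set (Fin d → ℝ)) = D := by
    refine Set.inter_eq_left.2 fun x hx => fun i => ?_
    exact ⟨neg_one_lt_zero.trans_le ((hD hx).1 i), (hD hx).2 i⟩
  rw [hDI] at hI
  have hmain : ∀ lam : ℝ, lam ≠ 0 → ‖∫ x in D, Complex.exp (Complex.I * lam * F x)‖ ≤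
      (C₀ + 1) * |lam| ^ (-((α : ℝ) / m)) := by
    intro lam hlam
    rcases le_total 1 |lam| with h | h
    · refine (hI lam h).trans ?_
      gcongr
      linarith
    · have h1 : 1 ≤ |lam| ^ (-((α : ℝ) / m)) :=
        Real.one_le_rpow_of_pos_of_le_one_of_nonpos (abs_pos.2 hlam) h
          (neg_nonpos.2 (by positivity))
      have h2 : ‖∫ x in D, Complex.exp (Complex.I * lam * F x)‖ ≤ 1 * volume.real D :=
        norm_setIntegral_le_of_norm_le_const hDtop fun x _ => (norm_exp_I_mul _ _).le
      have h3 : volume.real D ≤ 1 := ENNReal.toReal_le_of_le_ofReal zero_le_one (by simpa using hvol)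
      nlinarith
  refine ⟨(C₀ + 1) * |L F x₀| ^ (1 / m), fun c hc h lam hlam => (hmain lam hlam).trans ?_⟩
  have hc1 : 0 < |L F x₀| := hc.trans_le (h x₀ hx₀)
  have h1 : 1 ≤ |L F x₀| ^ (1 / m) * c ^ (-(1 : ℝ) / m) := by
    rw [neg_div, Real.rpow_neg hc.le, ← div_eq_mul_inv, one_le_div (by positivity)]
    exact Real.rpow_le_rpow hc.le (h x₀ hx₀) (by positivity)
  rw [neg_div (m : ℝ) (α : ℝ)]
  calc (C₀ + 1) * |lam| ^ (-((α : ℝ) / m))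
      = (C₀ + 1) * |lam| ^ (-((α : ℝ) / m)) * 1 := (mul_one _).symm
    _ ≤ (C₀ + 1) * |lam| ^ (-((α : ℝ) / m)) *
        (|L F x₀| ^ (1 / m) * c ^ (-(1 : ℝ) / m)) := by gcongr
    _ = _ := by ring
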